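/- arXiv:1601.07123 — 2 statements merged into one kernel-verified Lean document; each statement's English description precedes it below -/
import Mathlib

section
/- Suppose that for some integer n ≥ 1 and indices i_0,…,i_n ∈ {1,…,N} one has inf_{y ∈ ℝ^N} det(σ(y)σ(y)^T) > 0, i.e. the vectors V_1(y),…,V_{n+1}(y) span ℝ^N uniformly in y. Then the following Doeblin-type lower bound holds: for every z_0 ∈ ℝ^N there exist z* ∈ ℝ^N, δ_1, δ_2 > 0, β ∈ (0,1) and a C^∞ probability density ν on ℝ^N with support contained in the ball of radius δ_2 around z*, such that K^{n+1}(x, B) ≥ β ∫_B ν(y) dy for every x in the ball of radius δ_1 around z_0 and every Borel set B ⊆ ℝ^N. -/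
open MeasureTheory Set ProbabilityTheory Matrix

noncomputable section

section Flow

variable {E : Type*} [NormedAddCommGroup E] [NormedSpace ℝ E]

/-- The semiflow `γ`, extended to negative times by straight lines of velocity `v`. -/
def extendedFlow (γ : ℝ → E → E) (v : E) (q : ℝ × E) : E :=
  γ (max q.1 0) q.2 + min q.1 0 • v

lemma extendedFlow_of_nonneg (γ : ℝ → E → E) (v : E) {s : ℝ} (hs : 0 ≤ s) (x : E) :
    extendedFlow γ v (s, x) = γ s x := by
  simp [extendedFlow, hs]

variable {b : E → E} {γ : ℝ → E → E} {L : NNReal}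

lemma dist_flow_le (hb : LipschitzWith L b) (hγ0 : ∀ x, γ 0 x = x)
    (hγ : ∀ x t, 0 ≤ t → HasDerivAt (fun s => γ s x) (b (γ t x)) t)
    {t : ℝ} (ht : 0 ≤ t) (x y : E) :
    dist (γ t x) (γ t y) ≤ dist x y * Real.exp (L * t) := by
  have h := dist_le_of_trajectories_ODE (v := fun _ => b) (f := fun s => γ s x)
    (g := fun s => γ s y) (a := 0) (b := t) (δ := dist x y) (fun _ => hb)
    (fun s hs => (hγ x s hs.1).continuousAt.continuousWithinAt)
    (fun s hs => (hγ x s hs.1).hasDerivWithinAt)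
    (fun s hs => (hγ y s hs.1).continuousAt.continuousWithinAt)
    (fun s hs => (hγ y s hs.1).hasDerivWithinAt) (by simp [hγ0]) t ⟨ht, le_rfl⟩
  simpa using h

lemma continuous_flow (hb : LipschitzWith L b) (hγ0 : ∀ x, γ 0 x = x)
    (hγ : ∀ x t, 0 ≤ t → HasDerivAt (fun s => γ s x) (b (γ t x)) t) :
    Continuous fun q : ℝ × E => γ (max q.1 0) q.2 := by
  have key : ∀ T : ℝ, ContinuousOn (fun q : ℝ × E => γ (max q.1 0) q.2) (Iio T ×ˢ univ) := by
    intro T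
    refine continuousOn_prod_of_continuousOn_lipschitzOnWith' _
      (Real.toNNReal (Real.exp (L * max T 0))) (fun s hs => ?_) (fun x _ => ?_)
    · refine LipschitzOnWith.of_dist_le_mul fun x _ y _ => ?_
      rw [Real.coe_toNNReal _ (Real.exp_pos _).le, mul_comm]
      refine (dist_flow_le hb hγ0 hγ (le_max_right s 0) x y).trans ?_
      have : s ≤ T := le_of_lt hs
      gcongr
    · refine Continuous.continuousOn (continuous_iff_continuousAt.2 fun s => ?_)
      exact ContinuousAt.comp (f := fun s : ℝ => max s 0) (g := fun s => γ s x)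
        (hγ x _ (le_max_right _ _)).continuousAt (by fun_prop)
  refine continuous_iff_continuousAt.2 fun q => (key (q.1 + 1)).continuousAt ?_
  exact prod_mem_nhds (Iio_mem_nhds (by linarith)) Filter.univ_mem

lemma continuous_extendedFlow (hb : LipschitzWith L b) (hγ0 : ∀ x, γ 0 x = x)
    (hγ : ∀ x t, 0 ≤ t → HasDerivAt (fun s => γ s x) (b (γ t x)) t) (v : E) :
    Continuous (extendedFlow γ v) :=
  (continuous_flow hb hγ0 hγ).add (by fun_prop)

lemma hasStrictFDerivAt_extendedFlow (hb : LipschitzWith L b) (hγ0 : ∀ x, γ 0 x = x)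
    (hγ : ∀ x t, 0 ≤ t → HasDerivAt (fun s => γ s x) (b (γ t x)) t) (p : E) :
    HasStrictFDerivAt (extendedFlow γ (b p))
      (ContinuousLinearMap.snd ℝ ℝ E + (ContinuousLinearMap.fst ℝ ℝ E).smulRight (b p)) (0, p) := by
  rw [hasStrictFDerivAt_iff_isLittleO, Asymptotics.isLittleO_iff]
  intro ε hε
  have hcont : ContinuousAt (fun q : ℝ × E => b (γ (max q.1 0) q.2)) (0, p) :=
    (hb.continuous.comp (continuous_flow hb hγ0 hγ)).continuousAt
  have hnear : ∀ᶠ q : ℝ × E in nhds (0, p), ‖b (γ (max q.1 0) q.2) - b p‖ ≤ ε / 2 := by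
    have := hcont.eventually (Metric.closedBall_mem_nhds _ (half_pos hε))
    simpa [hγ0, dist_eq_norm] using this
  have hsmall : ∀ᶠ r : ℝ in nhds 0, L * Real.exp (L * r) * r < ε / 2 := by
    have : ContinuousAt (fun r : ℝ => L * Real.exp (L * r) * r) 0 := by fun_prop
    exact this.eventually (Iio_mem_nhds (by simpa using half_pos hε))
  obtain ⟨δ₀, hδ₀, hball⟩ := Metric.eventually_nhds_iff_ball.1 hnear
  obtain ⟨δ₁, hδ₁, hball₁⟩ := Metric.eventually_nhds_iff_ball.1 hsmall
  have hspace : ∀ s, 0 ≤ s → s < δ₁ → ∀ x y : E,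
      ‖(γ s x - γ s y) - (x - y)‖ ≤ ε / 2 * ‖x - y‖ := by
    intro s hs0 hs x y
    have := norm_image_sub_le_of_norm_deriv_le_segment' (a := 0) (b := s)
      (f := fun u => γ u x - γ u y) (f' := fun u => b (γ u x) - b (γ u y))
      (C := L * (dist x y * Real.exp (L * s)))
      (fun u hu => ((hγ x u hu.1).sub (hγ y u hu.1)).hasDerivWithinAt)
      (fun u hu => by
        rw [← dist_eq_norm]
        refine (hb.dist_le_mul _ _).trans ?_
        have h1 := dist_flow_le hb hγ0 hγ hu.1 x y
        have h2 : u ≤ s := hu.2.le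
        gcongr
        exact h1.trans (by gcongr)) s ⟨hs0, le_rfl⟩
    simp only [hγ0, sub_zero] at this
    refine this.trans ?_
    have h3 := hball₁ s (by simpa [abs_of_nonneg hs0] using hs)
    rw [dist_eq_norm]
    nlinarith [norm_nonneg (x - y)]
  have htime : ∀ y ∈ Metric.ball p δ₀, ∀ s ∈ Ico 0 δ₀, ∀ t ∈ Ico 0 δ₀,
      ‖(γ s y - s • b p) - (γ t y - t • b p)‖ ≤ ε / 2 * ‖s - t‖ := by
    intro y hy s hs t ht
    refine Convex.norm_image_sub_le_of_norm_hasDerivWithin_le (s := Ico 0 δ₀)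
      (f := fun u => γ u y - u • b p) (f' := fun u => b (γ u y) - b p) (fun u hu => ?_)
      (fun u hu => ?_) (convex_Ico _ _) ht hs
    · simpa using ((hγ y u hu.1).fun_sub ((hasDerivAt_id u).smul_const (b p))).hasDerivWithinAt
    · have := hball (u, y) (by
        rw [← ball_prod_same]
        exact ⟨by simpa [abs_of_nonneg hu.1] using hu.2, hy⟩)
      simpa [hu.1] using this
  have hδ : 0 < min δ₀ δ₁ := lt_min hδ₀ hδ₁
  have hmem : ∀ᶠ q : (ℝ × E) × (ℝ × E) in nhds ((0, p), (0, p)),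
      q ∈ Metric.ball ((0 : ℝ), p) (min δ₀ δ₁) ×ˢ Metric.ball ((0 : ℝ), p) (min δ₀ δ₁) :=
    prod_mem_nhds (Metric.ball_mem_nhds _ hδ) (Metric.ball_mem_nhds _ hδ)
  filter_upwards [hmem]
  rintro ⟨⟨s, x⟩, ⟨t, y⟩⟩ ⟨h1, h2⟩
  rw [← ball_prod_same] at h1 h2
  obtain ⟨hs, hx⟩ := h1
  obtain ⟨ht, hy⟩ := h2
  simp only [Metric.mem_ball, dist_zero_right, Real.norm_eq_abs, lt_min_iff] at hs ht hx hy
  have hs' : max s 0 < δ₁ := max_lt (lt_of_abs_lt hs.2) hδ₁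
  have hs'' : max s 0 < δ₀ := max_lt (lt_of_abs_lt hs.1) hδ₀
  have ht'' : max t 0 < δ₀ := max_lt (lt_of_abs_lt ht.1) hδ₀
  have hA := hspace _ (le_max_right s 0) hs' x y
  have hB := htime y hy.1 _ ⟨le_max_right s 0, hs''⟩ _ ⟨le_max_right t 0, ht''⟩
  have hst : ‖max s 0 - max t 0‖ ≤ ‖s - t‖ := by
    simpa using abs_max_sub_max_le_abs s t (0 : ℝ)
  have hmm : ∀ u : ℝ, min u 0 = u - max u 0 := fun u => by
    linarith [min_add_max u 0]
  have hid : extendedFlow γ (b p) (s, x) - extendedFlow γ (b p) (t, y) -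
      (ContinuousLinearMap.snd ℝ ℝ E + (ContinuousLinearMap.fst ℝ ℝ E).smulRight (b p))
        ((s, x) - (t, y)) =
      ((γ (max s 0) x - γ (max s 0) y) - (x - y)) +
        ((γ (max s 0) y - max s 0 • b p) - (γ (max t 0) y - max t 0 • b p)) := by
    simp only [extendedFlow, hmm, _root_.add_apply, ContinuousLinearMap.coe_snd',
      ContinuousLinearMap.smulRight_apply, ContinuousLinearMap.coe_fst', Prod.mk_sub_mk]
    module
  simp only [hid]
  have hn1 : ‖x - y‖ ≤ ‖((s, x) : ℝ × E) - (t, y)‖ := norm_snd_le (((s, x) : ℝ × E) - (t, y))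
  have hn2 : ‖s - t‖ ≤ ‖((s, x) : ℝ × E) - (t, y)‖ := norm_fst_le (((s, x) : ℝ × E) - (t, y))
  refine (norm_add_le _ _).trans ?_
  nlinarith [hA, hB, hst]

end Flow

section Survival

lemma integrableOn_mul_exp_neg_integral {ψ : ℝ → ℝ} (hc : Continuous ψ) (h0 : ∀ t, 0 ≤ ψ t) :
    IntegrableOn (fun t => ψ t * Real.exp (-∫ s in (0 : ℝ)..t, ψ s)) (Ioi 0) := by
  have hderiv : ∀ t, HasDerivAt (fun t => -Real.exp (-∫ s in (0 : ℝ)..t, ψ s))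
      (ψ t * Real.exp (-∫ s in (0 : ℝ)..t, ψ s)) t := by
    intro t
    have h1 : HasDerivAt (fun t => ∫ s in (0 : ℝ)..t, ψ s) (ψ t) t :=
      (hc.integral_hasStrictDerivAt 0 t).hasDerivAt
    have h2 := h1.fun_neg.exp.fun_neg
    rwa [mul_neg, neg_neg, mul_comm] at h2
  have hmono : Monotone fun t => -Real.exp (-∫ s in (0 : ℝ)..t, ψ s) :=
    monotone_of_hasDerivAt_nonneg hderiv fun t => mul_nonneg (h0 t) (Real.exp_pos _).le
  have hlim := tendsto_atTop_ciSup hmono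
    ⟨0, by rintro _ ⟨t, rfl⟩; exact neg_nonpos.2 (Real.exp_pos _).le⟩
  exact integrableOn_Ioi_deriv_of_nonneg (hderiv 0).continuousAt.continuousWithinAt
    (fun t _ => hderiv t) (fun t _ => mul_nonneg (h0 t) (Real.exp_pos _).le) hlim

/-- Integrability of the sojourn-time density when the rate is only known to be continuous at
nonnegative times. -/
lemma integrableOn_mul_exp_neg_integral_of_max {φ : ℝ → ℝ}
    (hc : Continuous fun t => φ (max t 0)) (h0 : ∀ t, 0 ≤ φ t) :
    IntegrableOn (fun t => φ t * Real.exp (-∫ s in (0 : ℝ)..t, φ s)) (Ioi 0) := by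
  refine (integrableOn_mul_exp_neg_integral hc fun t => h0 _).congr_fun (fun t ht => ?_)
    measurableSet_Ioi
  have ht' : (0 : ℝ) ≤ t := (mem_Ioi.1 ht).le
  have : ∫ s in (0 : ℝ)..t, φ (max s 0) = ∫ s in (0 : ℝ)..t, φ s :=
    intervalIntegral.integral_congr fun s hs => by
      rw [uIcc_of_le ht'] at hs
      simp [hs.1]
  simp only [this, max_eq_left ht']

/-- The sojourn-time density is bounded below on a bounded time interval on which the rate is
bounded above and below. -/
lemma ofReal_integral_sojourn_ge {α : Type*} [MeasurableSpace α] {φ : ℝ → ℝ} {x : ℝ → α}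
    (hc : Continuous fun t => φ (max t 0)) (h0 : ∀ t, 0 ≤ φ t)
    {B : Set α} (hB : MeasurableSet B) (hx : Measurable fun t => x (max t 0))
    {η m M : ℝ} (hη1 : η ≤ 1) (hφm : ∀ t ∈ Icc 0 η, m ≤ φ t)
    (hφM : ∀ t, φ t ≤ M) :
    ENNReal.ofReal (m * Real.exp (-M)) * volume {t ∈ Icc 0 η | x t ∈ B} ≤
      ENNReal.ofReal (∫ t in Ioi (0 : ℝ), φ t * Real.exp (-∫ s in (0 : ℝ)..t, φ s) *
        B.indicator (fun _ => (1 : ℝ)) (x t)) := by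
  have hM : 0 ≤ M := (h0 0).trans (hφM 0)
  have hint0 := integrableOn_mul_exp_neg_integral_of_max hc h0
  have hind : Measurable fun t => B.indicator (fun _ => (1 : ℝ)) (x (max t 0)) :=
    (measurable_const.indicator hB).comp hx
  have hint : IntegrableOn (fun t => φ t * Real.exp (-∫ s in (0 : ℝ)..t, φ s) *
      B.indicator (fun _ => (1 : ℝ)) (x t)) (Ioi 0) := by
    have h1 : IntegrableOn (fun t => φ t * Real.exp (-∫ s in (0 : ℝ)..t, φ s) *
        B.indicator (fun _ => (1 : ℝ)) (x (max t 0))) (Ioi 0) := by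
      refine hint0.mul_bdd (c := 1) hind.aestronglyMeasurable (Filter.Eventually.of_forall fun t => ?_)
      by_cases h : x (max t 0) ∈ B <;> simp [h]
    refine h1.congr_fun (fun t ht => ?_) measurableSet_Ioi
    simp only [max_eq_left (mem_Ioi.1 ht).le]
  rw [ofReal_integral_eq_lintegral_ofReal hint (Filter.Eventually.of_forall fun t => ?_)]
  swap
  · refine mul_nonneg (mul_nonneg (h0 t) (Real.exp_pos _).le) (indicator_nonneg (by simp) _)
  have hset : MeasurableSet {t ∈ Ioc 0 η | x t ∈ B} := by
    have : {t ∈ Ioc 0 η | x t ∈ B} = Ioc 0 η ∩ (fun t => x (max t 0)) ⁻¹' B := by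
      ext t
      simp only [Set.mem_ofPred_eq, mem_inter_iff, mem_preimage, and_congr_right_iff]
      intro ht
      rw [max_eq_left ht.1.le]
    rw [this]
    exact measurableSet_Ioc.inter (hx hB)
  have hvol : volume {t ∈ Icc 0 η | x t ∈ B} ≤ volume {t ∈ Ioc 0 η | x t ∈ B} := by
    have : {t ∈ Icc 0 η | x t ∈ B} ⊆ {t ∈ Ioc 0 η | x t ∈ B} ∪ {0} := by
      rintro t ⟨⟨h1, h2⟩, h3⟩
      rcases h1.eq_or_lt with h | h
      · exact Or.inr h.symm
      · exact Or.inl ⟨⟨h, h2⟩, h3⟩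
    calc _ ≤ _ := measure_mono this
      _ ≤ _ := measure_union_le _ _
      _ = _ := by simp
  calc ENNReal.ofReal (m * Real.exp (-M)) * volume {t ∈ Icc 0 η | x t ∈ B}
      ≤ ENNReal.ofReal (m * Real.exp (-M)) * volume {t ∈ Ioc 0 η | x t ∈ B} := by gcongr
    _ = ∫⁻ t in {t ∈ Ioc 0 η | x t ∈ B}, ENNReal.ofReal (m * Real.exp (-M)) := by simp
    _ ≤ ∫⁻ t in {t ∈ Ioc 0 η | x t ∈ B}, ENNReal.ofReal
          (φ t * Real.exp (-∫ s in (0 : ℝ)..t, φ s) * B.indicator (fun _ => (1 : ℝ)) (x t)) := by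
        refine setLIntegral_mono' hset fun t ht => ENNReal.ofReal_le_ofReal ?_
        rw [indicator_of_mem ht.2, mul_one]
        have hle : ∫ s in (0 : ℝ)..t, φ s ≤ M := by
          have := intervalIntegral.norm_integral_le_of_norm_le_const (a := 0) (b := t) (C := M)
            (f := φ) fun s _ => by rw [Real.norm_of_nonneg (h0 s)]; exact hφM s
          rw [sub_zero, abs_of_pos ht.1.1] at this
          have h2 : t ≤ 1 := ht.1.2.trans hη1
          exact (le_abs_self _).trans (this.trans (by nlinarith))
        have := hφm t ⟨ht.1.1.le, ht.1.2⟩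
        have := h0 t
        gcongr
    _ ≤ _ := lintegral_mono_set fun t ht => ht.1.1

end Survival

section JumpKernel

open Filter Topology

lemma jumpKernel_locally_ge {E ι : Type*} [NormedAddCommGroup E] [MeasurableSpace E]
    [BorelSpace E] [Fintype ι] {γ : ℝ → E → E} (hγ0 : ∀ x, γ 0 x = x)
    (hγ : Continuous fun q : ℝ × E => γ (max q.1 0) q.2)
    {f : ι → E → ℝ} (hfpos : ∀ i x, 0 < f i x) (hfcont : ∀ i, Continuous (f i))
    (hfbdd : ∀ i, ∃ c : ℝ, ∀ x, f i x ≤ c)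
    {a : ι → E → E} (ha : ∀ i, Continuous (a i)) {K : Kernel E E}
    (hK : ∀ x (B : Set E), MeasurableSet B →
      K x B = ENNReal.ofReal (∑ i,
        (f i x / ∑ j, f j x) *
          ∫ t in Ioi (0:ℝ),
            (∑ j, f j (γ t (x + a i x))) *
              Real.exp (-∫ s in (0:ℝ)..t, ∑ j, f j (γ s (x + a i x))) *
              B.indicator (fun _ => (1:ℝ)) (γ t (x + a i x))))
    (i : ι) (p : E) :
    ∃ c : ENNReal, c ≠ 0 ∧ ∃ η : ℝ, 0 < η ∧ ∀ᶠ z in 𝓝 p, ∀ B : Set E, MeasurableSet B →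
      c * volume {s ∈ Icc 0 η | γ s (z + a i z) ∈ B} ≤ K z B := by
  choose C hC using hfbdd
  set F : E → ℝ := fun x => ∑ j, f j x with hF
  have hFcont : Continuous F := continuous_finsetSum _ fun j _ => hfcont j
  have hFpos : ∀ x, 0 < F x := fun x =>
    Finset.sum_pos (fun j _ => hfpos j x) ⟨i, Finset.mem_univ i⟩
  have hFM : ∀ x, F x ≤ ∑ j, C j := fun x => Finset.sum_le_sum fun j _ => hC j x
  have hΔ : Continuous fun z => z + a i z := continuous_id.add (ha i)
  have hrate : ∀ᶠ q : ℝ × E in 𝓝 (0, p),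
      F (p + a i p) / 2 < F (γ (max q.1 0) (q.2 + a i q.2)) := by
    have hc : Continuous fun q : ℝ × E => F (γ (max q.1 0) (q.2 + a i q.2)) :=
      hFcont.comp (hγ.comp (continuous_fst.prodMk (hΔ.comp continuous_snd)))
    exact hc.continuousAt.eventually
      (Ioi_mem_nhds (by simpa [hγ0] using half_lt_self (hFpos (p + a i p))))
  have hratio : ∀ᶠ z in 𝓝 p, f i p / F p / 2 < f i z / F z := by
    have hc : Continuous fun z => f i z / F z :=
      (hfcont i).div hFcont fun z => (hFpos z).ne'
    exact hc.continuousAt.eventually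
      (Ioi_mem_nhds (half_lt_self (div_pos (hfpos i p) (hFpos p))))
  obtain ⟨U, hU, V, hV, hUV⟩ := eventually_prod_iff.1 (nhds_prod_eq (X := ℝ) (Y := E) ▸ hrate)
  obtain ⟨δ, hδ, hball⟩ := Metric.eventually_nhds_iff_ball.1 hU
  set m := F (p + a i p) / 2
  have hm : 0 < m := half_pos (hFpos _)
  refine ⟨ENNReal.ofReal (f i p / F p / 2) * ENNReal.ofReal (m * Real.exp (-∑ j, C j)), ?_,
    min 1 (δ / 2), by positivity, ?_⟩
  · have h1 := hfpos i p
    have h2 := hFpos p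
    refine mul_ne_zero ?_ ?_ <;> exact (ENNReal.ofReal_pos.2 (by positivity)).ne'
  filter_upwards [hV, hratio] with z hz hz' B hB
  have hc : Continuous fun t => F (γ (max t 0) (z + a i z)) :=
    hFcont.comp (hγ.comp (continuous_id.prodMk continuous_const))
  have hx : Continuous fun t => γ (max t 0) (z + a i z) :=
    hγ.comp (continuous_id.prodMk continuous_const)
  have hmain := ofReal_integral_sojourn_ge (φ := fun t => F (γ t (z + a i z)))
    (x := fun t => γ t (z + a i z)) hc (fun t => (hFpos _).le) hB hx.measurable
    (η := min 1 (δ / 2)) (m := m) (min_le_left _ _)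
    (fun t ht => by
      have ht2 : t < δ := by linarith [ht.2.trans (min_le_right _ _)]
      have := hUV (x := t) (hball t (by simpa [abs_of_nonneg ht.1] using ht2)) hz
      simp only [max_eq_left ht.1] at this
      exact this.le)
    (fun t => hFM _)
  rw [hK z B hB, mul_assoc]
  refine (mul_le_mul' (ENNReal.ofReal_le_ofReal hz'.le) hmain).trans ?_
  rw [← ENNReal.ofReal_mul (div_pos (hfpos i z) (hFpos z)).le]
  refine ENNReal.ofReal_le_ofReal ?_
  refine Finset.single_le_sum (f := fun i => (f i z / F z) *
    ∫ t in Ioi (0:ℝ), F (γ t (z + a i z)) *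
      Real.exp (-∫ s in (0:ℝ)..t, F (γ s (z + a i z))) *
        B.indicator (fun _ => (1:ℝ)) (γ t (z + a i z))) (fun j _ => ?_) (Finset.mem_univ i)
  refine mul_nonneg (div_pos (hfpos j z) (hFpos z)).le (integral_nonneg fun t => ?_)
  exact mul_nonneg (mul_nonneg (hFpos _).le (Real.exp_pos _).le) (indicator_nonneg (by simp) _)

end JumpKernel

section JumpFlow

open Filter Topology

variable {E : Type*}

/-- The position reached from `q.1` after `k` rounds, the `j`-th round consisting of the jump
`Δ j` followed by the motion `G j` during the time `q.2 j`. -/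
def jumpFlow (G : ℕ → ℝ × E → E) (Δ : ℕ → E → E) : (k : ℕ) → E × (Fin k → ℝ) → E
  | 0 => Prod.fst
  | k + 1 => fun q => G k (q.2 (Fin.last k), Δ k (jumpFlow G Δ k (q.1, Fin.init q.2)))

variable {G : ℕ → ℝ × E → E} {Δ : ℕ → E → E}

lemma jumpFlow_snoc (k : ℕ) (x : E) (t : Fin k → ℝ) (s : ℝ) :
    jumpFlow G Δ (k + 1) (x, Fin.snoc t s) = G k (s, Δ k (jumpFlow G Δ k (x, t))) := by
  simp [jumpFlow]

lemma jumpFlow_base {p : ℕ → E} (hG : ∀ k x, G k (0, x) = x) {n : ℕ}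
    (hp : ∀ k < n, Δ k (p k) = p (k + 1)) :
    ∀ k ≤ n, jumpFlow G Δ k (p 0, 0) = p k
  | 0, _ => rfl
  | k + 1, hk => by
    have : (Fin.init (0 : Fin (k + 1) → ℝ) : Fin k → ℝ) = 0 := rfl
    simp only [jumpFlow, this, Pi.zero_apply, hG, jumpFlow_base hG hp k (by lia), hp k (by lia)]

lemma continuous_jumpFlow [TopologicalSpace E] (hG : ∀ k, Continuous (G k))
    (hΔ : ∀ k, Continuous (Δ k)) : ∀ k, Continuous (jumpFlow G Δ k)
  | 0 => continuous_fst
  | k + 1 => by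
    have ih := continuous_jumpFlow hG hΔ k
    have hinit : Continuous fun q : E × (Fin (k + 1) → ℝ) => (q.1, Fin.init q.2) :=
      continuous_fst.prodMk (continuous_pi fun j =>
        (continuous_apply j.castSucc).comp continuous_snd)
    exact (hG k).comp (((continuous_apply _).comp continuous_snd).prodMk
      ((hΔ k).comp (ih.comp hinit)))

/-- Integration over a product of `k + 1` copies of a set, splitting off the last variable. -/
lemma lintegral_pi_snoc {k : ℕ} (I : Set ℝ) (hI : MeasurableSet I)
    {g : (Fin (k + 1) → ℝ) → ENNReal} (hg : Measurable g) :
    ∫⁻ t in univ.pi fun _ => I, g t =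
      ∫⁻ t in univ.pi fun _ : Fin k => I, ∫⁻ s in I, g (Fin.snoc t s) := by
  have hmp := volume_preserving_piFinSuccAbove (fun _ : Fin (k + 1) => ℝ) (Fin.last k)
  have hsymm := hmp.symm
  have hpre : (MeasurableEquiv.piFinSuccAbove (fun _ : Fin (k + 1) => ℝ) (Fin.last k)).symm ⁻¹'
      (univ.pi fun _ => I) = I ×ˢ (univ.pi fun _ : Fin k => I) := by
    ext ⟨s, t⟩
    simp [MeasurableEquiv.piFinSuccAbove, Fin.forall_fin_succ', and_comm]
  have hbox : MeasurableSet (univ.pi fun _ : Fin k => I) := MeasurableSet.univ_pi fun _ => hI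
  rw [← hsymm.setLIntegral_comp_preimage (MeasurableSet.univ_pi fun _ => hI) hg, hpre,
    Measure.volume_eq_prod, ← Measure.prod_restrict, lintegral_prod_symm]
  · refine lintegral_congr fun t => lintegral_congr fun s => ?_
    congr 1
    simp [MeasurableEquiv.piFinSuccAbove]
    rfl
  · exact (hg.comp (MeasurableEquiv.measurable _)).aemeasurable

/-- The iterates of a kernel dominate the image of Lebesgue measure on a box of small sojourn
times, if the kernel does so locally along the chain of positions `p`. -/
lemma iterate_kernel_ge [TopologicalSpace E] [MeasurableSpace E] [BorelSpace E]
    {K : Kernel E E} {Q : ℕ → Kernel E E} (hQ0 : Q 0 = Kernel.id)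
    (hQ : ∀ k, Q (k + 1) = K ∘ₖ Q k) (hGc : ∀ k, Continuous (G k)) (hΔc : ∀ k, Continuous (Δ k))
    (hG : ∀ k x, G k (0, x) = x) {p : ℕ → E} {n : ℕ} (hp : ∀ k < n, Δ k (p k) = p (k + 1))
    (hK : ∀ k < n, ∃ c : ENNReal, c ≠ 0 ∧ ∃ η : ℝ, 0 < η ∧ ∀ᶠ z in 𝓝 (p k), ∀ B : Set E,
      MeasurableSet B → c * volume {s ∈ Icc 0 η | G k (s, Δ k z) ∈ B} ≤ K z B) :
    ∀ k ≤ n, ∃ c : ENNReal, c ≠ 0 ∧ ∃ r : ℝ, 0 < r ∧ ∀ᶠ x in 𝓝 (p 0), ∀ η ≤ r,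
      c • (volume.restrict (univ.pi fun _ => Icc 0 η)).map (fun t => jumpFlow G Δ k (x, t))
        ≤ Q k x := by
  have hT : ∀ k x, Measurable fun t => jumpFlow G Δ k (x, t) := fun k x =>
    ((continuous_jumpFlow hGc hΔc k).comp (by fun_prop : Continuous fun t => (x, t))).measurable
  intro k
  induction k with
  | zero =>
    intro _
    refine ⟨1, one_ne_zero, 1, one_pos, Eventually.of_forall fun x η _ => ?_⟩
    refine Measure.le_iff.2 fun B hB => ?_
    have : (univ.pi fun _ : Fin 0 => Icc (0 : ℝ) η) = univ :=
      eq_univ_of_forall fun t j => j.elim0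
    rw [one_smul, hQ0, Kernel.id_apply, this, Measure.restrict_univ]
    change Measure.map (fun _ => x) _ B ≤ _
    rw [Measure.map_const]
    simp [volume_pi]
  | succ k ih =>
    intro hk
    obtain ⟨c, hc, r, hr, hx⟩ := ih (by lia)
    obtain ⟨c', hc', η', hη', hz⟩ := hK k (by lia)
    have hlim : Tendsto (jumpFlow G Δ k) (𝓝 (p 0, 0)) (𝓝 (p k)) := by
      have := (continuous_jumpFlow hGc hΔc k).continuousAt (x := (p 0, 0))
      rwa [ContinuousAt, jumpFlow_base hG hp k (by lia)] at this
    have hz' := hlim.eventually hz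
    rw [nhds_prod_eq] at hz'
    obtain ⟨U, hU, V, hV, hUV⟩ := eventually_prod_iff.1 hz'
    obtain ⟨δ, hδ, hball⟩ := Metric.eventually_nhds_iff_ball.1 hV
    refine ⟨c * c', mul_ne_zero hc hc', min r (min η' (δ / 2)), by positivity, ?_⟩
    filter_upwards [hx, hU] with x hx hxU η hη
    have hηr : η ≤ r := hη.trans (min_le_left _ _)
    have hηη : η ≤ η' := hη.trans ((min_le_right _ _).trans (min_le_left _ _))
    have hηδ : η < δ := by linarith [hη.trans ((min_le_right _ _).trans (min_le_right _ _))]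
    refine Measure.le_iff.2 fun B hB => ?_
    have hbox : MeasurableSet (univ.pi fun _ : Fin k => Icc 0 η) :=
      MeasurableSet.univ_pi fun _ => measurableSet_Icc
    rw [hQ, Kernel.comp_apply' _ _ _ hB, Measure.smul_apply, smul_eq_mul]
    calc c * c' * (Measure.map (fun t => jumpFlow G Δ (k + 1) (x, t))
            (volume.restrict (univ.pi fun _ => Icc 0 η))) B
        = c * (c' * ∫⁻ t in univ.pi fun _ : Fin k => Icc 0 η, ∫⁻ s in Icc 0 η,
            B.indicator 1 (G k (s, Δ k (jumpFlow G Δ k (x, t))))) := by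
          rw [← lintegral_indicator_one hB, lintegral_map (measurable_one.indicator hB) (hT _ x),
            lintegral_pi_snoc (g := fun t => B.indicator 1 (jumpFlow G Δ (k + 1) (x, t))) _
              measurableSet_Icc ((measurable_one.indicator hB).comp (hT _ x)),
            mul_assoc]
          simp only [jumpFlow_snoc]
      _ ≤ c * ∫⁻ t in univ.pi fun _ : Fin k => Icc 0 η, K (jumpFlow G Δ k (x, t)) B := by
          refine mul_le_mul_right ?_ c
          refine (lintegral_const_mul_le _ _).trans (setLIntegral_mono' hbox fun t ht => ?_)
          have htδ : t ∈ Metric.ball 0 δ := by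
            refine mem_ball_zero_iff.2 ((pi_norm_lt_iff hδ).2 fun j => ?_)
            have := ht j (mem_univ j)
            rw [Real.norm_of_nonneg this.1]
            exact this.2.trans_lt hηδ
          refine le_trans ?_ (hUV hxU (hball t htδ) B hB)
          have hms : Measurable fun s => G k (s, Δ k (jumpFlow G Δ k (x, t))) :=
            ((hGc k).comp (by fun_prop : Continuous fun s : ℝ =>
              (s, Δ k (jumpFlow G Δ k (x, t))))).measurable
          have hrw : ∫⁻ s in Icc 0 η, B.indicator 1 (G k (s, Δ k (jumpFlow G Δ k (x, t)))) =
              volume {s ∈ Icc 0 η | G k (s, Δ k (jumpFlow G Δ k (x, t))) ∈ B} := by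
            rw [← lintegral_map (measurable_one.indicator hB) hms, lintegral_indicator_one hB,
              Measure.map_apply hms hB, Measure.restrict_apply (hms hB), inter_comm]
            rfl
          rw [hrw]
          refine mul_le_mul_right (measure_mono ?_) _
          exact fun s hs => ⟨⟨hs.1.1, hs.1.2.trans hηη⟩, hs.2⟩
      _ = ∫⁻ z, K z B ∂(c • Measure.map (fun t => jumpFlow G Δ k (x, t))
            (volume.restrict (univ.pi fun _ => Icc 0 η))) := by
          rw [lintegral_smul_measure, lintegral_map (K.measurable_coe hB) (hT _ x), smul_eq_mul]
      _ ≤ ∫⁻ z, K z B ∂(Q k x) := lintegral_mono' (hx η hηr) le_rfl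

end JumpFlow

section JumpFlowDeriv

variable {E : Type*} [NormedAddCommGroup E] [NormedSpace ℝ E]

/-- The derivative of `jumpFlow` at time `0`, where `A k` is the derivative of the `k`-th jump and
`v k` the velocity of the `k`-th motion. -/
def jumpFlowDeriv (A : ℕ → E →L[ℝ] E) (v : ℕ → E) : (k : ℕ) → E × (Fin k → ℝ) →L[ℝ] E
  | 0 => ContinuousLinearMap.fst ℝ E _
  | k + 1 =>
    (ContinuousLinearMap.snd ℝ ℝ E + (ContinuousLinearMap.fst ℝ ℝ E).smulRight (v k)) ∘L
      ((ContinuousLinearMap.proj (Fin.last k) ∘L ContinuousLinearMap.snd ℝ E _).prod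
        (A k ∘L jumpFlowDeriv A v k ∘L
          (ContinuousLinearMap.fst ℝ E _).prod
            (ContinuousLinearMap.pi fun j : Fin k =>
              ContinuousLinearMap.proj j.castSucc ∘L ContinuousLinearMap.snd ℝ E _)))

variable {A : ℕ → E →L[ℝ] E} {v : ℕ → E}

lemma jumpFlowDeriv_succ_apply (k : ℕ) (x : E) (t : Fin (k + 1) → ℝ) :
    jumpFlowDeriv A v (k + 1) (x, t) =
      A k (jumpFlowDeriv A v k (x, Fin.init t)) + t (Fin.last k) • v k :=
  rfl

lemma hasStrictFDerivAt_jumpFlow {G : ℕ → ℝ × E → E} {Δ : ℕ → E → E} {p : ℕ → E}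
    (hG : ∀ k x, G k (0, x) = x) {n : ℕ} (hp : ∀ k < n, Δ k (p k) = p (k + 1))
    (hGd : ∀ k < n, HasStrictFDerivAt (G k)
      (ContinuousLinearMap.snd ℝ ℝ E + (ContinuousLinearMap.fst ℝ ℝ E).smulRight (v k))
      (0, p (k + 1)))
    (hΔd : ∀ k < n, HasStrictFDerivAt (Δ k) (A k) (p k)) :
    ∀ k ≤ n, HasStrictFDerivAt (jumpFlow G Δ k) (jumpFlowDeriv A v k) (p 0, 0)
  | 0, _ => hasStrictFDerivAt_fst
  | k + 1, hk => by
    set J : E × (Fin (k + 1) → ℝ) →L[ℝ] E × (Fin k → ℝ) := (ContinuousLinearMap.fst ℝ E _).prod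
      (ContinuousLinearMap.pi fun j : Fin k =>
        ContinuousLinearMap.proj j.castSucc ∘L ContinuousLinearMap.snd ℝ E _)
    have hJ : J (p 0, 0) = (p 0, 0) := rfl
    have hbase := jumpFlow_base hG hp k (by lia)
    have ih : HasStrictFDerivAt (jumpFlow G Δ k) (jumpFlowDeriv A v k) (J (p 0, 0)) := by
      rw [hJ]
      exact hasStrictFDerivAt_jumpFlow hG hp hGd hΔd k (by lia)
    have h1 := ih.comp (p 0, 0) J.hasStrictFDerivAt
    have h2 : HasStrictFDerivAt (Δ k) (A k) ((jumpFlow G Δ k ∘ J) (p 0, 0)) := by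
      rw [Function.comp_apply, hJ, hbase]
      exact hΔd k (by lia)
    have h3 := ((ContinuousLinearMap.proj (R := ℝ) (φ := fun _ : Fin (k + 1) => ℝ)
      (Fin.last k)) ∘L ContinuousLinearMap.snd ℝ E (Fin (k + 1) → ℝ)).hasStrictFDerivAt
        (x := (p 0, 0)) |>.prodMk (h2.comp (p 0, 0) h1)
    refine HasStrictFDerivAt.comp (g := G k) (p 0, 0) ?_ h3
    have h4 := hGd k (by lia)
    rw [← hp k (by lia), ← hbase, ← hJ] at h4
    exact h4

lemma comp_jumpFlowDeriv_apply {C : ℕ → E →L[ℝ] E} {n : ℕ}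
    (hC : ∀ k, 1 ≤ k → k ≤ n → C k = (C (k + 1)).comp (A k)) :
    ∀ k ≤ n, ∀ t : Fin (k + 1) → ℝ, C (k + 1) (jumpFlowDeriv A v (k + 1) (0, t)) =
      ∑ j : Fin (k + 1), t j • C (j + 1) (v j)
  | 0, _, t => by
    have h0 : jumpFlowDeriv A v 0 (0, Fin.init t) = 0 := rfl
    rw [jumpFlowDeriv_succ_apply, h0]
    simp
  | k + 1, hk, t => by
    have ih := comp_jumpFlowDeriv_apply hC k (by lia) (Fin.init t)
    rw [hC (k + 1) (by lia) hk, ContinuousLinearMap.comp_apply] at ih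
    rw [jumpFlowDeriv_succ_apply, map_add, map_smul, Fin.sum_univ_castSucc, ih]
    simp [Fin.init]

end JumpFlowDeriv

section Covering

open Filter Topology

/-- A family of maps strictly differentiable at `(z₀, 0)` with a partial derivative in the time
variable that has a right inverse sends Lebesgue measure on a small box of positive times to a
measure dominating Lebesgue measure on a ball, uniformly in the parameter. -/
lemma map_volume_box_ge {N m : ℕ} {T : (Fin N → ℝ) × (Fin m → ℝ) → (Fin N → ℝ)}
    (hTc : Continuous T) {D : (Fin N → ℝ) × (Fin m → ℝ) →L[ℝ] (Fin N → ℝ)} {z₀ : Fin N → ℝ}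
    (hT : HasStrictFDerivAt T D (z₀, 0)) (R : (Fin N → ℝ) →L[ℝ] (Fin m → ℝ))
    (hR : ∀ u, D (0, R u) = u) {r : ℝ} (hr : 0 < r) :
    ∃ η ≤ r, ∃ (z : Fin N → ℝ) (δ : ℝ), 0 < δ ∧ ∃ κ : ENNReal, κ ≠ 0 ∧
      ∀ᶠ x in 𝓝 z₀, κ • volume.restrict (Metric.ball z δ) ≤
        (volume.restrict (univ.pi fun _ => Icc 0 η)).map fun t => T (x, t) := by
  set ε : NNReal := (2 * (‖R‖₊ + 1))⁻¹ with hεdef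
  have hε : 0 < ε := by positivity
  have hεR : (ε : ℝ) * ‖R‖ ≤ 1 / 2 := by
    have h0 : 0 ≤ ‖R‖ := norm_nonneg R
    rw [hεdef]
    push_cast
    rw [inv_mul_le_iff₀ (by positivity)]
    linarith
  obtain ⟨s, hs, hTs⟩ := hT.approximates_deriv_on_nhds (c := ε) (Or.inr hε)
  obtain ⟨ρ₀, hρ₀, hball⟩ := Metric.nhds_basis_closedBall.mem_iff.1 hs
  set η := min r ρ₀
  have hη : 0 < η := lt_min hr hρ₀
  set tstar : Fin m → ℝ := fun _ => η / 2 with htstar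
  set ρ := η / (4 * (‖R‖ + 1)) with hρdef
  have hρ : 0 < ρ := by positivity
  have hRρ : ∀ u ∈ Metric.closedBall (0 : Fin N → ℝ) ρ, ‖R u‖ ≤ η / 4 := by
    intro u hu
    have h0 : 0 ≤ ‖R‖ := norm_nonneg R
    rw [mem_closedBall_zero_iff] at hu
    calc ‖R u‖ ≤ ‖R‖ * ‖u‖ := R.le_opNorm u
      _ ≤ (‖R‖ + 1) * ρ := by gcongr; linarith
      _ = η / 4 := by rw [hρdef]; field_simp
  have hnear : ∀ᶠ q in 𝓝 (z₀, tstar), dist (T q) (T (z₀, tstar)) < ρ / 4 :=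
    hTc.continuousAt.eventually (Metric.ball_mem_nhds _ (by positivity))
  rw [nhds_prod_eq] at hnear
  obtain ⟨U, hU, V, hV, hUV⟩ := eventually_prod_iff.1 hnear
  obtain ⟨η₁, hη₁, hballV⟩ := Metric.eventually_nhds_iff_ball.1 hV
  set W := Metric.ball tstar (min η₁ (η / 4)) with hW
  have hWbox : ∀ t ∈ W, ∀ u ∈ Metric.closedBall (0 : Fin N → ℝ) ρ,
      t + R u ∈ univ.pi fun _ : Fin m => Icc 0 η := by
    intro t ht u hu j _
    have h1 : |t j - η / 2| < η / 4 :=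
      (dist_le_pi_dist t tstar j).trans_lt ((Metric.mem_ball.1 ht).trans_le (min_le_right _ _))
    have h2 : |R u j| ≤ η / 4 := (norm_le_pi_norm (R u) j).trans (hRρ u hu)
    rw [abs_lt] at h1
    rw [abs_le] at h2
    simp only [Pi.add_apply, mem_Icc]
    constructor <;> linarith
  have hbox_s : ∀ x ∈ Metric.closedBall z₀ ρ₀, ∀ t ∈ univ.pi fun _ : Fin m => Icc 0 η,
      (x, t) ∈ s := by
    intro x hx t ht
    refine hball ?_
    rw [← closedBall_prod_same]
    refine ⟨hx, mem_closedBall_zero_iff.2 ((pi_norm_le_iff_of_nonneg hρ₀.le).2 fun j => ?_)⟩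
    have := ht j (mem_univ j)
    rw [Real.norm_of_nonneg this.1]
    exact this.2.trans (min_le_right _ _)
  have hW0 : volume W ≠ 0 := (Metric.measure_ball_pos _ _ (by positivity)).ne'
  have hWtop : volume W ≠ ⊤ := measure_ball_lt_top.ne
  set cB := Metric.closedBall (0 : Fin N → ℝ) ρ with hcB
  have hcB0 : volume cB ≠ 0 := (Metric.measure_closedBall_pos _ _ hρ).ne'
  have hcBtop : volume cB ≠ ⊤ := measure_closedBall_lt_top.ne
  refine ⟨η, min_le_left _ _, T (z₀, tstar), ρ / 4, by positivity,
    volume W / (2 ^ N * volume cB),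
    ENNReal.div_ne_zero.2 ⟨hW0, ENNReal.mul_ne_top (by simp) hcBtop⟩, ?_⟩
  filter_upwards [hU, Metric.closedBall_mem_nhds z₀ hρ₀] with x hxU hx
  have hTx : Continuous fun t => T (x, t) := by fun_prop
  refine Measure.le_iff.2 fun B hB => ?_
  set X := volume ((fun t => T (x, t)) ⁻¹' B ∩ univ.pi fun _ : Fin m => Icc 0 η) with hX
  set Y := volume (B ∩ Metric.ball (T (z₀, tstar)) (ρ / 4)) with hY
  have hlocal : ∀ t ∈ W, Y ≤ 2 ^ N * volume ({u | T (x, t + R u) ∈ B} ∩ cB) := by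
    intro t ht
    have happ : ∀ u ∈ cB, ∀ u' ∈ cB,
        ‖T (x, t + R u) - T (x, t + R u') - (u - u')‖ ≤ 1 / 2 * ‖u - u'‖ := by
      intro u hu u' hu'
      have h := hTs _ (hbox_s x hx _ (hWbox t ht u hu)) _ (hbox_s x hx _ (hWbox t ht u' hu'))
      have hdiff : (x, t + R u) - (x, t + R u') = ((0 : Fin N → ℝ), R (u - u')) := by
        simp [Prod.mk_sub_mk]
      rw [hdiff, hR] at h
      refine h.trans ?_
      have hn : ‖((0 : Fin N → ℝ), R (u - u'))‖ ≤ ‖R‖ * ‖u - u'‖ := by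
        simpa [Prod.norm_def] using R.le_opNorm (u - u')
      calc (ε : ℝ) * ‖((0 : Fin N → ℝ), R (u - u'))‖ ≤ ε * (‖R‖ * ‖u - u'‖) := by gcongr
        _ = ε * ‖R‖ * ‖u - u'‖ := by ring
        _ ≤ _ := by gcongr
    have happrox : ApproximatesLinearOn (fun u => T (x, t + R u))
        (ContinuousLinearMap.id ℝ (Fin N → ℝ)) cB (1 / 2) := by
      intro u hu u' hu'
      simpa using happ u hu u' hu'
    have hsurj := happrox.surjOn_closedBall_of_nonlinearRightInverse
      { toFun := id, nnnorm := 1, bound' := by simp, right_inv' := fun _ => rfl }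
      hρ.le subset_rfl
    have hlip : LipschitzOnWith 2 (fun u => T (x, t + R u)) cB := by
      refine LipschitzOnWith.of_dist_le_mul fun u hu u' hu' => ?_
      have h := happ u hu u' hu'
      have h2 := norm_le_norm_add_norm_sub (u - u') (T (x, t + R u) - T (x, t + R u'))
      rw [norm_sub_rev (u - u')] at h2
      rw [dist_eq_norm, dist_eq_norm]
      push_cast
      linarith [norm_nonneg (u - u')]
    have himage : B ∩ Metric.ball (T (z₀, tstar)) (ρ / 4) ⊆
        (fun u => T (x, t + R u)) '' ({u | T (x, t + R u) ∈ B} ∩ cB) := by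
      rintro w ⟨hwB, hw⟩
      have hclose : dist (T (x, t)) (T (z₀, tstar)) < ρ / 4 :=
        hUV hxU (hballV t (Metric.ball_subset_ball (min_le_left _ _) ht))
      obtain ⟨u, hu, rfl⟩ := hsurj (a := w) (by
        rw [Metric.mem_closedBall]
        have h1 : dist w (T (z₀, tstar)) < ρ / 4 := hw
        have h2 := dist_triangle_right w (T (x, t)) (T (z₀, tstar))
        simp only [map_zero, add_zero, NNReal.coe_one, inv_one]
        norm_num
        linarith)
      exact ⟨u, ⟨hwB, hu⟩, rfl⟩
    have hvol := (hlip.mono inter_subset_right :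
      LipschitzOnWith 2 _ ({u | T (x, t + R u) ∈ B} ∩ cB)).hausdorffMeasure_image_le
        (d := (Fintype.card (Fin N) : ℝ)) (by positivity)
    rw [hausdorffMeasure_pi_real] at hvol
    refine (measure_mono himage).trans (hvol.trans_eq ?_)
    simp
  have hmeas : Measurable (Function.uncurry fun (t : Fin m → ℝ) (u : Fin N → ℝ) =>
      B.indicator (1 : (Fin N → ℝ) → ENNReal) (T (x, t + R u))) := by
    have hc : Continuous fun q : (Fin m → ℝ) × (Fin N → ℝ) => T (x, q.1 + R q.2) := by fun_prop
    exact (measurable_one.indicator hB).comp hc.measurable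
  have hu_meas : ∀ t, MeasurableSet {u | T (x, t + R u) ∈ B} := fun t =>
    (by fun_prop : Continuous fun u => T (x, t + R u)).measurable hB
  have ht_meas : ∀ u, MeasurableSet {t | T (x, t + R u) ∈ B} := fun u =>
    (by fun_prop : Continuous fun t => T (x, t + R u)).measurable hB
  have hcount : Y * volume W ≤ X * (2 ^ N * volume cB) := by
    calc Y * volume W = ∫⁻ _ in W, Y := by simp
      _ ≤ ∫⁻ t in W, 2 ^ N * ∫⁻ u in cB, B.indicator 1 (T (x, t + R u)) := by
          refine setLIntegral_mono' measurableSet_ball fun t ht => (hlocal t ht).trans_eq ?_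
          congr 1
          rw [← Measure.restrict_apply (hu_meas t), ← lintegral_indicator_one (hu_meas t)]
          rfl
      _ = 2 ^ N * ∫⁻ u in cB, ∫⁻ t in W, B.indicator 1 (T (x, t + R u)) := by
          rw [lintegral_const_mul' _ _ (by simp), lintegral_lintegral_swap hmeas.aemeasurable]
      _ ≤ 2 ^ N * ∫⁻ _ in cB, X := by
          refine mul_le_mul_right (setLIntegral_mono' Metric.isClosed_closedBall.measurableSet
            fun u hu => ?_) _
          have hrw : ∫⁻ t in W, B.indicator 1 (T (x, t + R u)) =
              volume ({t | T (x, t + R u) ∈ B} ∩ W) := by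
            rw [← Measure.restrict_apply (ht_meas u), ← lintegral_indicator_one (ht_meas u)]
            rfl
          rw [hrw, hX]
          refine le_trans (measure_mono ?_) (measure_preimage_add_right volume (R u) _).le
          exact fun t ht => ⟨ht.1, hWbox t ht.2 u hu⟩
      _ = X * (2 ^ N * volume cB) := by
          rw [setLIntegral_const]
          ring
  rw [Measure.map_apply hTx.measurable hB, Measure.restrict_apply (hTx.measurable hB),
    Measure.smul_apply, Measure.restrict_apply hB, smul_eq_mul, mul_comm, ← mul_div_assoc]
  exact ENNReal.div_le_of_le_mul hcount

end Covering

section SmoothDensity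

open Metric

lemma exists_smooth_density_le {N : ℕ} (z : Fin N → ℝ) {δ : ℝ} (hδ : 0 < δ) {κ : ENNReal}
    (hκ : κ ≠ 0) :
    ∃ β : ℝ, 0 < β ∧ β < 1 ∧ ∃ ν : (Fin N → ℝ) → ℝ,
      ContDiff ℝ (⊤ : ℕ∞) ν ∧ (∀ y, 0 ≤ ν y) ∧ (∫ y, ν y) = 1 ∧ tsupport ν ⊆ ball z δ ∧
      ∀ B : Set (Fin N → ℝ), MeasurableSet B →
        ENNReal.ofReal (β * ∫ y in B, ν y) ≤ κ * volume (B ∩ ball z δ) := by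
  let g : ContDiffBump z := ⟨δ / 4, δ / 2, by positivity, by linarith⟩
  have hsupp : tsupport (g.normed volume) ⊆ ball z δ := by
    rw [g.tsupport_normed_eq]
    exact closedBall_subset_ball (half_lt_self hδ)
  have hI : 0 < ∫ x, g x := g.integral_pos
  set M := (∫ x, g x)⁻¹ with hM
  have hM0 : 0 < M := inv_pos.2 hI
  have hνM : ∀ y, g.normed volume y ≤ M := fun y => by
    rw [g.normed_def, hM, div_eq_mul_inv]
    exact mul_le_of_le_one_left hM0.le g.le_one
  have hκ1 : min κ 1 ≠ ⊤ := ne_top_of_le_ne_top ENNReal.one_ne_top (min_le_right _ _)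
  have hκ0 : 0 < (min κ 1).toReal :=
    ENNReal.toReal_pos (lt_min (pos_iff_ne_zero.2 hκ) one_pos).ne' hκ1
  refine ⟨min (1 / 2) ((min κ 1).toReal / M), by positivity,
    (min_le_left _ _).trans_lt (by norm_num), g.normed volume, g.contDiff_normed,
    fun y => g.nonneg_normed y, g.integral_normed, hsupp, fun B hB => ?_⟩
  rw [ENNReal.ofReal_mul (by positivity), ofReal_integral_eq_lintegral_ofReal
    g.integrable_normed.restrict (Filter.Eventually.of_forall fun y => g.nonneg_normed y)]
  have hdom : ∫⁻ y in B, ENNReal.ofReal (g.normed volume y) ≤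
      ENNReal.ofReal M * volume (B ∩ ball z δ) := by
    calc ∫⁻ y in B, ENNReal.ofReal (g.normed volume y)
        ≤ ∫⁻ y in B, (ball z δ).indicator (fun _ => ENNReal.ofReal M) y := by
          refine lintegral_mono fun y => ?_
          by_cases hy : y ∈ ball z δ
          · simpa [hy] using ENNReal.ofReal_le_ofReal (hνM y)
          · simp [image_eq_zero_of_notMem_tsupport fun h => hy (hsupp h)]
      _ = _ := by
          rw [lintegral_indicator measurableSet_ball, setLIntegral_const,
            Measure.restrict_apply measurableSet_ball, inter_comm]
  calc ENNReal.ofReal (min (1 / 2) ((min κ 1).toReal / M)) *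
        ∫⁻ y in B, ENNReal.ofReal (g.normed volume y)
      ≤ ENNReal.ofReal ((min κ 1).toReal / M) *
        (ENNReal.ofReal M * volume (B ∩ ball z δ)) :=
        mul_le_mul' (ENNReal.ofReal_le_ofReal (min_le_right _ _)) hdom
    _ = min κ 1 * volume (B ∩ ball z δ) := by
        rw [← mul_assoc, ← ENNReal.ofReal_mul (by positivity), div_mul_cancel₀ _ hM0.ne',
          ENNReal.ofReal_toReal hκ1]
    _ ≤ κ * volume (B ∩ ball z δ) := mul_le_mul_left (min_le_left _ _) _

end SmoothDensity

lemma exists_rightInverse_of_det_ne_zero {N m : ℕ} (M : Matrix (Fin N) (Fin m) ℝ)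
    (hM : (M * Mᵀ).det ≠ 0) :
    ∃ R : (Fin N → ℝ) →L[ℝ] (Fin m → ℝ), ∀ u, M *ᵥ R u = u := by
  refine ⟨LinearMap.toContinuousLinearMap (Mᵀ * (M * Mᵀ)⁻¹).mulVecLin, fun u => ?_⟩
  simp only [LinearMap.coe_toContinuousLinearMap', Matrix.mulVecLin_apply]
  rw [Matrix.mulVec_mulVec, ← Matrix.mul_assoc,
    Matrix.mul_nonsing_inv _ (isUnit_iff_ne_zero.2 hM), Matrix.one_mulVec]

/-- if for some `n ≥ 1` and indices `i_0,…,i_n` the matrix `σ(y)σ(y)ᵀ` built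
from the vectors `V_1(y),…,V_{n+1}(y)` has determinant bounded below away from `0`
uniformly in `y`, then a Doeblin-type lower bound holds for the `(n+1)`-fold iterate of the
jump-chain kernel `K`: around every point `z₀` there is a small ball `C` and a smooth
compactly supported probability density `ν` with `K^{n+1}(x,·) ≥ β ν(y) dy` on `C`. -/
theorem doeblin_lower_bound_of_uniform_nondegeneracy
    (N : ℕ) (hN : 1 ≤ N)
    (b : (Fin N → ℝ) → (Fin N → ℝ)) (hbC : ContDiff ℝ 1 b)
    (hbLip : ∃ L : NNReal, LipschitzWith L b)
    (hbGrowth : ∃ c : ℝ, ∀ x, ‖b x‖ ≤ c * (1 + ‖x‖))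
    (γ : ℝ → (Fin N → ℝ) → (Fin N → ℝ))
    (hγ0 : ∀ x, γ 0 x = x)
    (hγ : ∀ x t, 0 ≤ t → HasDerivAt (fun s => γ s x) (b (γ t x)) t)
    (f : Fin N → (Fin N → ℝ) → ℝ)
    (hfpos : ∀ i x, 0 < f i x)
    (hfLip : ∀ i, ∃ L : NNReal, LipschitzWith L (f i))
    (hfbdd : ∀ i, ∃ c : ℝ, ∀ x, f i x ≤ c)
    (hfdiv : ∀ x, (∫⁻ s in Ioi (0:ℝ), ENNReal.ofReal (∑ i, f i (γ s x))) = ⊤)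
    (a : Fin N → (Fin N → ℝ) → (Fin N → ℝ)) (haC : ∀ i, ContDiff ℝ 1 (a i))
    -- the jump-chain kernel and its iterates
    (K : Kernel (Fin N → ℝ) (Fin N → ℝ)) [IsMarkovKernel K]
    (hK : ∀ x (B : Set (Fin N → ℝ)), MeasurableSet B →
      K x B = ENNReal.ofReal (∑ i,
        (f i x / ∑ j, f j x) *
          ∫ t in Ioi (0:ℝ),
            (∑ j, f j (γ t (x + a i x))) *
              Real.exp (-∫ s in (0:ℝ)..t, ∑ j, f j (γ s (x + a i x))) *
              B.indicator (fun _ => (1:ℝ)) (γ t (x + a i x))))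
    (Kpow : ℕ → Kernel (Fin N → ℝ) (Fin N → ℝ))
    (hKpow0 : Kpow 0 = K)
    (hKpowS : ∀ m, Kpow (m + 1) = K.comp (Kpow m))
    -- the data `n ≥ 1`, `i_0,…,i_n`
    (n : ℕ) (hn : 1 ≤ n) (idx : ℕ → Fin N)
    -- the chain of configurations `x̄_0 = Δ_{i_0}(y)`, `x̄_k = Δ_{i_k}(x̄_{k-1})`
    (xb : (Fin N → ℝ) → ℕ → (Fin N → ℝ))
    (hxb0 : ∀ y, xb y 0 = y + a (idx 0) y)
    (hxbS : ∀ y k, k < n → xb y (k + 1) = xb y k + a (idx (k + 1)) (xb y k))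
    -- the partial products `C_k(y) = A^{i_n}(x̄_{n-1}) ⋯ A^{i_k}(x̄_{k-1})`, `C_{n+1}(y) = Id`
    (Cmap : (Fin N → ℝ) → ℕ → ((Fin N → ℝ) →L[ℝ] (Fin N → ℝ)))
    (hCtop : ∀ y, Cmap y (n + 1) = ContinuousLinearMap.id ℝ (Fin N → ℝ))
    (hCS : ∀ y k, 1 ≤ k → k ≤ n →
      Cmap y k = (Cmap y (k + 1)).comp
        (fderiv ℝ (fun z => z + a (idx k) z) (xb y (k - 1))))
    -- uniform non-degeneracy: `inf_y det(σ(y)σ(y)ᵀ) > 0`, where the columns of `σ(y)` are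
    -- the vectors `V_1(y),…,V_{n+1}(y)` (`V_{n+1-j}(y) = C_{j+1}(y) b(x̄_j(y))`, `0 ≤ j ≤ n`)
    (hσ : ∃ c : ℝ, 0 < c ∧ ∀ y : Fin N → ℝ,
      c ≤ Matrix.det
        ((Matrix.of (fun (i : Fin N) (j : Fin (n + 1)) => Cmap y ((j : ℕ) + 1) (b (xb y j)) i)) *
          (Matrix.of (fun (i : Fin N) (j : Fin (n + 1)) =>
            Cmap y ((j : ℕ) + 1) (b (xb y j)) i))ᵀ)) :
    ∀ z₀ : Fin N → ℝ, ∃ (zstar : Fin N → ℝ) (δ₁ δ₂ β : ℝ),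
      0 < δ₁ ∧ 0 < δ₂ ∧ 0 < β ∧ β < 1 ∧
      ∃ ν : (Fin N → ℝ) → ℝ,
        ContDiff ℝ (⊤ : ℕ∞) ν ∧ (∀ y, 0 ≤ ν y) ∧ (∫ y, ν y) = 1 ∧
        tsupport ν ⊆ Metric.ball zstar δ₂ ∧
        ∀ x ∈ Metric.ball z₀ δ₁, ∀ B : Set (Fin N → ℝ), MeasurableSet B →
          ENNReal.ofReal (β * ∫ y in B, ν y) ≤ Kpow n x B := by
  intro z₀
  obtain ⟨L, hL⟩ := hbLip
  have hfcont : ∀ i, Continuous (f i) := fun i => (hfLip i).choose_spec.continuous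
  have hflow := continuous_flow hL hγ0 hγ
  let Δ : ℕ → (Fin N → ℝ) → (Fin N → ℝ) := fun k z => z + a (idx k) z
  let p : ℕ → (Fin N → ℝ) := fun k => Nat.casesOn k z₀ (xb z₀)
  let v : ℕ → (Fin N → ℝ) := fun k => b (xb z₀ k)
  let G : ℕ → ℝ × (Fin N → ℝ) → (Fin N → ℝ) := fun k => extendedFlow γ (v k)
  let A : ℕ → (Fin N → ℝ) →L[ℝ] (Fin N → ℝ) := fun k => fderiv ℝ (Δ k) (p k)
  let Q : ℕ → Kernel (Fin N → ℝ) (Fin N → ℝ) := fun k => Nat.casesOn k Kernel.id Kpow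
  have hG : ∀ k x, G k (0, x) = x := fun k x => by
    simp only [G, extendedFlow_of_nonneg γ _ le_rfl, hγ0]
  have hGc : ∀ k, Continuous (G k) := fun k => continuous_extendedFlow hL hγ0 hγ _
  have hΔC : ∀ k, ContDiff ℝ 1 (Δ k) := fun k => contDiff_id.add (haC _)
  have hp : ∀ k < n + 1, Δ k (p k) = p (k + 1)
    | 0, _ => (hxb0 z₀).symm
    | k + 1, hk => (hxbS z₀ k (by lia)).symm
  have hQ : ∀ k, Q (k + 1) = K ∘ₖ Q k
    | 0 => by
      change Kpow 0 = K ∘ₖ Kernel.id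
      rw [hKpow0, Kernel.comp_id]
    | k + 1 => hKpowS k
  have hKlocal : ∀ k < n + 1, ∃ c : ENNReal, c ≠ 0 ∧ ∃ η : ℝ, 0 < η ∧
      ∀ᶠ z in nhds (p k), ∀ B : Set (Fin N → ℝ), MeasurableSet B →
        c * volume {s ∈ Icc 0 η | G k (s, Δ k z) ∈ B} ≤ K z B := by
    intro k _
    obtain ⟨c, hc, η, hη, h⟩ := jumpKernel_locally_ge hγ0 hflow hfpos hfcont hfbdd
      (fun i => (haC i).continuous) hK (idx k) (p k)
    refine ⟨c, hc, η, hη, h.mono fun z hz B hB => le_trans ?_ (hz B hB)⟩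
    refine mul_le_mul_right (measure_mono ?_) c
    rintro s ⟨hs, hsB⟩
    exact ⟨hs, by simpa only [G, extendedFlow_of_nonneg γ _ hs.1] using hsB⟩
  obtain ⟨c, hc, r, hr, hiter⟩ := iterate_kernel_ge (Q := Q) rfl hQ hGc
    (fun k => (hΔC k).continuous) hG hp hKlocal (n + 1) le_rfl
  have hderiv := hasStrictFDerivAt_jumpFlow (v := v) (A := A) hG hp
    (fun k _ => hasStrictFDerivAt_extendedFlow hL hγ0 hγ (xb z₀ k))
    (fun k _ => (hΔC k).contDiffAt.hasStrictFDerivAt one_ne_zero) (n + 1) le_rfl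
  obtain ⟨c₀, hc₀, hdet⟩ := hσ
  obtain ⟨R, hR⟩ := exists_rightInverse_of_det_ne_zero _ (hc₀.trans_le (hdet z₀)).ne'
  have hDR : ∀ u, jumpFlowDeriv A v (n + 1) (0, R u) = u := by
    intro u
    have hC : ∀ k, 1 ≤ k → k ≤ n → Cmap z₀ k = (Cmap z₀ (k + 1)).comp (A k)
      | k + 1, h1, hk => hCS z₀ (k + 1) h1 hk
    have h := comp_jumpFlowDeriv_apply (v := v) hC n le_rfl (R u)
    rw [hCtop, ContinuousLinearMap.id_apply] at h
    rw [h]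
    conv_rhs => rw [← hR u]
    ext i
    simp [Matrix.mulVec, dotProduct, v, mul_comm]
  obtain ⟨η, hη, z, δ, hδ, κ, hκ, hcover⟩ := map_volume_box_ge
    (continuous_jumpFlow hGc (fun k => (hΔC k).continuous) (n + 1)) hderiv R hDR hr
  obtain ⟨β, hβ0, hβ1, ν, hν, hν0, hν1, hνs, hνB⟩ :=
    exists_smooth_density_le z hδ (mul_ne_zero hc hκ)
  obtain ⟨δ₁, hδ₁, hball⟩ := Metric.eventually_nhds_iff_ball.1 (hiter.and hcover)
  refine ⟨z, δ₁, δ, β, hδ₁, hδ, hβ0, hβ1, ν, hν, hν0, hν1, hνs, fun x hx B hB => ?_⟩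
  obtain ⟨h1, h2⟩ := hball x hx
  calc ENNReal.ofReal (β * ∫ y in B, ν y) ≤ c * κ * volume (B ∩ Metric.ball z δ) := hνB B hB
    _ = c * (κ • volume.restrict (Metric.ball z δ)) B := by
        rw [Measure.smul_apply, Measure.restrict_apply hB, smul_eq_mul, mul_assoc]
    _ ≤ c * _ := mul_le_mul_right (h2 B) c
    _ ≤ Kpow n x B := h1 η hη B
end
end

section
/- Fix 1 ≤ i ≤ N and let π be the image of m under the coordinate projection x ↦ x^i. Then for every d > (k+2)·A·B, the restriction of π to the open set S_{d,k+2} admits a bounded continuous Lebesgue density p_π; moreover p_π ∈ C^k(S_{d,k+2}), and for every α ∈ (0,1) there exists a constant C depending only on N, k, d, A, a, F, B and α (but not otherwise on b̃, the f_i, the a_i^j, or m) such that sup_{0 ≤ ℓ ≤ k, v ∈ S_{d,k+2}} |p_π^{(ℓ)}(v)| + sup_{v ≠ v', v, v' ∈ S_{d,k+2}} |p_π^{(k)}(v) − p_π^{(k)}(v')| / |v − v'|^α ≤ C. -/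
open MeasureTheory Set

noncomputable section

/-- The house-of-cards jump map `Δ_i`: coordinate `i` is reset to `0`, coordinate `j ≠ i`
is moved to `x^j + a_i^j(x^j)`. -/
def jmap (N : ℕ) (aij : Fin N → Fin N → ℝ → ℝ) (i : Fin N) (x : Fin N → ℝ) : Fin N → ℝ :=
  fun j => if j = i then 0 else x j + aij i j (x j)

/-- The coordinatewise flow `γ_t(x) = (γ̃_t(x^1),…,γ̃_t(x^N))`. -/
def flowN (N : ℕ) (γt : ℝ → ℝ → ℝ) (t : ℝ) (x : Fin N → ℝ) : Fin N → ℝ :=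
  fun j => γt t (x j)

/-- The survival factor `e(x,t) = exp(-∫_0^t f̄(γ_s(x)) ds)`. -/
def surv (N : ℕ) (γt : ℝ → ℝ → ℝ) (f : Fin N → ℝ → ℝ) (x : Fin N → ℝ) (t : ℝ) : ℝ :=
  Real.exp (-∫ s in (0:ℝ)..t, ∑ i, f i (γt s (x i)))

section Auxiliary

open Filter Topology

/-- `φ` has `r` derivatives on `U`, all bounded by `C`, the last one being `C`-Lipschitz on every
segment contained in `U`. -/
def HasLipDerivs : ℕ → ℝ → Set ℝ → (ℝ → ℝ) → Prop
  | 0, C, U, φ => (∀ v ∈ U, |φ v| ≤ C) ∧ ∀ u v, uIcc u v ⊆ U → |φ u - φ v| ≤ C * |u - v|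
  | r + 1, C, U, φ => (∀ v ∈ U, |φ v| ≤ C) ∧
      ∃ φ' : ℝ → ℝ, (∀ v ∈ U, HasDerivAt φ (φ' v) v) ∧ HasLipDerivs r C U φ'

namespace HasLipDerivs

theorem bound {r : ℕ} {C : ℝ} {U : Set ℝ} {φ : ℝ → ℝ} (h : HasLipDerivs r C U φ) :
    ∀ v ∈ U, |φ v| ≤ C := by
  cases r with
  | zero => exact h.1
  | succ r => exact h.1

theorem mono {r : ℕ} {C C' : ℝ} {U U' : Set ℝ} {φ : ℝ → ℝ} (h : HasLipDerivs r C U φ)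
    (hC : C ≤ C') (hU : U' ⊆ U) : HasLipDerivs r C' U' φ := by
  induction r generalizing φ with
  | zero =>
    exact ⟨fun v hv => (h.1 v (hU hv)).trans hC, fun u v huv =>
      (h.2 u v (huv.trans hU)).trans (mul_le_mul_of_nonneg_right hC (abs_nonneg _))⟩
  | succ r ih =>
    obtain ⟨h1, φ', h2, h3⟩ := h
    exact ⟨fun v hv => (h1 v (hU hv)).trans hC, φ', fun v hv => h2 v (hU hv), ih h3⟩

theorem of_hasDerivAt {C : ℝ} {U : Set ℝ} {φ φ' : ℝ → ℝ} (hφ : ∀ v ∈ U, |φ v| ≤ C)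
    (hd : ∀ v ∈ U, HasDerivAt φ (φ' v) v) (hφ' : ∀ v ∈ U, |φ' v| ≤ C) :
    HasLipDerivs 0 C U φ := by
  refine ⟨hφ, fun u v huv => ?_⟩
  have := (convex_uIcc u v).norm_image_sub_le_of_norm_hasDerivWithin_le (f := φ) (f' := φ') (C := C)
    (fun x hx => (hd x (huv hx)).hasDerivWithinAt) (fun x hx => hφ' x (huv hx))
    right_mem_uIcc left_mem_uIcc
  simpa using this

theorem of_succ {r : ℕ} {C : ℝ} {U : Set ℝ} {φ : ℝ → ℝ} (h : HasLipDerivs (r + 1) C U φ) :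
    HasLipDerivs r C U φ := by
  induction r generalizing φ with
  | zero =>
    obtain ⟨h1, φ', h2, h3⟩ := h
    exact of_hasDerivAt h1 h2 h3.bound
  | succ r ih =>
    obtain ⟨h1, φ', h2, h3⟩ := h
    exact ⟨h1, φ', h2, ih h3⟩

theorem add {r : ℕ} {C C' : ℝ} {U : Set ℝ} {φ ψ : ℝ → ℝ} (h : HasLipDerivs r C U φ)
    (h' : HasLipDerivs r C' U ψ) : HasLipDerivs r (C + C') U (fun v => φ v + ψ v) := by
  induction r generalizing φ ψ with
  | zero =>
    refine ⟨fun v hv => (abs_add_le _ _).trans (add_le_add (h.1 v hv) (h'.1 v hv)),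
      fun u v huv => ?_⟩
    have h1 := h.2 u v huv
    have h2 := h'.2 u v huv
    calc |φ u + ψ u - (φ v + ψ v)| = |(φ u - φ v) + (ψ u - ψ v)| := by ring_nf
      _ ≤ |φ u - φ v| + |ψ u - ψ v| := abs_add_le _ _
      _ ≤ _ := by rw [add_mul]; exact add_le_add h1 h2
  | succ r ih =>
    obtain ⟨h1, φ', h2, h3⟩ := h
    obtain ⟨h1', ψ', h2', h3'⟩ := h'
    exact ⟨fun v hv => (abs_add_le _ _).trans (add_le_add (h1 v hv) (h1' v hv)), _,
      fun v hv => (h2 v hv).add (h2' v hv), ih h3 h3'⟩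

theorem neg {r : ℕ} {C : ℝ} {U : Set ℝ} {φ : ℝ → ℝ} (h : HasLipDerivs r C U φ) :
    HasLipDerivs r C U (fun v => -φ v) := by
  induction r generalizing φ with
  | zero =>
    refine ⟨fun v hv => by simpa using h.1 v hv, fun u v huv => ?_⟩
    have := h.2 u v huv
    rwa [abs_sub_comm, ← neg_sub_neg] at this
  | succ r ih =>
    obtain ⟨h1, φ', h2, h3⟩ := h
    exact ⟨fun v hv => by simpa using h1 v hv, _, fun v hv => (h2 v hv).neg, ih h3⟩

theorem of_locally_const {r : ℕ} {C : ℝ} {U : Set ℝ} {φ : ℝ → ℝ} (hC : ∀ v ∈ U, |φ v| ≤ C)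
    (hC0 : 0 ≤ C) (h : ∀ u v, uIcc u v ⊆ U → φ u = φ v) (hU : IsOpen U) :
    HasLipDerivs r C U φ := by
  induction r generalizing φ with
  | zero => exact ⟨hC, fun u v huv => by rw [h u v huv, sub_self, abs_zero]; positivity⟩
  | succ r ih =>
    refine ⟨hC, fun _ => 0, fun v hv => ?_, ih (fun _ _ => by simpa using hC0) (fun _ _ _ => rfl)⟩
    obtain ⟨ε, hε, hb⟩ := Metric.isOpen_iff.1 hU v hv
    refine (hasDerivAt_const v (φ v)).congr_of_eventuallyEq ?_
    filter_upwards [Metric.ball_mem_nhds v hε] with w hw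
    exact h w v (((convex_ball v ε).ordConnected.uIcc_subset hw (Metric.mem_ball_self hε)).trans hb)

theorem sum {ι : Type*} (s : Finset ι) {r : ℕ} {C : ℝ} {U : Set ℝ} {φ : ι → ℝ → ℝ}
    (hU : IsOpen U) (h : ∀ j ∈ s, HasLipDerivs r C U (φ j)) :
    HasLipDerivs r (s.card * C) U (fun v => ∑ j ∈ s, φ j v) := by
  classical
  induction s using Finset.induction_on with
  | empty => exact of_locally_const (by simp) (by simp) (by simp) hU
  | insert j s hj ih =>
    simp only [Finset.sum_insert hj, Finset.card_insert_of_notMem hj]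
    refine ((h j (by simp)).add (ih fun l hl => h l (by simp [hl]))).mono ?_ le_rfl
    push_cast
    linarith

theorem exists_mul (r : ℕ) (C C' : ℝ) : ∃ C'' : ℝ, ∀ (U : Set ℝ) (φ ψ : ℝ → ℝ),
    HasLipDerivs r C U φ → HasLipDerivs r C' U ψ →
    HasLipDerivs r C'' U (fun v => φ v * ψ v) := by
  have key : ∀ (U : Set ℝ) (φ ψ : ℝ → ℝ), (∀ v ∈ U, |φ v| ≤ C) → (∀ v ∈ U, |ψ v| ≤ C') →
      ∀ v ∈ U, |φ v * ψ v| ≤ |C| * |C'| := fun U φ ψ h h' v hv => by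
    rw [abs_mul]
    exact mul_le_mul ((h v hv).trans (le_abs_self _)) ((h' v hv).trans (le_abs_self _))
      (abs_nonneg _) (abs_nonneg _)
  induction r with
  | zero =>
    refine ⟨2 * (|C| * |C'|), fun U φ ψ h h' => ⟨fun v hv => ?_, fun u v huv => ?_⟩⟩
    · have := key U φ ψ h.1 h'.1 v hv
      have : 0 ≤ |C| * |C'| := by positivity
      linarith
    · have hu := huv left_mem_uIcc
      have hv := huv right_mem_uIcc
      calc |φ u * ψ u - φ v * ψ v| = |φ u * (ψ u - ψ v) + (φ u - φ v) * ψ v| := by ring_nf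
        _ ≤ |φ u| * |ψ u - ψ v| + |φ u - φ v| * |ψ v| := by
            rw [← abs_mul, ← abs_mul]; exact abs_add_le _ _
        _ ≤ |C| * (|C'| * |u - v|) + (|C| * |u - v|) * |C'| := by
            have h1 := (h.1 u hu).trans (le_abs_self _)
            have h2 := (h'.1 v hv).trans (le_abs_self _)
            have h3 := (h.2 u v huv).trans
              (mul_le_mul_of_nonneg_right (le_abs_self C) (abs_nonneg _))
            have h4 := (h'.2 u v huv).trans
              (mul_le_mul_of_nonneg_right (le_abs_self C') (abs_nonneg _))
            gcongr
        _ = _ := by ring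
  | succ r ih =>
    obtain ⟨K, hK⟩ := ih
    refine ⟨max (K + K) (|C| * |C'|), fun U φ ψ h h' => ⟨fun v hv =>
      (key U φ ψ h.bound h'.bound v hv).trans (le_max_right _ _), ?_⟩⟩
    obtain ⟨-, φ', h2, h3⟩ := id h
    obtain ⟨-, ψ', h2', h3'⟩ := id h'
    exact ⟨_, fun v hv => (h2 v hv).mul (h2' v hv),
      ((hK U _ _ h3 h'.of_succ).add (hK U _ _ h.of_succ h3')).mono (le_max_left _ _) le_rfl⟩

theorem exists_inv (r : ℕ) (C d : ℝ) (hd : 0 < d) : ∃ C' : ℝ, ∀ (U : Set ℝ) (φ : ℝ → ℝ),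
    HasLipDerivs r C U φ → (∀ v ∈ U, d ≤ |φ v|) →
    HasLipDerivs r C' U (fun v => (φ v)⁻¹) := by
  have key : ∀ (U : Set ℝ) (φ : ℝ → ℝ), (∀ v ∈ U, d ≤ |φ v|) → ∀ v ∈ U, |(φ v)⁻¹| ≤ d⁻¹ :=
    fun U φ h v hv => by
      rw [abs_inv]
      exact inv_anti₀ hd (h v hv)
  induction r with
  | zero =>
    refine ⟨max d⁻¹ (|C| * d⁻¹ * d⁻¹), fun U φ h h' => ⟨fun v hv =>
      (key U φ h' v hv).trans (le_max_left _ _), fun u v huv => ?_⟩⟩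
    have hu := huv left_mem_uIcc
    have hv := huv right_mem_uIcc
    have hu0 : φ u ≠ 0 := abs_pos.1 (hd.trans_le (h' u hu))
    have hv0 : φ v ≠ 0 := abs_pos.1 (hd.trans_le (h' v hv))
    have h3 := (h.2 u v huv).trans
              (mul_le_mul_of_nonneg_right (le_abs_self C) (abs_nonneg _))
    have : (φ u)⁻¹ - (φ v)⁻¹ = -((φ u - φ v) * (φ u)⁻¹ * (φ v)⁻¹) := by
      field_simp; ring
    rw [this, abs_neg, abs_mul, abs_mul]
    calc _ ≤ (|C| * |u - v|) * d⁻¹ * d⁻¹ := by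
            gcongr
            · exact key U φ h' u hu
            · exact key U φ h' v hv
      _ = (|C| * d⁻¹ * d⁻¹) * |u - v| := by ring
      _ ≤ _ := by gcongr; exact le_max_right _ _
  | succ r ih =>
    obtain ⟨K, hK⟩ := ih
    obtain ⟨K1, hK1⟩ := exists_mul r K K
    obtain ⟨K2, hK2⟩ := exists_mul r C K1
    refine ⟨max K2 d⁻¹, fun U φ h h' => ⟨fun v hv =>
      (key U φ h' v hv).trans (le_max_right _ _), ?_⟩⟩
    obtain ⟨-, φ', h2, h3⟩ := id h
    have hi := hK U φ h.of_succ h'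
    refine ⟨fun v => -(φ' v * ((φ v)⁻¹ * (φ v)⁻¹)), fun v hv => ?_,
      (hK2 U _ _ h3 (hK1 U _ _ hi hi)).neg.mono (le_max_left _ _) le_rfl⟩
    have hv0 : φ v ≠ 0 := abs_pos.1 (hd.trans_le (h' v hv))
    have hi' := (h2 v hv).fun_inv hv0
    rwa [div_eq_mul_inv, pow_two, mul_inv, neg_mul] at hi'

theorem comp_zero {C C' : ℝ} (hC : 0 ≤ C) {U V : Set ℝ} {φ ψ ψ' : ℝ → ℝ}
    (hφ : HasLipDerivs 0 C V φ) (hUV : MapsTo ψ U V)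
    (hψ : ∀ v ∈ U, HasDerivAt ψ (ψ' v) v) (hψ' : ∀ v ∈ U, |ψ' v| ≤ C') :
    HasLipDerivs 0 (max C (C * C')) U (fun v => φ (ψ v)) := by
  refine ⟨fun v hv => (hφ.1 _ (hUV hv)).trans (le_max_left _ _), fun u v huv => ?_⟩
  have h1 : uIcc (ψ u) (ψ v) ⊆ V :=
    (intermediate_value_uIcc fun x hx => (hψ x (huv hx)).continuousAt.continuousWithinAt).trans
      (image_subset_iff.2 fun x hx => hUV (huv hx))
  have h2 := (convex_uIcc u v).norm_image_sub_le_of_norm_hasDerivWithin_le (f := ψ) (f' := ψ')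
    (C := C') (fun x hx => (hψ x (huv hx)).hasDerivWithinAt) (fun x hx => hψ' x (huv hx))
    right_mem_uIcc left_mem_uIcc
  simp only [Real.norm_eq_abs] at h2
  calc |φ (ψ u) - φ (ψ v)| ≤ C * |ψ u - ψ v| := hφ.2 _ _ h1
    _ ≤ C * (C' * |u - v|) := by gcongr
    _ = (C * C') * |u - v| := by ring
    _ ≤ _ := by gcongr; exact le_max_right _ _

theorem exists_comp (r : ℕ) (C C' : ℝ) (hC : 0 ≤ C) : ∃ C'' : ℝ,
    ∀ (U V : Set ℝ) (φ ψ ψ' : ℝ → ℝ), HasLipDerivs (r + 1) C V φ → MapsTo ψ U V →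
    (∀ v ∈ U, HasDerivAt ψ (ψ' v) v) → HasLipDerivs r C' U ψ' →
    HasLipDerivs (r + 1) C'' U (fun v => φ (ψ v)) := by
  induction r with
  | zero =>
    obtain ⟨K, hK⟩ := exists_mul 0 (max C (C * C')) C'
    refine ⟨max C K, fun U V φ ψ ψ' hφ hUV hψ hψ' => ?_⟩
    obtain ⟨h1, φ', h2, h3⟩ := hφ
    exact ⟨fun v hv => (h1 _ (hUV hv)).trans (le_max_left _ _), _,
      fun v hv => (h2 _ (hUV hv)).comp v (hψ v hv),
      (hK U _ _ (comp_zero hC h3 hUV hψ hψ'.bound) hψ').mono (le_max_right _ _) le_rfl⟩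
  | succ r ih =>
    obtain ⟨K', hK'⟩ := ih
    obtain ⟨K, hK⟩ := exists_mul (r + 1) K' C'
    refine ⟨max C K, fun U V φ ψ ψ' hφ hUV hψ hψ' => ?_⟩
    obtain ⟨h1, φ', h2, h3⟩ := hφ
    exact ⟨fun v hv => (h1 _ (hUV hv)).trans (le_max_left _ _), _,
      fun v hv => (h2 _ (hUV hv)).comp v (hψ v hv),
      (hK U _ _ (hK' U V φ' ψ ψ' h3 hUV hψ hψ'.of_succ) hψ').mono (le_max_right _ _) le_rfl⟩

/-- Composition with an inner function having one more derivative than strictly necessary. -/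
theorem exists_comp' (r : ℕ) (C C' : ℝ) (hC : 0 ≤ C) : ∃ C'' : ℝ,
    ∀ (U V : Set ℝ) (φ ψ ψ' : ℝ → ℝ), HasLipDerivs r C V φ → MapsTo ψ U V →
    (∀ v ∈ U, HasDerivAt ψ (ψ' v) v) → HasLipDerivs r C' U ψ' →
    HasLipDerivs r C'' U (fun v => φ (ψ v)) := by
  cases r with
  | zero =>
    exact ⟨_, fun U V φ ψ ψ' hφ hUV hψ hψ' => comp_zero hC hφ hUV hψ hψ'.bound⟩
  | succ r =>
    obtain ⟨K, hK⟩ := exists_comp r C C' hC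
    exact ⟨K, fun U V φ ψ ψ' hφ hUV hψ hψ' => hK U V φ ψ ψ' hφ hUV hψ hψ'.of_succ⟩

theorem of_iteratedDeriv_le {r : ℕ} {M : ℝ} {g : ℝ → ℝ} (U : Set ℝ)
    (hg : ContDiff ℝ (r + 1 : ℕ) g) (hM : ∀ l ≤ r + 1, ∀ v, |iteratedDeriv l g v| ≤ M) :
    HasLipDerivs r M U g := by
  have hb : ∀ v, |g v| ≤ M := fun v => by simpa using hM 0 (Nat.zero_le _) v
  have hd : ∀ v, HasDerivAt g (deriv g v) v := fun v =>
    ((hg.differentiable (by simp)) v).hasDerivAt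
  induction r generalizing g with
  | zero =>
    refine of_hasDerivAt (fun v _ => hb v) (fun v _ => hd v) fun v _ => ?_
    simpa using hM 1 le_rfl v
  | succ r ih =>
    have hg' : ContDiff ℝ (r + 1 : ℕ) (deriv g) := by
      have : ContDiff ℝ ((r + 1 : ℕ) + 1) g := by exact_mod_cast hg
      exact (contDiff_succ_iff_deriv.1 this).2.2
    have hM' : ∀ l ≤ r + 1, ∀ v, |iteratedDeriv l (deriv g) v| ≤ M := fun l hl v => by
      rw [← iteratedDeriv_succ']; exact hM (l + 1) (by omega) v
    exact ⟨fun v _ => hb v, deriv g, fun v _ => hd v, ih hg' hM'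
      (fun v => by simpa using hM' 0 (Nat.zero_le _) v)
      fun v => ((hg'.differentiable (by simp)) v).hasDerivAt⟩

theorem contDiffOn {r : ℕ} {C : ℝ} {U : Set ℝ} {φ : ℝ → ℝ} (hU : IsOpen U)
    (h : HasLipDerivs r C U φ) : ContDiffOn ℝ r φ U := by
  induction r generalizing φ with
  | zero =>
    simp only [CharP.cast_eq_zero, contDiffOn_zero]
    intro v hv
    obtain ⟨ε, hε, hb⟩ := Metric.isOpen_iff.1 hU v hv
    have : LipschitzOnWith (Real.toNNReal C) φ (Metric.ball v ε) :=
      LipschitzOnWith.of_dist_le_mul fun x hx y hy => by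
        rw [Real.dist_eq, Real.dist_eq]
        refine (h.2 x y (((convex_ball v ε).ordConnected.uIcc_subset hx hy).trans hb)).trans ?_
        gcongr
        exact Real.le_coe_toNNReal C
    exact (this.continuousOn.continuousAt (Metric.ball_mem_nhds v hε)).continuousWithinAt
  | succ r ih =>
    obtain ⟨h1, φ', h2, h3⟩ := h
    have : ContDiffOn ℝ ((r : WithTop ℕ∞) + 1) φ U := by
      rw [contDiffOn_succ_iff_deriv_of_isOpen hU]
      refine ⟨fun v hv => (h2 v hv).differentiableAt.differentiableWithinAt, by simp, ?_⟩
      exact (ih h3).congr fun v hv => (h2 v hv).deriv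
    exact_mod_cast this

theorem iteratedDeriv_le {r : ℕ} {C : ℝ} {U : Set ℝ} {φ : ℝ → ℝ} (hU : IsOpen U)
    (h : HasLipDerivs r C U φ) {l : ℕ} (hl : l ≤ r) {v : ℝ} (hv : v ∈ U) :
    |iteratedDeriv l φ v| ≤ C := by
  induction r generalizing φ l with
  | zero => obtain rfl : l = 0 := by omega
            simpa using h.1 v hv
  | succ r ih =>
    obtain ⟨h1, φ', h2, h3⟩ := h
    cases l with
    | zero => simpa using h1 v hv
    | succ l =>
      have he : deriv φ =ᶠ[nhds v] φ' := by
        filter_upwards [hU.mem_nhds hv] with w hw using (h2 w hw).deriv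
      rw [iteratedDeriv_succ', he.iteratedDeriv_eq l]
      exact ih h3 (by omega)

theorem iteratedDeriv_sub_le {r : ℕ} {C : ℝ} {U : Set ℝ} {φ : ℝ → ℝ} (hU : IsOpen U)
    (h : HasLipDerivs r C U φ) {u v : ℝ} (huv : uIcc u v ⊆ U) :
    |iteratedDeriv r φ u - iteratedDeriv r φ v| ≤ C * |u - v| := by
  induction r generalizing φ with
  | zero => simpa using h.2 u v huv
  | succ r ih =>
    obtain ⟨h1, φ', h2, h3⟩ := h
    have he : ∀ w ∈ U, deriv φ =ᶠ[nhds w] φ' := fun w hw => by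
      filter_upwards [hU.mem_nhds hw] with w hw using (h2 w hw).deriv
    rw [iteratedDeriv_succ', (he u (huv left_mem_uIcc)).iteratedDeriv_eq r,
      (he v (huv right_mem_uIcc)).iteratedDeriv_eq r]
    exact ih h3

end HasLipDerivs

/-- `K` is measurable, has partial derivatives up to order `r`, and all of them, including `K`
itself, are measurable and bounded by `M`. -/
def HasBddPartials {N : ℕ} : ℕ → ℝ → ((Fin N → ℝ) → ℝ) → Prop
  | 0, M, K => Measurable K ∧ ∀ x, |K x| ≤ M
  | r + 1, M, K => (Measurable K ∧ ∀ x, |K x| ≤ M) ∧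
      ∃ D : Fin N → (Fin N → ℝ) → ℝ,
        (∀ x, HasFDerivAt K
          (∑ l, D l x • (ContinuousLinearMap.proj l : (Fin N → ℝ) →L[ℝ] ℝ)) x) ∧
        ∀ l, HasBddPartials r M (D l)

/-- The derivative of `K` along the vector field `x ↦ (b (x l))_l`. -/
def lieDeriv {N : ℕ} (b : ℝ → ℝ) (K : (Fin N → ℝ) → ℝ) (x : Fin N → ℝ) : ℝ :=
  fderiv ℝ K x fun l => b (x l)

namespace HasBddPartials

variable {N : ℕ}

theorem measurable_and_bound {r : ℕ} {M : ℝ} {K : (Fin N → ℝ) → ℝ} (h : HasBddPartials r M K) :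
    Measurable K ∧ ∀ x, |K x| ≤ M := by
  cases r with
  | zero => exact h
  | succ r => exact h.1

theorem measurable {r : ℕ} {M : ℝ} {K : (Fin N → ℝ) → ℝ} (h : HasBddPartials r M K) :
    Measurable K := h.measurable_and_bound.1

theorem bound {r : ℕ} {M : ℝ} {K : (Fin N → ℝ) → ℝ} (h : HasBddPartials r M K) (x : Fin N → ℝ) :
    |K x| ≤ M := h.measurable_and_bound.2 x

theorem nonneg {r : ℕ} {M : ℝ} {K : (Fin N → ℝ) → ℝ} (h : HasBddPartials r M K) : 0 ≤ M :=
  (abs_nonneg _).trans (h.bound 0)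

theorem differentiable {r : ℕ} {M : ℝ} {K : (Fin N → ℝ) → ℝ} (h : HasBddPartials (r + 1) M K) :
    Differentiable ℝ K := by
  obtain ⟨-, D, h2, -⟩ := h
  exact fun x => (h2 x).differentiableAt

theorem mono {r : ℕ} {M M' : ℝ} {K : (Fin N → ℝ) → ℝ} (h : HasBddPartials r M K) (hM : M ≤ M') :
    HasBddPartials r M' K := by
  induction r generalizing K with
  | zero => exact ⟨h.1, fun x => (h.2 x).trans hM⟩
  | succ r ih =>
    obtain ⟨h1, D, h2, h3⟩ := h
    exact ⟨⟨h1.1, fun x => (h1.2 x).trans hM⟩, D, h2, fun l => ih (h3 l)⟩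

theorem of_succ {r : ℕ} {M : ℝ} {K : (Fin N → ℝ) → ℝ} (h : HasBddPartials (r + 1) M K) :
    HasBddPartials r M K := by
  induction r generalizing K with
  | zero => exact h.1
  | succ r ih =>
    obtain ⟨h1, D, h2, h3⟩ := h
    exact ⟨h1, D, h2, fun l => ih (h3 l)⟩

theorem const (r : ℕ) (c : ℝ) : HasBddPartials r |c| (fun _ : Fin N → ℝ => c) := by
  have h0 : ∀ r, HasBddPartials r |c| (fun _ : Fin N → ℝ => (0 : ℝ)) := fun r => by
    induction r with
    | zero => exact ⟨measurable_const, fun _ => by simp⟩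
    | succ r ih =>
      exact ⟨⟨measurable_const, fun _ => by simp⟩, fun _ _ => 0,
        fun x => by simpa using hasFDerivAt_const (0 : ℝ) x, fun _ => ih⟩
  cases r with
  | zero => exact ⟨measurable_const, fun _ => le_rfl⟩
  | succ r => exact ⟨⟨measurable_const, fun _ => le_rfl⟩, fun _ _ => 0,
        fun x => by simpa using hasFDerivAt_const c x, fun _ => h0 r⟩

theorem add {r : ℕ} {M M' : ℝ} {K K' : (Fin N → ℝ) → ℝ} (h : HasBddPartials r M K)
    (h' : HasBddPartials r M' K') : HasBddPartials r (M + M') (fun x => K x + K' x) := by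
  have key : Measurable (fun x => K x + K' x) ∧ ∀ x, |K x + K' x| ≤ M + M' :=
    ⟨h.measurable.add h'.measurable,
      fun x => (abs_add_le _ _).trans (add_le_add (h.bound x) (h'.bound x))⟩
  induction r generalizing K K' with
  | zero => exact key
  | succ r ih =>
    obtain ⟨-, D, h2, h3⟩ := h
    obtain ⟨-, D', h2', h3'⟩ := h'
    refine ⟨key, fun l x => D l x + D' l x, fun x => ?_, fun l => ih (h3 l) (h3' l)
      ⟨(h3 l).measurable.add (h3' l).measurable,
        fun x => (abs_add_le _ _).trans (add_le_add ((h3 l).bound x) ((h3' l).bound x))⟩⟩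
    simp only [add_smul, Finset.sum_add_distrib]
    exact (h2 x).add (h2' x)

theorem neg {r : ℕ} {M : ℝ} {K : (Fin N → ℝ) → ℝ} (h : HasBddPartials r M K) :
    HasBddPartials r M (fun x => -K x) := by
  induction r generalizing K with
  | zero => exact ⟨h.1.neg, fun x => by simpa using h.2 x⟩
  | succ r ih =>
    obtain ⟨h1, D, h2, h3⟩ := h
    exact ⟨⟨h1.1.neg, fun x => by simpa using h1.2 x⟩, fun l x => -D l x,
      fun x => (h2 x).fun_neg.congr_fderiv (by ext v; simp), fun l => ih (h3 l)⟩

theorem sum {ι : Type*} (s : Finset ι) {r : ℕ} {M : ℝ} {K : ι → (Fin N → ℝ) → ℝ}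
    (h : ∀ j ∈ s, HasBddPartials r M (K j)) :
    HasBddPartials r (s.card * M) (fun x => ∑ j ∈ s, K j x) := by
  classical
  induction s using Finset.induction_on with
  | empty => simpa using const (N := N) r 0
  | insert j s hj ih =>
    simp only [Finset.sum_insert hj, Finset.card_insert_of_notMem hj]
    refine ((h j (by simp)).add (ih fun l hl => h l (by simp [hl]))).mono (le_of_eq ?_)
    push_cast
    ring

theorem exists_mul (r : ℕ) (M M' : ℝ) : ∃ M'' : ℝ, ∀ K K' : (Fin N → ℝ) → ℝ,
    HasBddPartials r M K → HasBddPartials r M' K' →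
    HasBddPartials r M'' (fun x => K x * K' x) := by
  have key : ∀ r, ∀ K K' : (Fin N → ℝ) → ℝ, HasBddPartials r M K → HasBddPartials r M' K' →
      Measurable (fun x => K x * K' x) ∧ ∀ x, |K x * K' x| ≤ M * M' := fun r K K' h h' =>
    ⟨h.measurable.mul h'.measurable, fun x => by
      rw [abs_mul]
      exact mul_le_mul (h.bound x) (h'.bound x) (abs_nonneg _) h.nonneg⟩
  induction r with
  | zero => exact ⟨M * M', fun K K' h h' => key 0 K K' h h'⟩
  | succ r ih =>
    obtain ⟨C, hC⟩ := ih
    refine ⟨max (M * M') (C + C), fun K K' h h' => ?_⟩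
    have hk := key _ K K' h h'
    obtain ⟨-, D, h2, h3⟩ := id h
    obtain ⟨-, D', h2', h3'⟩ := id h'
    refine ⟨⟨hk.1, fun x => (hk.2 x).trans (le_max_left _ _)⟩,
      fun l x => K x * D' l x + D l x * K' x, fun x => ?_, fun l =>
        ((hC _ _ h.of_succ (h3' l)).add (hC _ _ (h3 l) h'.of_succ)).mono (le_max_right _ _)⟩
    refine ((h2 x).mul (h2' x)).congr_fderiv ?_
    simp only [add_smul, Finset.sum_add_distrib, Finset.smul_sum, smul_smul, mul_comm (K' x)]

theorem of_coord {r : ℕ} {M : ℝ} {g : ℝ → ℝ} (hg : ContDiff ℝ r g)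
    (hM : ∀ l ≤ r, ∀ v, |iteratedDeriv l g v| ≤ M) (j : Fin N) :
    HasBddPartials r M (fun x => g (x j)) := by
  have hb : ∀ x : Fin N → ℝ, |g (x j)| ≤ M := fun x => by
    simpa using hM 0 (Nat.zero_le _) (x j)
  have hm : Measurable fun x : Fin N → ℝ => g (x j) :=
    hg.continuous.measurable.comp (measurable_pi_apply j)
  induction r generalizing g with
  | zero => exact ⟨hm, hb⟩
  | succ r ih =>
    have hg' : ContDiff ℝ r (deriv g) := by
      have : ContDiff ℝ (r + 1) g := by exact_mod_cast hg
      exact (contDiff_succ_iff_deriv.1 this).2.2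
    have hM' : ∀ l ≤ r, ∀ v, |iteratedDeriv l (deriv g) v| ≤ M := fun l hl v => by
      rw [← iteratedDeriv_succ']; exact hM (l + 1) (by omega) v
    refine ⟨⟨hm, hb⟩, fun l x => if l = j then deriv g (x j) else 0, fun x => ?_, fun l => ?_⟩
    · have h1 : HasFDerivAt (fun x : Fin N → ℝ => g (x j))
          (deriv g (x j) • (ContinuousLinearMap.proj j : (Fin N → ℝ) →L[ℝ] ℝ)) x :=
        ((hg.differentiable (by simp)) (x j)).hasDerivAt.comp_hasFDerivAt x
          (hasFDerivAt_apply j x)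
      refine h1.congr_fderiv ?_
      simp [ite_smul]
    · by_cases hl : l = j
      · simp only [hl, if_true]
        exact ih hg' hM' (fun x => by simpa using hM' 0 (Nat.zero_le _) (x j))
          (hg'.continuous.measurable.comp (measurable_pi_apply j))
      · simp only [hl, if_false]
        exact (const r 0).mono (by simpa using (abs_nonneg _).trans (hb 0))

theorem exists_lieDeriv (r : ℕ) (M B : ℝ) : ∃ M' : ℝ, ∀ (b : ℝ → ℝ) (K : (Fin N → ℝ) → ℝ),
    ContDiff ℝ r b → (∀ l ≤ r, ∀ v, |iteratedDeriv l b v| ≤ B) →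
    HasBddPartials (r + 1) M K → HasBddPartials r M' (lieDeriv b K) := by
  obtain ⟨C, hC⟩ := exists_mul (N := N) r M B
  refine ⟨(Finset.univ : Finset (Fin N)).card * C, fun b K hb hB hK => ?_⟩
  obtain ⟨-, D, h2, h3⟩ := hK
  have : lieDeriv b K = fun x => ∑ l, D l x * b (x l) := by
    funext x
    simp [lieDeriv, (h2 x).fderiv]
  rw [this]
  exact sum Finset.univ fun l _ => hC _ _ (h3 l) (of_coord hb hB l)

theorem exists_comp_jmap (r : ℕ) (M A : ℝ) (hA : 0 ≤ A) : ∃ M' : ℝ,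
    ∀ (aij : Fin N → Fin N → ℝ → ℝ) (i : Fin N) (K : (Fin N → ℝ) → ℝ),
    (∀ j, i ≠ j → ContDiff ℝ (⊤ : ℕ∞) (aij i j)) →
    (∀ j, i ≠ j → ∀ (l : ℕ) (v : ℝ), |iteratedDeriv l (aij i j) v| ≤ A) →
    HasBddPartials r M K → HasBddPartials r M' (fun x => K (jmap N aij i x)) := by
  have hJ : ∀ (aij : Fin N → Fin N → ℝ → ℝ) (i : Fin N),
      (∀ j, i ≠ j → ContDiff ℝ (⊤ : ℕ∞) (aij i j)) → Measurable (jmap N aij i) := by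
    refine fun aij i h => measurable_pi_lambda _ fun j => ?_
    by_cases hj : j = i
    · simp [hj, jmap]
    · simp only [hj, jmap, if_false]
      exact (measurable_pi_apply j).add
        ((h j (Ne.symm hj)).continuous.measurable.comp (measurable_pi_apply j))
  induction r with
  | zero =>
    exact ⟨M, fun aij i K ha hA hK => ⟨hK.1.comp (hJ aij i ha), fun x => hK.2 _⟩⟩
  | succ r ih =>
    obtain ⟨C, hC⟩ := ih
    obtain ⟨C', hC'⟩ := exists_mul (N := N) r C (1 + A)
    refine ⟨max M C', fun aij i K ha hA' hK => ?_⟩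
    obtain ⟨h1, D, h2, h3⟩ := hK
    let w : Fin N → (Fin N → ℝ) → ℝ := fun l x => if l = i then 0 else 1 + deriv (aij i l) (x l)
    refine ⟨⟨h1.1.comp (hJ aij i ha), fun x => (h1.2 _).trans (le_max_left _ _)⟩,
      fun l x => D l (jmap N aij i x) * w l x, fun x => ?_, fun l =>
      (hC' _ _ (hC aij i _ ha hA' (h3 l)) ?_).mono (le_max_right _ _)⟩
    · have hj : HasFDerivAt (jmap N aij i) (ContinuousLinearMap.pi fun l =>
          w l x • (ContinuousLinearMap.proj l : (Fin N → ℝ) →L[ℝ] ℝ)) x := by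
        rw [hasFDerivAt_pi']
        intro l
        by_cases hl : l = i
        · simp only [jmap, hl, if_true, w]
          refine (hasFDerivAt_const (0 : ℝ) x).congr_fderiv ?_
          ext v
          simp
        · have hd : HasDerivAt (fun v => v + aij i l v) (1 + deriv (aij i l) (x l)) (x l) :=
            (hasDerivAt_id _).add
              (((ha l (Ne.symm hl)).differentiable (by simp)) (x l)).hasDerivAt
          have : HasFDerivAt (fun y : Fin N → ℝ => y l + aij i l (y l))
              ((1 + deriv (aij i l) (x l)) •
                (ContinuousLinearMap.proj l : (Fin N → ℝ) →L[ℝ] ℝ)) x :=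
            HasDerivAt.comp_hasFDerivAt (f := fun y : Fin N → ℝ => y l) x hd
              (hasFDerivAt_apply l x)
          simp only [jmap, hl, if_false, w]
          refine this.congr_fderiv ?_
          ext v
          simp [hl]
      refine ((h2 (jmap N aij i x)).comp x hj).congr_fderiv ?_
      ext v
      simp [mul_assoc]
    · by_cases hl : l = i
      · simp only [w, hl, if_true]
        exact (const r 0).mono (by simp; linarith)
      · simp only [w, hl, if_false]
        have hal := ha l (Ne.symm hl)
        have h1 : HasBddPartials r A fun x : Fin N → ℝ => deriv (aij i l) (x l) := by
          refine of_coord ?_ (fun n _ v => ?_) l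
          · have : ContDiff ℝ (r + 1) (aij i l) := hal.of_le (by exact_mod_cast le_top)
            exact (contDiff_succ_iff_deriv.1 this).2.2
          · rw [← iteratedDeriv_succ']
            exact hA' l (Ne.symm hl) (n + 1) v
        simpa using (const (N := N) r 1).add h1

end HasBddPartials

/-- The total jump rate. -/
def totalRate {N : ℕ} (f : Fin N → ℝ → ℝ) (x : Fin N → ℝ) : ℝ := ∑ i, f i (x i)

/-- The process with drift `b`, flow `γ`, jump rates `f i`, jump amplitudes `aij` and a measure `m`
satisfying the representation identity of the invariant measure. -/
structure IsPDMP (N k : ℕ) (F B A a : ℝ) (b : ℝ → ℝ) (γ : ℝ → ℝ → ℝ) (f : Fin N → ℝ → ℝ)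
    (aij : Fin N → Fin N → ℝ → ℝ) (m : Measure (Fin N → ℝ)) : Prop where
  drift_contDiff : ContDiff ℝ (k + 1 : ℕ) b
  drift_bound : ∀ l ≤ k + 1, ∀ v : ℝ, |iteratedDeriv l b v| ≤ B
  flow_zero : ∀ v, γ 0 v = v
  flow_continuous_time : ∀ v, Continuous fun t => γ t v
  flow_continuous : ∀ t, Continuous (γ t)
  flow_hasDerivAt : ∀ v t, 0 < t → HasDerivAt (fun s => γ s v) (b (γ t v)) t
  rate_pos : ∀ i v, 0 < f i v
  rate_contDiff : ∀ i, ContDiff ℝ (k : ℕ) (f i)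
  rate_bound : ∀ i, ∀ l ≤ k, ∀ v : ℝ, |iteratedDeriv l (f i) v| ≤ F
  jump_contDiff : ∀ i j, i ≠ j → ContDiff ℝ (⊤ : ℕ∞) (aij i j)
  jump_bound : ∀ i j, i ≠ j → ∀ (l : ℕ) (v : ℝ), |iteratedDeriv l (aij i j) v| ≤ A
  jump_deriv : ∀ i j, i ≠ j → ∀ v : ℝ, a ≤ |deriv (fun w => w + aij i j w) v|
  rate_infinite : ∀ x : Fin N → ℝ,
    (∫⁻ s in Ioi (0:ℝ), ENNReal.ofReal (totalRate f (flowN N γ s x))) = ⊤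
  isProbabilityMeasure : IsProbabilityMeasure m
  representation : ∀ g : (Fin N → ℝ) → ℝ, Measurable g → (∃ c, ∀ x, |g x| ≤ c) →
    ∫ x, g x ∂m = ∑ i', ∫ x, (f i' (x i') * ∫ t in Ioi (0:ℝ),
      surv N γ f (jmap N aij i' x) t * g (flowN N γ t (jmap N aij i' x))) ∂m

namespace IsPDMP

variable {N k : ℕ} {F B A a : ℝ} {b : ℝ → ℝ} {γ : ℝ → ℝ → ℝ} {f : Fin N → ℝ → ℝ}
  {aij : Fin N → Fin N → ℝ → ℝ} {m : Measure (Fin N → ℝ)}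

theorem rate_continuous (h : IsPDMP N k F B A a b γ f aij m) (i : Fin N) : Continuous (f i) :=
  (h.rate_contDiff i).continuous

theorem rate_le (h : IsPDMP N k F B A a b γ f aij m) (i : Fin N) (v : ℝ) : f i v ≤ F :=
  (le_abs_self _).trans (by simpa using h.rate_bound i 0 (Nat.zero_le _) v)

theorem totalRate_continuous (h : IsPDMP N k F B A a b γ f aij m) : Continuous (totalRate f) :=
  continuous_finsetSum _ fun i _ => (h.rate_continuous i).comp (continuous_apply i)

theorem totalRate_nonneg (h : IsPDMP N k F B A a b γ f aij m) (x : Fin N → ℝ) :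
    0 ≤ totalRate f x :=
  Finset.sum_nonneg fun i _ => (h.rate_pos i _).le

theorem totalRate_pos (h : IsPDMP N k F B A a b γ f aij m) (i : Fin N) (x : Fin N → ℝ) :
    0 < totalRate f x :=
  Finset.sum_pos (fun i _ => h.rate_pos i _) ⟨i, Finset.mem_univ i⟩

theorem totalRate_le (h : IsPDMP N k F B A a b γ f aij m) (x : Fin N → ℝ) :
    totalRate f x ≤ N * F := by
  have := Finset.sum_le_card_nsmul Finset.univ (fun i => f i (x i)) F fun i _ => h.rate_le i _
  simpa [totalRate] using this

theorem jmap_measurable (h : IsPDMP N k F B A a b γ f aij m) (i : Fin N) :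
    Measurable (jmap N aij i) := by
  refine measurable_pi_lambda _ fun j => ?_
  by_cases hj : j = i
  · simp [hj, jmap]
  · simp only [hj, jmap, if_false]
    exact (measurable_pi_apply j).add
      ((h.jump_contDiff i j (Ne.symm hj)).continuous.measurable.comp (measurable_pi_apply j))

theorem flowN_continuous_time (h : IsPDMP N k F B A a b γ f aij m) (x : Fin N → ℝ) :
    Continuous fun t => flowN N γ t x :=
  continuous_pi fun j => h.flow_continuous_time (x j)

theorem flowN_hasDerivAt (h : IsPDMP N k F B A a b γ f aij m) (x : Fin N → ℝ) {t : ℝ}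
    (ht : 0 < t) :
    HasDerivAt (fun s => flowN N γ s x) (fun l => b (flowN N γ t x l)) t :=
  hasDerivAt_pi.2 fun j => h.flow_hasDerivAt (x j) t ht

theorem flowN_measurable (h : IsPDMP N k F B A a b γ f aij m) :
    Measurable fun p : (Fin N → ℝ) × ℝ => flowN N γ p.2 p.1 := by
  have : Measurable (Function.uncurry (flowN N γ)) :=
    measurable_uncurry_of_continuous_of_measurable h.flowN_continuous_time fun t =>
      (continuous_pi fun j => (h.flow_continuous t).comp (continuous_apply j)).measurable
  exact this.comp measurable_swap

theorem surv_eq (x : Fin N → ℝ) (t : ℝ) :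
    surv N γ f x t = Real.exp (-∫ s in (0:ℝ)..t, totalRate f (flowN N γ s x)) := rfl

theorem surv_pos (x : Fin N → ℝ) (t : ℝ) : 0 < surv N γ f x t := Real.exp_pos _

theorem surv_zero (x : Fin N → ℝ) : surv N γ f x 0 = 1 := by simp [surv]

theorem rate_flow_continuous (h : IsPDMP N k F B A a b γ f aij m) (x : Fin N → ℝ) :
    Continuous fun s => totalRate f (flowN N γ s x) :=
  h.totalRate_continuous.comp (h.flowN_continuous_time x)

theorem surv_hasDerivAt (h : IsPDMP N k F B A a b γ f aij m) (x : Fin N → ℝ) (t : ℝ) :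
    HasDerivAt (surv N γ f x) (-(totalRate f (flowN N γ t x) * surv N γ f x t)) t := by
  have h1 : HasDerivAt (fun t => ∫ s in (0:ℝ)..t, totalRate f (flowN N γ s x))
      (totalRate f (flowN N γ t x)) t :=
    ((h.rate_flow_continuous x).integral_hasStrictDerivAt 0 t).hasDerivAt
  have h2 := h1.fun_neg.exp
  rw [← surv_eq, mul_neg, mul_comm] at h2
  exact h2

theorem surv_continuous (h : IsPDMP N k F B A a b γ f aij m) (x : Fin N → ℝ) :
    Continuous (surv N γ f x) :=
  continuous_iff_continuousAt.2 fun t => (h.surv_hasDerivAt x t).continuousAt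

theorem surv_measurable (h : IsPDMP N k F B A a b γ f aij m) :
    Measurable fun p : (Fin N → ℝ) × ℝ => surv N γ f p.1 p.2 := by
  have hm : ∀ s : Set ℝ, Measurable fun x => ∫ t in s, totalRate f (flowN N γ t x) := fun s =>
    (StronglyMeasurable.integral_prod_right (f := fun x t => totalRate f (flowN N γ t x))
      (h.totalRate_continuous.measurable.comp h.flowN_measurable).stronglyMeasurable).measurable
  have : Measurable (Function.uncurry fun t x => surv N γ f x t) :=
    measurable_uncurry_of_continuous_of_measurable h.surv_continuous fun t =>
      Real.measurable_exp.comp ((hm _).sub (hm _)).neg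
  exact this.comp measurable_swap

theorem surv_tendsto (h : IsPDMP N k F B A a b γ f aij m) (x : Fin N → ℝ) :
    Tendsto (surv N γ f x) atTop (𝓝 0) := by
  have hc := h.rate_flow_continuous x
  have hmono : Monotone fun t => ∫ s in (0:ℝ)..t, totalRate f (flowN N γ s x) :=
    monotone_of_hasDerivAt_nonneg (fun t => (hc.integral_hasStrictDerivAt 0 t).hasDerivAt)
      fun t => h.totalRate_nonneg _
  rcases tendsto_atTop_of_monotone hmono with ht | ⟨l, hl⟩
  · exact Real.tendsto_exp_atBot.comp (tendsto_neg_atTop_atBot.comp ht)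
  · exfalso
    have hi : IntegrableOn (fun s => totalRate f (flowN N γ s x)) (Ioi 0) :=
      integrableOn_Ioi_of_intervalIntegral_norm_tendsto (b := id) l 0
        (fun i => (hc.integrableOn_Icc).mono_set Ioc_subset_Icc_self) tendsto_id (by
          simpa [Real.norm_eq_abs, abs_of_nonneg (h.totalRate_nonneg _)] using hl)
    have := hi.lintegral_lt_top
    rw [h.rate_infinite x] at this
    exact lt_irrefl _ this

theorem rate_mul_surv_integrable (h : IsPDMP N k F B A a b γ f aij m) (x : Fin N → ℝ) :
    IntegrableOn (fun t => totalRate f (flowN N γ t x) * surv N γ f x t) (Ioi 0) := by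
  have := integrableOn_Ioi_deriv_of_nonpos' (a := 0) (fun t _ => h.surv_hasDerivAt x t)
    (fun t _ => neg_nonpos.2 (mul_nonneg (h.totalRate_nonneg _) (surv_pos x t).le))
    (h.surv_tendsto x)
  simpa using this.neg

theorem integral_rate_mul_surv (h : IsPDMP N k F B A a b γ f aij m) (x : Fin N → ℝ) :
    ∫ t in Ioi 0, totalRate f (flowN N γ t x) * surv N γ f x t = 1 := by
  have := integral_Ioi_of_hasDerivAt_of_nonpos' (a := 0) (fun t _ => h.surv_hasDerivAt x t)
    (fun t _ => neg_nonpos.2 (mul_nonneg (h.totalRate_nonneg _) (surv_pos x t).le))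
    (h.surv_tendsto x)
  rw [integral_neg, surv_zero] at this
  linarith

/-- `m`-almost every post-jump state has a finite expected waiting time. -/
theorem ae_surv_integrable (h : IsPDMP N k F B A a b γ f aij m) (j : Fin N) :
    ∀ᵐ x ∂m, IntegrableOn (surv N γ f (jmap N aij j x)) (Ioi 0) := by
  have := h.isProbabilityMeasure
  let g : ℕ → (Fin N → ℝ) → ℝ := fun n => {x | ((n : ℝ) + 1)⁻¹ < totalRate f x}.indicator 1
  have hgm : ∀ n, Measurable (g n) := fun n => measurable_one.indicator
    (measurableSet_lt measurable_const h.totalRate_continuous.measurable)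
  have hg0 : ∀ n x, 0 ≤ g n x := fun n x => indicator_nonneg (by simp) _
  have hg1 : ∀ n x, g n x ≤ 1 := fun n x => indicator_le_self' (by simp) _
  have hgr : ∀ n x, g n x ≤ ((n : ℝ) + 1) * totalRate f x := fun n x => by
    by_cases hx : x ∈ {x | ((n : ℝ) + 1)⁻¹ < totalRate f x}
    · have h1 : ((n : ℝ) + 1)⁻¹ < totalRate f x := hx
      have h0 : (0 : ℝ) < n + 1 := by positivity
      have := (mul_lt_mul_of_pos_left h1 h0).le
      rw [mul_inv_cancel₀ h0.ne'] at this
      simpa only [g, indicator_of_mem hx, Pi.one_apply] using this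
    · have := h.totalRate_nonneg x
      simp only [g, indicator_of_notMem hx]
      positivity
  have hgmono : ∀ x, Monotone fun n => g n x := fun x n n' hn => by
    have hs : {y | ((n : ℝ) + 1)⁻¹ < totalRate f y} ⊆ {y | ((n' : ℝ) + 1)⁻¹ < totalRate f y} :=
      fun y hy => by
        refine lt_of_le_of_lt ?_ (show ((n : ℝ) + 1)⁻¹ < totalRate f y from hy)
        gcongr
    exact indicator_le_indicator_of_subset (f := (1 : (Fin N → ℝ) → ℝ)) hs
      (fun _ => zero_le_one) x
  have hglim : ∀ x, Tendsto (fun n => g n x) atTop (𝓝 1) := fun x => by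
    refine tendsto_const_nhds.congr' ?_
    have ht : Tendsto (fun n : ℕ => ((n : ℝ) + 1)⁻¹) atTop (𝓝 0) := by
      simpa using tendsto_one_div_add_atTop_nhds_zero_nat (𝕜 := ℝ)
    filter_upwards [ht.eventually_lt_const (h.totalRate_pos j x)] with n hn
    exact (indicator_of_mem (f := (1 : (Fin N → ℝ) → ℝ))
      (show x ∈ {x | ((n : ℝ) + 1)⁻¹ < totalRate f x} from hn)).symm
  let w : ℕ → Fin N → (Fin N → ℝ) → ℝ → ℝ := fun n i x t =>
    surv N γ f (jmap N aij i x) t * g n (flowN N γ t (jmap N aij i x))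
  have hjp : ∀ i, Measurable fun p : (Fin N → ℝ) × ℝ => (jmap N aij i p.1, p.2) := fun i =>
    ((h.jmap_measurable i).comp measurable_fst).prodMk measurable_snd
  have hwm : ∀ n i, Measurable fun p : (Fin N → ℝ) × ℝ => w n i p.1 p.2 := fun n i =>
    (h.surv_measurable.comp (hjp i)).mul ((hgm n).comp (h.flowN_measurable.comp (hjp i)))
  have hw0 : ∀ n i x t, 0 ≤ w n i x t := fun n i x t => mul_nonneg (surv_pos _ _).le (hg0 _ _)
  have hwle : ∀ n i x t, w n i x t ≤ (n + 1) *
      (totalRate f (flowN N γ t (jmap N aij i x)) * surv N γ f (jmap N aij i x) t) :=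
    fun n i x t => by
      have := mul_le_mul_of_nonneg_left (hgr n (flowN N γ t (jmap N aij i x)))
        (surv_pos (γ := γ) (f := f) (jmap N aij i x) t).le
      calc _ ≤ _ := this
        _ = _ := by ring
  have hwi : ∀ n i x, IntegrableOn (w n i x) (Ioi 0) := fun n i x => by
    refine ((h.rate_mul_surv_integrable (jmap N aij i x)).const_mul ((n : ℝ) + 1)).mono'
      ((hwm n i).comp measurable_prodMk_left).aestronglyMeasurable
      (Eventually.of_forall fun t => ?_)
    rw [Real.norm_eq_abs, abs_of_nonneg (hw0 n i x t)]
    exact hwle n i x t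
  have hwint : ∀ n i x, ∫ t in Ioi 0, w n i x t ≤ n + 1 := fun n i x => by
    calc _ ≤ ∫ t in Ioi 0, ((n : ℝ) + 1) *
          (totalRate f (flowN N γ t (jmap N aij i x)) * surv N γ f (jmap N aij i x) t) :=
        integral_mono (hwi n i x)
          ((h.rate_mul_surv_integrable (jmap N aij i x)).const_mul ((n : ℝ) + 1)) (hwle n i x)
      _ = n + 1 := by rw [integral_const_mul, h.integral_rate_mul_surv, mul_one]
  have hwint0 : ∀ n i x, 0 ≤ ∫ t in Ioi 0, w n i x t := fun n i x =>
    integral_nonneg (hw0 n i x)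
  have houtm : ∀ n i, Measurable fun x => f i (x i) * ∫ t in Ioi 0, w n i x t := fun n i =>
    ((h.rate_continuous i).measurable.comp (measurable_pi_apply i)).mul
      (StronglyMeasurable.integral_prod_right (hwm n i).stronglyMeasurable).measurable
  have hout0 : ∀ n i x, 0 ≤ f i (x i) * ∫ t in Ioi 0, w n i x t := fun n i x =>
    mul_nonneg (h.rate_pos i _).le (hwint0 n i x)
  have houti : ∀ n i, Integrable (fun x => f i (x i) * ∫ t in Ioi 0, w n i x t) m := fun n i => by
    refine Integrable.of_bound (houtm n i).aestronglyMeasurable (F * (n + 1))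
      (Eventually.of_forall fun x => ?_)
    rw [Real.norm_eq_abs, abs_of_nonneg (hout0 n i x)]
    exact mul_le_mul (h.rate_le i _) (hwint n i x) (hwint0 n i x)
      ((h.rate_pos i (x i)).le.trans (h.rate_le i _))
  have hle : ∀ n, ∫ x, (f j (x j) * ∫ t in Ioi 0, w n j x t) ∂m ≤ 1 := fun n => by
    have h1 := h.representation (g n) (hgm n) ⟨1, fun x => by
      rw [abs_of_nonneg (hg0 n x)]; exact hg1 n x⟩
    have h2 : ∫ x, g n x ∂m ≤ 1 := by
      calc _ ≤ ∫ x, (1 : ℝ) ∂m := integral_mono_of_nonneg (Eventually.of_forall (hg0 n))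
            (integrable_const _) (Eventually.of_forall (hg1 n))
        _ = 1 := by simp
    rw [h1] at h2
    exact (Finset.single_le_sum (f := fun i => ∫ x, (f i (x i) * ∫ t in Ioi 0, w n i x t) ∂m)
      (fun i _ => integral_nonneg (hout0 n i)) (Finset.mem_univ j)).trans h2
  let W : ℕ → (Fin N → ℝ) × ℝ → ENNReal := fun n p => ENNReal.ofReal (f j (p.1 j) * w n j p.1 p.2)
  have hfm : Measurable fun p : (Fin N → ℝ) × ℝ => f j (p.1 j) :=
    (h.rate_continuous j).measurable.comp ((measurable_pi_apply j).comp measurable_fst)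
  have hWm : ∀ n, Measurable (W n) := fun n => (hfm.mul (hwm n j)).ennreal_ofReal
  have hWle : ∀ n, ∫⁻ p, W n p ∂(m.prod (volume.restrict (Ioi 0))) ≤ 1 := fun n => by
    rw [lintegral_prod _ (hWm n).aemeasurable]
    have : ∀ x, ∫⁻ t in Ioi 0, W n (x, t) =
        ENNReal.ofReal (f j (x j) * ∫ t in Ioi 0, w n j x t) := fun x => by
      rw [← integral_const_mul, ofReal_integral_eq_lintegral_ofReal ((hwi n j x).const_mul _)
        (Eventually.of_forall fun t => mul_nonneg (h.rate_pos j _).le (hw0 n j x t))]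
    simp_rw [this]
    rw [← ofReal_integral_eq_lintegral_ofReal (houti n j) (Eventually.of_forall (hout0 n j))]
    exact ENNReal.ofReal_le_one.2 (hle n)
  let W' : (Fin N → ℝ) × ℝ → ENNReal := fun p =>
    ENNReal.ofReal (f j (p.1 j) * surv N γ f (jmap N aij j p.1) p.2)
  have hW'm : Measurable W' := (hfm.mul (h.surv_measurable.comp (hjp j))).ennreal_ofReal
  have hlim : Tendsto (fun n => ∫⁻ p, W n p ∂(m.prod (volume.restrict (Ioi 0)))) atTop
      (𝓝 (∫⁻ p, W' p ∂(m.prod (volume.restrict (Ioi 0))))) := by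
    refine lintegral_tendsto_of_tendsto_of_monotone (fun n => (hWm n).aemeasurable)
      (Eventually.of_forall fun p n n' hn => ?_) (Eventually.of_forall fun p => ?_)
    · refine ENNReal.ofReal_le_ofReal (mul_le_mul_of_nonneg_left
        (mul_le_mul_of_nonneg_left (hgmono _ hn) (surv_pos _ _).le) (h.rate_pos j _).le)
    · refine (ENNReal.continuous_ofReal.tendsto _).comp ?_
      simpa using ((hglim (flowN N γ p.2 (jmap N aij j p.1))).const_mul
        (surv N γ f (jmap N aij j p.1) p.2)).const_mul (f j (p.1 j))
  have hfin : ∫⁻ p, W' p ∂(m.prod (volume.restrict (Ioi 0))) ≤ 1 :=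
    le_of_tendsto hlim (Eventually.of_forall hWle)
  rw [lintegral_prod _ hW'm.aemeasurable] at hfin
  have hae := ae_lt_top hW'm.lintegral_prod_right' (hfin.trans_lt ENNReal.one_lt_top).ne
  filter_upwards [hae] with x hx
  have hi : IntegrableOn (fun t => f j (x j) * surv N γ f (jmap N aij j x) t) (Ioi 0) := by
    refine ⟨(continuous_const.mul (h.surv_continuous _)).aestronglyMeasurable, ?_⟩
    rw [hasFiniteIntegral_iff_ofReal (Eventually.of_forall fun t =>
      mul_nonneg (h.rate_pos j _).le (surv_pos _ t).le)]
    exact hx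
  have := hi.const_mul (f j (x j))⁻¹
  simp only [← mul_assoc, inv_mul_cancel₀ (h.rate_pos j (x j)).ne', one_mul] at this
  exact this

/-- Stationarity with respect to the generator. -/
theorem integral_generator (h : IsPDMP N k F B A a b γ f aij m) {g : (Fin N → ℝ) → ℝ} {c : ℝ}
    (hg : Differentiable ℝ g) (hc : ∀ x, |g x| ≤ c) (hLm : Measurable (lieDeriv b g))
    (hL : ∀ x, |lieDeriv b g x| ≤ c) :
    ∫ x, lieDeriv b g x - totalRate f x * g x ∂m
      = -∑ j, ∫ x, f j (x j) * g (jmap N aij j x) ∂m := by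
  let H : (Fin N → ℝ) → ℝ := fun x => lieDeriv b g x - totalRate f x * g x
  have hHm : Measurable H :=
    hLm.sub (h.totalRate_continuous.measurable.mul hg.continuous.measurable)
  have hHb : ∀ x, |H x| ≤ c + N * F * c := fun x => by
    refine (abs_sub _ _).trans (add_le_add (hL x) ?_)
    rw [abs_mul, abs_of_nonneg (h.totalRate_nonneg x)]
    exact mul_le_mul (h.totalRate_le x) (hc x) (abs_nonneg _)
      ((h.totalRate_nonneg x).trans (h.totalRate_le x))
  rw [h.representation H hHm ⟨_, hHb⟩, ← Finset.sum_neg_distrib]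
  refine Finset.sum_congr rfl fun j _ => ?_
  rw [← integral_neg]
  refine integral_congr_ae ?_
  filter_upwards [h.ae_surv_integrable j] with x hx
  set y := jmap N aij j x
  have hd : ∀ t ∈ Ioi (0:ℝ), HasDerivAt (fun t => surv N γ f y t * g (flowN N γ t y))
      (surv N γ f y t * H (flowN N γ t y)) t := fun t ht => by
    have h1 := (hg (flowN N γ t y)).hasFDerivAt.comp_hasDerivAt t (h.flowN_hasDerivAt y ht)
    refine ((h.surv_hasDerivAt y t).mul h1).congr_deriv ?_
    simp only [H, lieDeriv, Function.comp]
    ring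
  have hi : IntegrableOn (fun t => surv N γ f y t * H (flowN N γ t y)) (Ioi 0) :=
    Integrable.mul_bdd hx (hHm.comp (h.flowN_continuous_time y).measurable).aestronglyMeasurable
      (Eventually.of_forall fun t => hHb _)
  have ht : Tendsto (fun t => surv N γ f y t * g (flowN N γ t y)) atTop (𝓝 0) := by
    refine (h.surv_tendsto y).zero_mul_isBoundedUnder_le
      (isBoundedUnder_of ⟨c, fun t => hc _⟩)
  have hcont : Continuous (fun t => surv N γ f y t * g (flowN N γ t y)) :=
    (h.surv_continuous y).mul (hg.continuous.comp (h.flowN_continuous_time y))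
  rw [integral_Ioi_of_hasDerivAt_of_tendsto hcont.continuousWithinAt hd hi ht, surv_zero]
  have : flowN N γ 0 y = y := funext fun l => h.flow_zero _
  rw [this]
  ring

end IsPDMP

/-- The integral of `K` over the superlevel set `{s < u}`. -/
def tailIntegral {X : Type*} [MeasurableSpace X] (m : Measure X) (u K : X → ℝ) (s : ℝ) : ℝ :=
  ∫ x in {x | s < u x}, K x ∂m

section TailIntegral

variable {X : Type*} [MeasurableSpace X] {m : Measure X} {u K : X → ℝ} {c : ℝ}

theorem integrable_of_abs_le [IsFiniteMeasure m] (hK : Measurable K) (hc : ∀ x, |K x| ≤ c) :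
    Integrable K m :=
  Integrable.of_bound hK.aestronglyMeasurable c (Eventually.of_forall hc)

theorem abs_tailIntegral_le [IsProbabilityMeasure m] (hc0 : 0 ≤ c) (hc : ∀ x, |K x| ≤ c) (s : ℝ) :
    |tailIntegral m u K s| ≤ c := by
  have h1 := norm_setIntegral_le_of_norm_le_const (μ := m) (s := {x | s < u x}) (f := K) (C := c)
    (measure_lt_top _ _) fun x _ => hc x
  refine h1.trans ?_
  have : m.real {x | s < u x} ≤ 1 := measureReal_le_one
  nlinarith

theorem measurable_tailIntegral [SFinite m] (hu : Measurable u) (hK : Measurable K) :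
    Measurable (tailIntegral m u K) := by
  have hs : MeasurableSet {p : ℝ × X | p.1 < u p.2} :=
    measurableSet_lt measurable_fst (hu.comp measurable_snd)
  have h1 : Measurable fun p : ℝ × X => {p : ℝ × X | p.1 < u p.2}.indicator (fun p => K p.2) p :=
    (hK.comp measurable_snd).indicator hs
  have h2 := (StronglyMeasurable.integral_prod_right' (ν := m) h1.stronglyMeasurable).measurable
  convert h2 using 1
  funext s
  rw [tailIntegral, ← integral_indicator (measurableSet_lt measurable_const hu)]
  rfl

theorem integral_mul_setIntegral_Iio [IsFiniteMeasure m] (hu : Measurable u) (hK : Measurable K)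
    (hc : ∀ x, |K x| ≤ c) {h : ℝ → ℝ} (hh : Integrable h) :
    ∫ x, K x * (∫ s in Iio (u x), h s) ∂m = ∫ s, h s * tailIntegral m u K s := by
  let S : Set (X × ℝ) := {p | p.2 < u p.1}
  have hS : MeasurableSet S := measurableSet_lt measurable_snd (hu.comp measurable_fst)
  have hi : Integrable (S.indicator fun p => K p.1 * h p.2) (m.prod volume) :=
    ((integrable_of_abs_le hK hc).mul_prod hh).indicator hS
  have h1 := integral_integral_swap (μ := m) (ν := (volume : Measure ℝ))
    (f := fun x s => S.indicator (fun p => K p.1 * h p.2) (x, s)) hi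
  convert h1 using 1
  · refine integral_congr_ae (Eventually.of_forall fun x => ?_)
    simp only
    rw [← integral_const_mul, ← integral_indicator measurableSet_Iio]
    rfl
  · refine integral_congr_ae (Eventually.of_forall fun s => ?_)
    simp only
    rw [tailIntegral, ← integral_const_mul,
      ← integral_indicator (measurableSet_lt measurable_const hu)]
    refine integral_congr_ae (Eventually.of_forall fun x => ?_)
    simp only [indicator, S, mem_ofPred_eq, mul_comm]

theorem tailIntegral_sub [IsFiniteMeasure m] (hu : Measurable u) (hK : Integrable K m) {s s' : ℝ}
    (hs : s ≤ s') :
    tailIntegral m u K s - tailIntegral m u K s' = ∫ x in u ⁻¹' Ioc s s', K x ∂m := by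
  have h1 : {x | s < u x} = u ⁻¹' Ioc s s' ∪ {x | s' < u x} := by
    ext x
    simp only [mem_ofPred_eq, mem_union, mem_preimage, mem_Ioc]
    constructor
    · intro h
      rcases le_or_gt (u x) s' with h' | h'
      · exact Or.inl ⟨h, h'⟩
      · exact Or.inr h'
    · rintro (h | h)
      · exact h.1
      · exact hs.trans_lt h
  have h2 : Disjoint (u ⁻¹' Ioc s s') {x | s' < u x} :=
    Set.disjoint_left.2 fun x hx hx' => not_lt.2 hx.2 hx'
  rw [tailIntegral, h1, setIntegral_union h2 (measurableSet_lt measurable_const hu)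
    hK.integrableOn hK.integrableOn, tailIntegral, add_sub_cancel_right]

end TailIntegral

theorem hasDerivAt_setIntegral_Iio {h : ℝ → ℝ} (hh : Integrable h) (hc : Continuous h) (u : ℝ) :
    HasDerivAt (fun u => ∫ s in Iio u, h s) (h u) u := by
  have h1 : (fun u => ∫ s in Iio u, h s) = fun u => (∫ s in (0:ℝ)..u, h s) + ∫ s in Iic 0, h s := by
    funext u
    rw [← integral_Iic_eq_integral_Iio, ← intervalIntegral.integral_Iic_sub_Iic
      hh.integrableOn hh.integrableOn, sub_add_cancel]
  rw [h1]
  exact ((hc.integral_hasStrictDerivAt 0 u).hasDerivAt).add_const _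

/-- A continuous trapezoid converging to the indicator function of `(s, s']`. -/
def trapezoid (s s' : ℝ) (n : ℕ) (u : ℝ) : ℝ :=
  max 0 (min 1 (min (((n : ℝ) + 1) * (u - s)) (1 - ((n : ℝ) + 1) * (u - s'))))

section Trapezoid

variable {s s' : ℝ}

theorem trapezoid_continuous (n : ℕ) : Continuous (trapezoid s s' n) := by
  unfold trapezoid
  fun_prop

theorem trapezoid_nonneg (n : ℕ) (u : ℝ) : 0 ≤ trapezoid s s' n u := le_max_left _ _

theorem trapezoid_le_one (n : ℕ) (u : ℝ) : trapezoid s s' n u ≤ 1 :=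
  max_le zero_le_one (min_le_left _ _)

theorem trapezoid_eq_zero {n : ℕ} {u : ℝ} (hu : u ≤ s ∨ 1 ≤ ((n : ℝ) + 1) * (u - s')) :
    trapezoid s s' n u = 0 := by
  refine max_eq_left ((min_le_right _ _).trans ?_)
  rcases hu with hu | hu
  · refine (min_le_left _ _).trans (mul_nonpos_of_nonneg_of_nonpos (by positivity) (by linarith))
  · exact (min_le_right _ _).trans (by linarith)

theorem trapezoid_le_indicator (n : ℕ) (u : ℝ) :
    trapezoid s s' n u ≤ (Icc s (s' + 1)).indicator 1 u := by
  by_cases hu : u ∈ Icc s (s' + 1)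
  · rw [indicator_of_mem hu]
    exact trapezoid_le_one n u
  · rw [indicator_of_notMem hu]
    refine (trapezoid_eq_zero ?_).le
    by_contra! hcon
    refine hu ⟨hcon.1.le, ?_⟩
    by_contra! h
    have : (0 : ℝ) ≤ n := n.cast_nonneg
    nlinarith [hcon.2]

theorem tendsto_trapezoid (u : ℝ) :
    Tendsto (fun n => trapezoid s s' n u) atTop (𝓝 ((Ioc s s').indicator 1 u)) := by
  have hlin : ∀ ε : ℝ, 0 < ε → ∀ᶠ n : ℕ in atTop, 1 ≤ ((n : ℝ) + 1) * ε := fun ε hε => by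
    filter_upwards [eventually_ge_atTop ⌈ε⁻¹⌉₊] with n hn
    have h1 : ε⁻¹ ≤ (n : ℝ) := (Nat.le_ceil _).trans (by exact_mod_cast hn)
    have h2 := mul_le_mul_of_nonneg_right h1 hε.le
    rw [inv_mul_cancel₀ hε.ne'] at h2
    nlinarith
  refine tendsto_const_nhds.congr' ?_
  by_cases hs : u ≤ s
  · refine Eventually.of_forall fun n => ?_
    show (Ioc s s').indicator 1 u = trapezoid s s' n u
    rw [trapezoid_eq_zero (Or.inl hs), indicator_of_notMem (fun h => not_lt.2 hs h.1)]
  push Not at hs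
  by_cases hs' : u ≤ s'
  · filter_upwards [hlin (u - s) (by linarith)] with n hn
    have h2 : ((n : ℝ) + 1) * (u - s') ≤ 0 :=
      mul_nonpos_of_nonneg_of_nonpos (by positivity) (by linarith)
    rw [indicator_of_mem (show u ∈ Ioc s s' from ⟨hs, hs'⟩), trapezoid,
      min_eq_left (le_min hn (by linarith)), max_eq_right zero_le_one]
    rfl
  · push Not at hs'
    filter_upwards [hlin (u - s') (by linarith)] with n hn
    rw [trapezoid_eq_zero (Or.inr hn), indicator_of_notMem (fun h => not_lt.2 h.2 hs')]

end Trapezoid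

/-- `b(xⁱ) G` has, as a measure in the variable `xⁱ`, this function as Lebesgue density. -/
def fluxDensity {N : ℕ} (b : ℝ → ℝ) (f : Fin N → ℝ → ℝ) (aij : Fin N → Fin N → ℝ → ℝ)
    (m : Measure (Fin N → ℝ)) (i : Fin N) (G : (Fin N → ℝ) → ℝ) (s : ℝ) : ℝ :=
  tailIntegral m (fun x => x i) (fun x => totalRate f x * G x - lieDeriv b G x) s -
    ∑ j, tailIntegral m (fun x => jmap N aij j x i) (fun x => f j (x j) * G (jmap N aij j x)) s

namespace IsPDMP

variable {N k : ℕ} {F B A a : ℝ} {b : ℝ → ℝ} {γ : ℝ → ℝ → ℝ} {f : Fin N → ℝ → ℝ}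
  {aij : Fin N → Fin N → ℝ → ℝ} {m : Measure (Fin N → ℝ)} {G : (Fin N → ℝ) → ℝ} {M M' : ℝ}

theorem abs_drift_le (h : IsPDMP N k F B A a b γ f aij m) (v : ℝ) : |b v| ≤ B := by
  simpa using h.drift_bound 0 (Nat.zero_le _) v

theorem drift_continuous (h : IsPDMP N k F B A a b γ f aij m) : Continuous b :=
  h.drift_contDiff.continuous

theorem abs_jump_weight_le (h : IsPDMP N k F B A a b γ f aij m) (hM : ∀ x, |G x| ≤ M) (j : Fin N)
    (x : Fin N → ℝ) : |f j (x j) * G (jmap N aij j x)| ≤ F * M := by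
  rw [abs_mul, abs_of_nonneg (h.rate_pos j _).le]
  exact mul_le_mul (h.rate_le j _) (hM _) (abs_nonneg _)
    ((h.rate_pos j (x j)).le.trans (h.rate_le j _))

theorem measurable_jump_weight (h : IsPDMP N k F B A a b γ f aij m) (hG : Measurable G)
    (j : Fin N) : Measurable fun x => f j (x j) * G (jmap N aij j x) :=
  ((h.rate_continuous j).measurable.comp (measurable_pi_apply j)).mul
    (hG.comp (h.jmap_measurable j))

theorem abs_drift_weight_le (h : IsPDMP N k F B A a b γ f aij m) (hM : ∀ x, |G x| ≤ M)
    (hM' : ∀ x, |lieDeriv b G x| ≤ M') (x : Fin N → ℝ) :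
    |totalRate f x * G x - lieDeriv b G x| ≤ N * F * M + M' := by
  refine (abs_sub _ _).trans (add_le_add ?_ (hM' x))
  rw [abs_mul, abs_of_nonneg (h.totalRate_nonneg x)]
  exact mul_le_mul (h.totalRate_le x) (hM x) (abs_nonneg _)
    ((h.totalRate_nonneg x).trans (h.totalRate_le x))

theorem abs_fluxDensity_le (h : IsPDMP N k F B A a b γ f aij m) (hM : ∀ x, |G x| ≤ M)
    (hM' : ∀ x, |lieDeriv b G x| ≤ M') (i : Fin N) (s : ℝ) :
    |fluxDensity b f aij m i G s| ≤ (N * F * M + M') + N * (F * M) := by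
  have := h.isProbabilityMeasure
  refine (abs_sub _ _).trans (add_le_add ?_ ?_)
  · exact abs_tailIntegral_le ((abs_nonneg _).trans (h.abs_drift_weight_le hM hM' 0))
      (h.abs_drift_weight_le hM hM') s
  · refine (Finset.abs_sum_le_sum_abs _ _).trans ?_
    have := Finset.sum_le_card_nsmul Finset.univ (fun j => |tailIntegral m
      (fun x => jmap N aij j x i) (fun x => f j (x j) * G (jmap N aij j x)) s|) (F * M) fun j _ =>
      abs_tailIntegral_le ((abs_nonneg _).trans (h.abs_jump_weight_le hM j 0))
        (h.abs_jump_weight_le hM j) s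
    simpa using this

theorem fluxDensity_measurable (h : IsPDMP N k F B A a b γ f aij m) (hG : Measurable G)
    (hL : Measurable (lieDeriv b G)) (i : Fin N) : Measurable (fluxDensity b f aij m i G) := by
  have := h.isProbabilityMeasure
  refine (measurable_tailIntegral (measurable_pi_apply i)
    ((h.totalRate_continuous.measurable.mul hG).sub hL)).sub (Finset.measurable_sum _ fun j _ => ?_)
  exact measurable_tailIntegral ((measurable_pi_apply i).comp (h.jmap_measurable j))
    (h.measurable_jump_weight hG j)

theorem integral_mul_drift_mul (h : IsPDMP N k F B A a b γ f aij m) (hG : Differentiable ℝ G)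
    (hM : ∀ x, |G x| ≤ M) (hL : Measurable (lieDeriv b G)) (hM' : ∀ x, |lieDeriv b G x| ≤ M')
    (i : Fin N) {φ : ℝ → ℝ} (hφ : Continuous φ) (hφi : Integrable φ) {c : ℝ}
    (hc : ∀ v, |φ v| ≤ c) :
    ∫ x, G x * (b (x i) * φ (x i)) ∂m = ∫ s, φ s * fluxDensity b f aij m i G s := by
  have := h.isProbabilityMeasure
  let H : ℝ → ℝ := fun u => ∫ s in Iio u, φ s
  have hH : ∀ u, HasDerivAt H (φ u) u := hasDerivAt_setIntegral_Iio hφi hφ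
  have hHb : ∀ u, |H u| ≤ ∫ s, |φ s| := fun u => by
    have h1 : |∫ s in Iio u, φ s| ≤ ∫ s in Iio u, |φ s| := abs_integral_le_integral_abs
    refine h1.trans ?_
    exact setIntegral_le_integral hφi.abs (Eventually.of_forall fun s => abs_nonneg (φ s))
  have hHc : Continuous H := continuous_iff_continuousAt.2 fun u => (hH u).continuousAt
  set I := ∫ s, |φ s|
  have hI : 0 ≤ I := integral_nonneg fun s => abs_nonneg _
  have hgd : ∀ x, HasFDerivAt (fun x => G x * H (x i)) (G x • (φ (x i) •
      (ContinuousLinearMap.proj i : (Fin N → ℝ) →L[ℝ] ℝ)) + H (x i) • fderiv ℝ G x) x := fun x =>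
    (hG x).hasFDerivAt.mul (HasDerivAt.comp_hasFDerivAt (f := fun y : Fin N → ℝ => y i) x
      (hH (x i)) (hasFDerivAt_apply i x))
  have hLg : lieDeriv b (fun x => G x * H (x i)) =
      fun x => G x * (b (x i) * φ (x i)) + lieDeriv b G x * H (x i) := by
    funext x
    rw [lieDeriv, (hgd x).fderiv]
    simp [lieDeriv]
    ring
  have hmi := measurable_pi_apply (X := fun _ : Fin N => ℝ) i
  have hbm : Measurable fun x : Fin N → ℝ => b (x i) * φ (x i) :=
    (h.drift_continuous.mul hφ).measurable.comp hmi
  have hHm : Measurable fun x : Fin N → ℝ => H (x i) := hHc.measurable.comp hmi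
  have hM0 : 0 ≤ M := (abs_nonneg _).trans (hM 0)
  have hM0' : 0 ≤ M' := (abs_nonneg _).trans (hM' 0)
  have hc0 : 0 ≤ c := (abs_nonneg _).trans (hc 0)
  have hB0 : 0 ≤ B := (abs_nonneg _).trans (h.abs_drift_le 0)
  have hF0 : 0 ≤ F := (h.rate_pos i 0).le.trans (h.rate_le i 0)
  have hb1 : ∀ x : Fin N → ℝ, |G x * (b (x i) * φ (x i))| ≤ M * (B * c) := fun x => by
    rw [abs_mul, abs_mul]
    exact mul_le_mul (hM x) (mul_le_mul (h.abs_drift_le _) (hc _) (abs_nonneg _) hB0)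
      (by positivity) hM0
  have hb2 : ∀ x : Fin N → ℝ, |lieDeriv b G x * H (x i)| ≤ M' * I := fun x => by
    rw [abs_mul]
    exact mul_le_mul (hM' x) (hHb _) (abs_nonneg _) hM0'
  have hb3 : ∀ x : Fin N → ℝ, |G x * H (x i)| ≤ M * I := fun x => by
    rw [abs_mul]
    exact mul_le_mul (hM x) (hHb _) (abs_nonneg _) hM0
  have hgen := h.integral_generator (g := fun x => G x * H (x i))
    (c := M * (B * c) + M' * I + M * I) (fun x => (hgd x).differentiableAt)
    (fun x => (hb3 x).trans (by have := (abs_nonneg _).trans (hb1 x)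
                                have := (abs_nonneg _).trans (hb2 x)
                                linarith))
    (by rw [hLg]; exact (hG.continuous.measurable.mul hbm).add (hL.mul hHm))
    (fun x => by
      rw [hLg]
      have := (abs_nonneg _).trans (hb3 x)
      linarith [abs_add_le (G x * (b (x i) * φ (x i))) (lieDeriv b G x * H (x i)), hb1 x, hb2 x])
  have hKm : Measurable fun x => totalRate f x * G x - lieDeriv b G x :=
    (h.totalRate_continuous.measurable.mul hG.continuous.measurable).sub hL
  have hKb := h.abs_drift_weight_le hM hM'
  have hi1 : Integrable (fun x => G x * (b (x i) * φ (x i))) m :=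
    integrable_of_abs_le (hG.continuous.measurable.mul hbm) hb1
  have hi2 : Integrable (fun x => (totalRate f x * G x - lieDeriv b G x) * H (x i)) m :=
    Integrable.mul_bdd (integrable_of_abs_le hKm hKb) hHm.aestronglyMeasurable
      (Eventually.of_forall fun x => hHb _)
  have hsplit : ∫ x, lieDeriv b (fun x => G x * H (x i)) x - totalRate f x * (G x * H (x i)) ∂m
      = ∫ x, G x * (b (x i) * φ (x i)) ∂m
        - ∫ x, (totalRate f x * G x - lieDeriv b G x) * H (x i) ∂m := by
    rw [← integral_sub hi1 hi2, hLg]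
    refine integral_congr_ae (Eventually.of_forall fun x => ?_)
    simp only
    ring
  have hjm : ∀ j, Measurable fun x => jmap N aij j x i := fun j => hmi.comp (h.jmap_measurable j)
  have hT1 := integral_mul_setIntegral_Iio (m := m) hmi hKm hKb hφi
  have hT2 : ∀ j, ∫ x, f j (x j) * (G (jmap N aij j x) * H (jmap N aij j x i)) ∂m =
      ∫ s, φ s * tailIntegral m (fun x => jmap N aij j x i)
        (fun x => f j (x j) * G (jmap N aij j x)) s := fun j => by
    simp_rw [← mul_assoc]
    exact integral_mul_setIntegral_Iio (m := m) (hjm j)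
      (h.measurable_jump_weight hG.continuous.measurable j) (h.abs_jump_weight_le hM j) hφi
  have hTi : ∀ (u K : (Fin N → ℝ) → ℝ) (C : ℝ), Measurable u → Measurable K → (∀ x, |K x| ≤ C) →
      Integrable (fun s => φ s * tailIntegral m u K s) := fun u K C hu hK hC =>
    Integrable.mul_bdd hφi (measurable_tailIntegral hu hK).aestronglyMeasurable
      (Eventually.of_forall fun s => abs_tailIntegral_le ((abs_nonneg _).trans (hC 0)) hC s)
  rw [hsplit] at hgen
  simp_rw [hT2] at hgen
  have hH' : ∀ u, ∫ s in Iio u, φ s = H u := fun u => rfl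
  simp_rw [hH'] at hT1
  rw [hT1] at hgen
  simp only [fluxDensity, mul_sub, Finset.mul_sum]
  rw [integral_sub (hTi _ _ _ hmi hKm hKb) (integrable_finsetSum _ fun j _ =>
      hTi _ _ _ (hjm j) (h.measurable_jump_weight hG.continuous.measurable j)
        (h.abs_jump_weight_le hM j)),
    integral_finsetSum _ fun j _ =>
      hTi _ _ _ (hjm j) (h.measurable_jump_weight hG.continuous.measurable j)
        (h.abs_jump_weight_le hM j)]
  linarith

theorem setIntegral_mul_drift_mul (h : IsPDMP N k F B A a b γ f aij m) (hG : Differentiable ℝ G)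
    (hM : ∀ x, |G x| ≤ M) (hL : Measurable (lieDeriv b G)) (hM' : ∀ x, |lieDeriv b G x| ≤ M')
    (i : Fin N) {φ : ℝ → ℝ} (hφ : Continuous φ) {c : ℝ} (hc : ∀ v, |φ v| ≤ c) (s s' : ℝ) :
    ∫ x in (fun x => x i) ⁻¹' Ioc s s', G x * (b (x i) * φ (x i)) ∂m
      = ∫ u in Ioc s s', φ u * fluxDensity b f aij m i G u := by
  have := h.isProbabilityMeasure
  have hmi := measurable_pi_apply (X := fun _ : Fin N => ℝ) i
  have hM0 : 0 ≤ M := (abs_nonneg _).trans (hM 0)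
  have hc0 : 0 ≤ c := (abs_nonneg _).trans (hc 0)
  have hB0 : 0 ≤ B := (abs_nonneg _).trans (h.abs_drift_le 0)
  have hθ : ∀ n u, |trapezoid s s' n u| ≤ (Icc s (s' + 1)).indicator 1 u := fun n u => by
    rw [abs_of_nonneg (trapezoid_nonneg n u)]
    exact trapezoid_le_indicator n u
  have hθ1 : ∀ n u, |trapezoid s s' n u| ≤ 1 := fun n u => by
    rw [abs_of_nonneg (trapezoid_nonneg n u)]
    exact trapezoid_le_one n u
  have hind : Integrable ((Icc s (s' + 1)).indicator (1 : ℝ → ℝ)) :=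
    (integrable_indicator_iff measurableSet_Icc).2 (integrableOn_const (by simp) (by simp))
  have hθc : ∀ n, Continuous fun u => trapezoid s s' n u * φ u := fun n =>
    (trapezoid_continuous n).mul hφ
  have hθi : ∀ n, Integrable fun u => trapezoid s s' n u * φ u := fun n => by
    refine (hind.mul_const c).mono' (hθc n).aestronglyMeasurable (Eventually.of_forall fun u => ?_)
    rw [Real.norm_eq_abs, abs_mul]
    exact mul_le_mul (hθ n u) (hc u) (abs_nonneg _) (indicator_nonneg (by simp) _)
  have key := fun n => h.integral_mul_drift_mul hG hM hL hM' i (hθc n) (hθi n) (c := 1 * c)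
    (fun u => by
      rw [abs_mul]
      exact mul_le_mul (hθ1 n u) (hc u) (abs_nonneg _) zero_le_one)
  have hgm : Measurable fun x : Fin N → ℝ => G x * (b (x i) * φ (x i)) :=
    hG.continuous.measurable.mul ((h.drift_continuous.mul hφ).measurable.comp hmi)
  have hgb : ∀ x : Fin N → ℝ, |G x * (b (x i) * φ (x i))| ≤ M * (B * c) := fun x => by
    rw [abs_mul, abs_mul]
    exact mul_le_mul (hM x) (mul_le_mul (h.abs_drift_le _) (hc _) (abs_nonneg _) hB0)
      (by positivity) hM0
  have hlim1 : Tendsto (fun n => ∫ x, G x * (b (x i) * (trapezoid s s' n (x i) * φ (x i))) ∂m) atTop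
      (𝓝 (∫ x in (fun x => x i) ⁻¹' Ioc s s', G x * (b (x i) * φ (x i)) ∂m)) := by
    rw [← integral_indicator (hmi measurableSet_Ioc)]
    refine tendsto_integral_of_dominated_convergence (fun _ => M * (B * c))
      (fun n => ((hG.continuous.measurable.mul
        ((h.drift_continuous.mul (hθc n)).measurable.comp hmi))).aestronglyMeasurable)
      (integrable_const _) (fun n => Eventually.of_forall fun x => ?_)
      (Eventually.of_forall fun x => ?_)
    · have h1 : G x * (b (x i) * (trapezoid s s' n (x i) * φ (x i))) =
          trapezoid s s' n (x i) * (G x * (b (x i) * φ (x i))) := by ring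
      rw [h1, Real.norm_eq_abs, abs_mul]
      calc _ ≤ 1 * (M * (B * c)) := mul_le_mul (hθ1 n _) (hgb x) (abs_nonneg _) zero_le_one
        _ = _ := one_mul _
    · have h1 := (tendsto_trapezoid (s := s) (s' := s') (x i)).mul_const
        (G x * (b (x i) * φ (x i)))
      convert h1 using 2
      · ring
      · by_cases hx : x i ∈ Ioc s s'
        · rw [indicator_of_mem hx, indicator_of_mem (show x ∈ (fun x => x i) ⁻¹' Ioc s s' from hx)]
          simp
        · rw [indicator_of_notMem hx,
            indicator_of_notMem (show x ∉ (fun x => x i) ⁻¹' Ioc s s' from hx), zero_mul]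
  have hΦm := h.fluxDensity_measurable hG.continuous.measurable hL i
  set P := (N * F * M + M') + N * (F * M)
  have hΦb := h.abs_fluxDensity_le hM hM' i
  have hP : 0 ≤ P := (abs_nonneg _).trans (hΦb 0)
  have hlim2 : Tendsto (fun n => ∫ u, trapezoid s s' n u * φ u * fluxDensity b f aij m i G u) atTop
      (𝓝 (∫ u in Ioc s s', φ u * fluxDensity b f aij m i G u)) := by
    rw [← integral_indicator measurableSet_Ioc]
    refine tendsto_integral_of_dominated_convergence
      (fun u => (Icc s (s' + 1)).indicator 1 u * (c * P))
      (fun n => ((hθc n).measurable.mul hΦm).aestronglyMeasurable)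
      (hind.mul_const _) (fun n => Eventually.of_forall fun u => ?_)
      (Eventually.of_forall fun u => ?_)
    · rw [mul_assoc, Real.norm_eq_abs, abs_mul, abs_mul]
      exact mul_le_mul (hθ n u) (mul_le_mul (hc u) (hΦb u) (abs_nonneg _) hc0) (by positivity)
        (indicator_nonneg (by simp) _)
    · have h1 := (tendsto_trapezoid (s := s) (s' := s') u).mul_const
        (φ u * fluxDensity b f aij m i G u)
      convert h1 using 2
      · ring
      · by_cases hx : u ∈ Ioc s s'
        · simp [indicator_of_mem hx]
        · simp [indicator_of_notMem hx]
  refine tendsto_nhds_unique hlim1 (hlim2.congr fun n => ?_)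
  exact (key n).symm

end IsPDMP

/-- A diffeomorphism of the line at bounded distance from the identity is increasing; its inverse
moves points by the same distance. -/
theorem exists_inverse_id_add {A a : ℝ} (ha : 0 < a) {g : ℝ → ℝ} (hg : ContDiff ℝ (⊤ : ℕ∞) g)
    (hA : ∀ v, |g v| ≤ A) (hd : ∀ v, a ≤ |deriv (fun w => w + g w) v|) :
    ∃ ψ : ℝ → ℝ, (∀ v s, s < v + g v ↔ ψ s < v) ∧ (∀ s, |ψ s - s| ≤ A) ∧
      (∀ s, HasDerivAt ψ (1 + deriv g (ψ s))⁻¹ s) ∧ ∀ s, a ≤ |1 + deriv g (ψ s)| := by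
  have hgd : Differentiable ℝ g := hg.differentiable (by simp)
  have hΔ : ∀ v, HasDerivAt (fun w => w + g w) (1 + deriv g v) v := fun v =>
    (hasDerivAt_id' v).add (hgd v).hasDerivAt
  have hd' : ∀ v, a ≤ |1 + deriv g v| := fun v => by simpa only [(hΔ v).deriv] using hd v
  have hc : Continuous fun v => 1 + deriv g v := continuous_const.add (hg.continuous_deriv (by simp))
  have hne : ∀ v, 1 + deriv g v ≠ 0 := fun v h0 => by
    have := hd' v
    rw [h0, abs_zero] at this
    linarith
  have hΔc : Continuous fun w => w + g w := continuous_id.add hgd.continuous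
  have hpos : ∀ v, 0 < 1 + deriv g v := by
    by_contra! hcon
    obtain ⟨v₀, hv₀⟩ := hcon
    have hneg : ∀ v, 1 + deriv g v < 0 := fun v => by
      by_contra! hv
      obtain ⟨w, hw⟩ := mem_range_of_exists_le_of_exists_ge hc ⟨v₀, hv₀⟩ ⟨v, hv⟩
      exact hne w hw
    have hanti : StrictAnti fun w => w + g w :=
      strictAnti_of_deriv_neg fun v => by rw [(hΔ v).deriv]; exact hneg v
    have hA0 : 0 ≤ A := (abs_nonneg _).trans (hA 0)
    have h1 := hanti (show (0 : ℝ) < 2 * A + 1 by linarith)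
    have h2 := abs_le.1 (hA 0)
    have h3 := abs_le.1 (hA (2 * A + 1))
    simp only at h1
    linarith [h2.2, h3.1]
  have hmono : StrictMono fun w => w + g w :=
    strictMono_of_deriv_pos fun v => by rw [(hΔ v).deriv]; exact hpos v
  have hsurj : Function.Surjective fun w => w + g w := fun s =>
    mem_range_of_exists_le_of_exists_ge hΔc ⟨s - A, by linarith [(abs_le.1 (hA (s - A))).2]⟩
      ⟨s + A, by linarith [(abs_le.1 (hA (s + A))).1]⟩
  let e := hmono.orderIsoOfSurjective _ hsurj
  have he : ∀ v, e v = v + g v := fun v => rfl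
  have hes : ∀ s, e.symm s + g (e.symm s) = s := fun s => e.apply_symm_apply s
  refine ⟨e.symm, fun v s => ?_, fun s => ?_, fun s => ?_, fun s => hd' _⟩
  · rw [← he, e.symm_apply_lt]
  · have h1 : e.symm s - s = -g (e.symm s) := by linarith [hes s]
    rw [h1, abs_neg]
    exact hA _
  · exact (hΔ (e.symm s)).of_local_left_inverse e.symm.continuous.continuousAt (hne _)
      (Eventually.of_forall hes)

theorem HasLipDerivs.exists_inverse_deriv (r : ℕ) (A a : ℝ) (hA : 0 ≤ A) (ha : 0 < a) :
    ∃ C : ℝ, ∀ g ψ : ℝ → ℝ, ContDiff ℝ (⊤ : ℕ∞) g → (∀ (l : ℕ) v, |iteratedDeriv l g v| ≤ A) →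
    (∀ s, HasDerivAt ψ (1 + deriv g (ψ s))⁻¹ s) → (∀ s, a ≤ |1 + deriv g (ψ s)|) →
    HasLipDerivs r C univ fun s => (1 + deriv g (ψ s))⁻¹ := by
  have hg' : ∀ (r : ℕ) (g : ℝ → ℝ), ContDiff ℝ (⊤ : ℕ∞) g →
      (∀ (l : ℕ) v, |iteratedDeriv l g v| ≤ A) →
      HasLipDerivs r (1 + A) univ fun v => 1 + deriv g v := fun r g hg hb => by
    refine (of_locally_const (φ := fun _ => (1 : ℝ)) (by simp) zero_le_one (by simp)
      isOpen_univ).add (of_iteratedDeriv_le univ ?_ fun l _ v => ?_)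
    · have h1 : ContDiff ℝ ((r + 1 : ℕ) + 1) g := hg.of_le (by exact_mod_cast le_top)
      exact (contDiff_succ_iff_deriv.1 h1).2.2
    · rw [← iteratedDeriv_succ']
      exact hb _ v
  induction r with
  | zero =>
    obtain ⟨C, hC⟩ := exists_inv 0 (max (1 + A) ((1 + A) * a⁻¹)) a ha
    refine ⟨C, fun g ψ hg hb hψ hψa => hC _ _ ?_ fun s _ => hψa s⟩
    refine comp_zero (φ := fun v => 1 + deriv g v) (by linarith) (hg' 0 g hg hb)
      (mapsTo_univ ψ _) (fun s _ => hψ s) fun s _ => ?_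
    rw [abs_inv]
    exact inv_anti₀ ha (hψa s)
  | succ r ih =>
    obtain ⟨C, hC⟩ := ih
    obtain ⟨C', hC'⟩ := exists_comp r (1 + A) C (by linarith)
    obtain ⟨C'', hC''⟩ := exists_inv (r + 1) C' a ha
    refine ⟨C'', fun g ψ hg hb hψ hψa => hC'' _ _ ?_ fun s _ => hψa s⟩
    exact hC' univ univ _ ψ _ (hg' (r + 1) g hg hb) (mapsTo_univ _ _) (fun s _ => hψ s)
      (hC g ψ hg hb hψ hψa)

/-- The points from which `r` jumps of size at most `A` lead neither to `0` nor to a point at which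
the speed `|b|` is at most `d`. -/
def fastRegion (b : ℝ → ℝ) (d A B : ℝ) (r : ℕ) : Set ℝ :=
  {v | r * A < |v| ∧ d + r * (A * B) < |b v|}

theorem isOpen_fastRegion {b : ℝ → ℝ} (hb : Continuous b) (d A B : ℝ) (r : ℕ) :
    IsOpen (fastRegion b d A B r) :=
  (isOpen_lt continuous_const continuous_abs).inter (isOpen_lt continuous_const hb.abs)

theorem fastRegion_anti {b : ℝ → ℝ} {d A B : ℝ} (hA : 0 ≤ A) (hB : 0 ≤ B) :
    Antitone (fastRegion b d A B) := fun r r' hr v hv => by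
  have hr' : (r : ℝ) ≤ r' := by exact_mod_cast hr
  exact ⟨(mul_le_mul_of_nonneg_right hr' hA).trans_lt hv.1,
    (add_le_add_right (mul_le_mul_of_nonneg_right hr' (mul_nonneg hA hB)) d).trans_lt hv.2⟩

theorem le_abs_of_mem_fastRegion {b : ℝ → ℝ} {d A B : ℝ} (hA : 0 ≤ A) (hB : 0 ≤ B) {r : ℕ} {v : ℝ}
    (hv : v ∈ fastRegion b d A B r) : d ≤ |b v| := by
  have : 0 ≤ (r : ℝ) * (A * B) := by positivity
  linarith [hv.2]

/-- A bounded continuous function equal to `1 / b` where `d ≤ |b|`. -/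
def cutoffInv (b : ℝ → ℝ) (d : ℝ) (u : ℝ) : ℝ := b u / max (b u ^ 2) (d ^ 2)

section CutoffInv

variable {b : ℝ → ℝ} {d : ℝ}

theorem cutoffInv_continuous (hb : Continuous b) (hd : 0 < d) : Continuous (cutoffInv b d) :=
  hb.div ((hb.pow 2).max continuous_const) fun u => (lt_max_of_lt_right (by positivity)).ne'

theorem abs_cutoffInv_le (hd : 0 < d) (u : ℝ) : |cutoffInv b d u| ≤ d⁻¹ := by
  have h0 : 0 < max (b u ^ 2) (d ^ 2) := lt_max_of_lt_right (by positivity)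
  rw [cutoffInv, abs_div, abs_of_pos h0, div_le_iff₀ h0, ← sq_abs (b u)]
  rcases le_total |b u| d with h | h
  · calc |b u| ≤ d := h
      _ = d⁻¹ * d ^ 2 := by field_simp
      _ ≤ _ := by gcongr; exact le_max_right _ _
  · calc |b u| = d⁻¹ * (d * |b u|) := by field_simp
      _ ≤ d⁻¹ * |b u| ^ 2 := by rw [sq]; gcongr
      _ ≤ _ := by gcongr; exact le_max_left _ _

theorem mul_cutoffInv_nonneg (u : ℝ) : 0 ≤ b u * cutoffInv b d u := by
  rw [cutoffInv, ← mul_div_assoc]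
  exact div_nonneg (mul_self_nonneg _) ((sq_nonneg _).trans (le_max_left _ _))

theorem cutoffInv_eq (hd : 0 < d) {u : ℝ} (hu : d ≤ |b u|) : cutoffInv b d u = (b u)⁻¹ := by
  have h0 : b u ≠ 0 := fun h => by
    rw [h, abs_zero] at hu
    linarith
  rw [cutoffInv, max_eq_left (by rw [← sq_abs (b u)]; gcongr)]
  field_simp

theorem mul_cutoffInv (hd : 0 < d) {u : ℝ} (hu : d ≤ |b u|) : b u * cutoffInv b d u = 1 := by
  have h0 : b u ≠ 0 := fun h => by
    rw [h, abs_zero] at hu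
    linarith
  rw [cutoffInv_eq hd hu, mul_inv_cancel₀ h0]

end CutoffInv

theorem lieDeriv_const {N : ℕ} (b : ℝ → ℝ) (c : ℝ) :
    lieDeriv b (fun _ : Fin N → ℝ => c) = fun _ => 0 := by
  funext x
  simp [lieDeriv]

namespace IsPDMP

variable {N k : ℕ} {F B A a : ℝ} {b : ℝ → ℝ} {γ : ℝ → ℝ → ℝ} {f : Fin N → ℝ → ℝ}
  {aij : Fin N → Fin N → ℝ → ℝ} {m : Measure (Fin N → ℝ)} {G : (Fin N → ℝ) → ℝ} {M M' d : ℝ}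

theorem abs_drift_sub_le (h : IsPDMP N k F B A a b γ f aij m) (u v : ℝ) :
    |b u - b v| ≤ B * |u - v| := by
  have h1 : HasLipDerivs 0 B univ b :=
    HasLipDerivs.of_iteratedDeriv_le univ (h.drift_contDiff.of_le (by
      exact_mod_cast Nat.le_add_left _ _)) fun l hl => h.drift_bound l (by omega)
  exact h1.2 u v (subset_univ _)

theorem drift_bound_nonneg (h : IsPDMP N k F B A a b γ f aij m) : 0 ≤ B :=
  (abs_nonneg _).trans (h.abs_drift_le 0)

theorem mapsTo_fastRegion (h : IsPDMP N k F B A a b γ f aij m) {ψ : ℝ → ℝ}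
    (hψ : ∀ s, |ψ s - s| ≤ A) (r : ℕ) :
    MapsTo ψ (fastRegion b d A B (r + 1)) (fastRegion b d A B r) := fun s hs => by
  obtain ⟨h1, h2⟩ := hs
  have h3 := h.abs_drift_sub_le s (ψ s)
  have h4 : B * |s - ψ s| ≤ B * A :=
    mul_le_mul_of_nonneg_left (by rw [abs_sub_comm]; exact hψ s) h.drift_bound_nonneg
  have h5 := abs_sub_abs_le_abs_sub (b s) (b (ψ s))
  have h6 := abs_sub_abs_le_abs_sub s (ψ s)
  have h7 := hψ s
  rw [abs_sub_comm] at h7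
  push_cast at h1 h2
  constructor
  · linarith
  · linarith

theorem tailIntegral_sub_eq (h : IsPDMP N k F B A a b γ f aij m) (hd : 0 < d)
    (hG : Differentiable ℝ G) (hM : ∀ x, |G x| ≤ M) (hL : Measurable (lieDeriv b G))
    (hM' : ∀ x, |lieDeriv b G x| ≤ M') (i : Fin N) {s s' : ℝ}
    (hs : ∀ v ∈ uIcc s s', d ≤ |b v|) :
    tailIntegral m (fun x => x i) G s - tailIntegral m (fun x => x i) G s' =
      ∫ u in s..s', cutoffInv b d u * fluxDensity b f aij m i G u := by
  have := h.isProbabilityMeasure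
  have hmi := measurable_pi_apply (X := fun _ : Fin N => ℝ) i
  have key : ∀ s s', s ≤ s' → (∀ v ∈ uIcc s s', d ≤ |b v|) →
      tailIntegral m (fun x => x i) G s - tailIntegral m (fun x => x i) G s' =
        ∫ u in s..s', cutoffInv b d u * fluxDensity b f aij m i G u := fun s s' hss hs => by
    rw [tailIntegral_sub hmi (integrable_of_abs_le hG.continuous.measurable hM) hss,
      intervalIntegral.integral_of_le hss,
      ← h.setIntegral_mul_drift_mul hG hM hL hM' i (cutoffInv_continuous h.drift_continuous hd)
        (abs_cutoffInv_le hd) s s']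
    refine setIntegral_congr_fun (hmi measurableSet_Ioc) fun x hx => ?_
    have hx' : x i ∈ uIcc s s' := by
      rw [uIcc_of_le hss]
      exact Ioc_subset_Icc_self hx
    rw [mul_cutoffInv hd (hs _ hx'), mul_one]
  rcases le_total s s' with hss | hss
  · exact key s s' hss hs
  · have := key s' s hss (by rwa [uIcc_comm])
    rw [intervalIntegral.integral_symm]
    linarith

theorem hasLipDerivs_tailIntegral_zero (h : IsPDMP N k F B A a b γ f aij m) (hd : 0 < d)
    (hA : 0 ≤ A) (hG : HasBddPartials 0 M G) (i : Fin N) (r : ℕ) :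
    HasLipDerivs 0 (M + M * (d⁻¹ * (2 * (N * F)))) (fastRegion b d A B r)
      (tailIntegral m (fun x => x i) G) := by
  have := h.isProbabilityMeasure
  have hmi := measurable_pi_apply (X := fun _ : Fin N => ℝ) i
  have hM0 : 0 ≤ M := hG.nonneg
  have hF0 : 0 ≤ F := (h.rate_pos i 0).le.trans (h.rate_le i 0)
  have hΦ : ∀ u, |cutoffInv b d u * fluxDensity b f aij m i (fun _ => 1) u| ≤
      d⁻¹ * (2 * (N * F)) := fun u => by
    have h1 := h.abs_fluxDensity_le (G := fun _ => 1) (M := 1) (M' := 0) (by simp)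
      (by simp [lieDeriv_const]) i u
    rw [abs_mul]
    refine mul_le_mul (abs_cutoffInv_le hd u) (h1.trans (le_of_eq (by ring))) (abs_nonneg _)
      (by positivity)
  have key : ∀ u v, u ≤ v → uIcc u v ⊆ fastRegion b d A B r →
      |tailIntegral m (fun x => x i) G u - tailIntegral m (fun x => x i) G v| ≤
        M * (d⁻¹ * (2 * (N * F))) * |u - v| := fun u v huv huv' => by
    rw [tailIntegral_sub hmi (integrable_of_abs_le hG.measurable hG.bound) huv]
    have h1 := norm_setIntegral_le_of_norm_le_const (μ := m) (f := G) (C := M)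
      (s := (fun x : Fin N → ℝ => x i) ⁻¹' Ioc u v) (measure_lt_top _ _) fun x _ => hG.bound x
    have h2 : m.real ((fun x : Fin N → ℝ => x i) ⁻¹' Ioc u v) =
        ∫ s in u..v, cutoffInv b d s * fluxDensity b f aij m i (fun _ => 1) s := by
      rw [← h.tailIntegral_sub_eq (G := fun _ => 1) (M := 1) (M' := 0) hd
        (differentiable_const _) (by simp) (by simp [lieDeriv_const]) (by simp [lieDeriv_const]) i
        fun w hw => le_abs_of_mem_fastRegion hA h.drift_bound_nonneg (huv' hw),
        tailIntegral_sub hmi (integrable_const _) huv]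
      simp
    have h3 := intervalIntegral.norm_integral_le_of_norm_le_const (a := u) (b := v)
      (f := fun s => cutoffInv b d s * fluxDensity b f aij m i (fun _ => 1) s)
      fun s _ => hΦ s
    rw [← h2, Real.norm_eq_abs, abs_of_nonneg measureReal_nonneg, abs_sub_comm v u] at h3
    refine h1.trans ?_
    rw [mul_assoc]
    exact mul_le_mul_of_nonneg_left h3 hM0
  have hC : 0 ≤ M * (d⁻¹ * (2 * (N * F))) := by positivity
  refine ⟨fun v _ => (abs_tailIntegral_le hM0 hG.bound v).trans (by linarith), fun u v huv => ?_⟩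
  have h1 : |tailIntegral m (fun x => x i) G u - tailIntegral m (fun x => x i) G v| ≤
      M * (d⁻¹ * (2 * (N * F))) * |u - v| := by
    rcases le_total u v with h' | h'
    · exact key u v h' huv
    · rw [abs_sub_comm, abs_sub_comm u]
      exact key v u h' (by rwa [uIcc_comm])
  refine h1.trans (mul_le_mul_of_nonneg_right (by linarith) (abs_nonneg _))

theorem hasDerivAt_tailIntegral (h : IsPDMP N k F B A a b γ f aij m) (hd : 0 < d)
    (hG : Differentiable ℝ G) (hM : ∀ x, |G x| ≤ M) (hL : Measurable (lieDeriv b G))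
    (hM' : ∀ x, |lieDeriv b G x| ≤ M') (i : Fin N) {U : Set ℝ} (hU : IsOpen U)
    (hUd : ∀ v ∈ U, d ≤ |b v|) (hΦ : ContinuousOn (fluxDensity b f aij m i G) U) {v : ℝ}
    (hv : v ∈ U) :
    HasDerivAt (tailIntegral m (fun x => x i) G)
      (-(fluxDensity b f aij m i G v * (b v)⁻¹)) v := by
  have hc := cutoffInv_continuous h.drift_continuous hd
  have hmeas : Measurable fun u => cutoffInv b d u * fluxDensity b f aij m i G u :=
    hc.measurable.mul (h.fluxDensity_measurable hG.continuous.measurable hL i)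
  have h1 : HasDerivAt (fun w => ∫ u in v..w, cutoffInv b d u * fluxDensity b f aij m i G u)
      (cutoffInv b d v * fluxDensity b f aij m i G v) v :=
    intervalIntegral.integral_hasDerivAt_right (by simp)
      ⟨univ, univ_mem, hmeas.aestronglyMeasurable⟩
      (hc.continuousAt.mul (hΦ.continuousAt (hU.mem_nhds hv)))
  rw [cutoffInv_eq hd (hUd v hv), mul_comm] at h1
  refine (h1.const_sub (tailIntegral m (fun x => x i) G v)).congr_of_eventuallyEq ?_
  obtain ⟨ε, hε, hb⟩ := Metric.isOpen_iff.1 hU v hv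
  filter_upwards [Metric.ball_mem_nhds v hε] with w hw
  rw [← h.tailIntegral_sub_eq hd hG hM hL hM' i fun u hu => hUd u (hb
    ((convex_ball v ε).ordConnected.uIcc_subset (Metric.mem_ball_self hε) hw hu)), sub_sub_cancel]

end IsPDMP

section Bootstrap

variable {N k : ℕ} {F B A a d : ℝ}

theorem exists_hasBddPartials_weights (hA : 0 ≤ A) {r : ℕ} (hr : r ≤ k) (M : ℝ) :
    ∃ M' : ℝ, ∀ (b : ℝ → ℝ) (γ : ℝ → ℝ → ℝ) (f : Fin N → ℝ → ℝ) (aij : Fin N → Fin N → ℝ → ℝ)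
      (m : Measure (Fin N → ℝ)) (G : (Fin N → ℝ) → ℝ), IsPDMP N k F B A a b γ f aij m →
      HasBddPartials r M G → HasBddPartials r M (lieDeriv b G) →
      HasBddPartials r M' (fun x => totalRate f x * G x - lieDeriv b G x) ∧
      ∀ j, HasBddPartials r M' (fun x => f j (x j) * G (jmap N aij j x)) := by
  obtain ⟨M₁, h₁⟩ := HasBddPartials.exists_mul (N := N) r
    ((Finset.univ : Finset (Fin N)).card * F) M
  obtain ⟨M₂, h₂⟩ := HasBddPartials.exists_comp_jmap (N := N) r M A hA
  obtain ⟨M₃, h₃⟩ := HasBddPartials.exists_mul (N := N) r F M₂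
  refine ⟨max (M₁ + M) M₃, fun b γ f aij m G h hG hL => ?_⟩
  have hf : ∀ j, HasBddPartials r F (fun x : Fin N → ℝ => f j (x j)) := fun j =>
    HasBddPartials.of_coord ((h.rate_contDiff j).of_le (by exact_mod_cast hr))
      (fun l hl => h.rate_bound j l (hl.trans hr)) j
  constructor
  · have h4 := (h₁ _ _ (HasBddPartials.sum Finset.univ fun j _ => hf j) hG).add hL.neg
    refine HasBddPartials.mono ?_ (le_max_left _ _)
    simp only [sub_eq_add_neg]
    exact h4
  · exact fun j => (h₃ _ _ (hf j) (h₂ aij j G (h.jump_contDiff j) (h.jump_bound j) hG)).mono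
      (le_max_right _ _)

/-- Regularity of the tail integrals on a region gives regularity of the flux densities on the
points at distance at least `A` from the complement of the region. -/
theorem exists_hasLipDerivs_fluxDensity (hA : 0 ≤ A) (ha : 0 < a) {r : ℕ} (hr : r ≤ k)
    (ih : ∀ M, ∃ C, 0 ≤ C ∧ ∀ (b : ℝ → ℝ) (γ : ℝ → ℝ → ℝ) (f : Fin N → ℝ → ℝ)
      (aij : Fin N → Fin N → ℝ → ℝ) (m : Measure (Fin N → ℝ)) (i : Fin N) (G : (Fin N → ℝ) → ℝ),
      IsPDMP N k F B A a b γ f aij m → HasBddPartials r M G →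
      HasLipDerivs r C (fastRegion b d A B r) (tailIntegral m (fun x => x i) G)) (M : ℝ) :
    ∃ C, 0 ≤ C ∧ ∀ (b : ℝ → ℝ) (γ : ℝ → ℝ → ℝ) (f : Fin N → ℝ → ℝ)
      (aij : Fin N → Fin N → ℝ → ℝ) (m : Measure (Fin N → ℝ)) (i : Fin N) (G : (Fin N → ℝ) → ℝ),
      IsPDMP N k F B A a b γ f aij m → HasBddPartials r M G →
      HasBddPartials r M (lieDeriv b G) →
      HasLipDerivs r C (fastRegion b d A B (r + 1)) (fluxDensity b f aij m i G) := by
  obtain ⟨M₁, hM₁⟩ := exists_hasBddPartials_weights (N := N) (F := F) (B := B) (a := a) hA hr M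
  obtain ⟨C, hC0, hC⟩ := ih M₁
  obtain ⟨P, hP⟩ := HasLipDerivs.exists_inverse_deriv r A a hA ha
  obtain ⟨C', hC'⟩ := HasLipDerivs.exists_comp' r C P hC0
  refine ⟨C + (Finset.univ : Finset (Fin N)).card * (max C' M₁ ⊔ 0), by positivity,
    fun b γ f aij m i G h hG hL => ?_⟩
  have := h.isProbabilityMeasure
  have hopen := isOpen_fastRegion h.drift_continuous d A B (r + 1)
  obtain ⟨hw, hj⟩ := hM₁ b γ f aij m G h hG hL
  simp only [funext fun s => show fluxDensity b f aij m i G s = _ from sub_eq_add_neg _ _]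
  refine ((hC b γ f aij m i _ h hw).mono le_rfl
    (fastRegion_anti hA h.drift_bound_nonneg r.le_succ)).add
    (HasLipDerivs.sum Finset.univ hopen fun j _ => ?_).neg
  by_cases hji : j = i
  · subst hji
    have hT : ∀ u v, (u < 0 ↔ v < 0) → tailIntegral m (fun x => jmap N aij j x j)
        (fun x => f j (x j) * G (jmap N aij j x)) u = tailIntegral m (fun x => jmap N aij j x j)
        (fun x => f j (x j) * G (jmap N aij j x)) v := fun u v huv => by
      simp only [tailIntegral, jmap, if_true, huv]
    refine (HasLipDerivs.of_locally_const (C := M₁) (fun v _ => abs_tailIntegral_le (hj j).nonneg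
      (hj j).bound v) (hj j).nonneg (fun u v huv => hT u v ?_) hopen).mono
      ((le_max_right _ _).trans (le_max_left _ _)) le_rfl
    have h0 : (0 : ℝ) ∉ uIcc u v := fun h0 => by
      have h1 := (huv h0).1
      rw [abs_zero] at h1
      have : 0 ≤ ((r + 1 : ℕ) : ℝ) * A := by positivity
      linarith
    rw [mem_uIcc] at h0
    push Not at h0
    constructor
    · intro hu
      exact h0.1 hu.le
    · intro hv
      exact h0.2 hv.le
  · obtain ⟨ψ, hψ, hψA, hψd, hψa⟩ := exists_inverse_id_add ha (h.jump_contDiff j i hji)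
      (fun v => by simpa using h.jump_bound j i hji 0 v) (h.jump_deriv j i hji)
    have hT : ∀ s, tailIntegral m (fun x => jmap N aij j x i)
        (fun x => f j (x j) * G (jmap N aij j x)) s = tailIntegral m (fun x => x i)
        (fun x => f j (x j) * G (jmap N aij j x)) (ψ s) := fun s => by
      have hset : {x : Fin N → ℝ | s < jmap N aij j x i} = {x | ψ s < x i} := by
        ext x
        simp only [jmap, if_neg (Ne.symm hji), mem_ofPred_eq]
        exact hψ (x i) s
      rw [tailIntegral, hset, tailIntegral]
    refine (congrArg (HasLipDerivs r _ _) (funext hT)).mpr ?_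
    exact (hC' _ _ _ ψ _ (hC b γ f aij m i _ h (hj j)) (h.mapsTo_fastRegion hψA r)
      (fun s _ => hψd s) ((hP _ ψ (h.jump_contDiff j i hji) (h.jump_bound j i hji) hψd hψa).mono
        le_rfl (subset_univ _))).mono ((le_max_left _ _).trans (le_max_left _ _)) le_rfl

theorem exists_hasLipDerivs_flux_div (hA : 0 ≤ A) (hd : 0 < d) {r : ℕ} (hr : r ≤ k)
    (C : ℝ) : ∃ C' : ℝ, ∀ (b : ℝ → ℝ) (γ : ℝ → ℝ → ℝ) (f : Fin N → ℝ → ℝ)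
      (aij : Fin N → Fin N → ℝ → ℝ) (m : Measure (Fin N → ℝ)) (Φ : ℝ → ℝ),
      IsPDMP N k F B A a b γ f aij m →
      HasLipDerivs r C (fastRegion b d A B (r + 1)) Φ →
      HasLipDerivs r C' (fastRegion b d A B (r + 1)) (fun v => Φ v * (b v)⁻¹) := by
  obtain ⟨C₁, h₁⟩ := HasLipDerivs.exists_inv r B d hd
  obtain ⟨C₂, h₂⟩ := HasLipDerivs.exists_mul r C C₁
  refine ⟨C₂, fun b γ f aij m Φ h hΦ => h₂ _ _ _ hΦ (h₁ _ _ ?_ fun v hv =>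
    le_abs_of_mem_fastRegion hA h.drift_bound_nonneg hv)⟩
  exact HasLipDerivs.of_iteratedDeriv_le _ (h.drift_contDiff.of_le (by
    exact_mod_cast Nat.add_le_add_right hr 1)) fun l hl => h.drift_bound l (by omega)

theorem exists_hasLipDerivs_tailIntegral (hA : 0 ≤ A) (ha : 0 < a) (hd : 0 < d) (r : ℕ)
    (hr : r ≤ k) (M : ℝ) :
    ∃ C, 0 ≤ C ∧ ∀ (b : ℝ → ℝ) (γ : ℝ → ℝ → ℝ) (f : Fin N → ℝ → ℝ)
      (aij : Fin N → Fin N → ℝ → ℝ) (m : Measure (Fin N → ℝ)) (i : Fin N) (G : (Fin N → ℝ) → ℝ),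
      IsPDMP N k F B A a b γ f aij m → HasBddPartials r M G →
      HasLipDerivs r C (fastRegion b d A B r) (tailIntegral m (fun x => x i) G) := by
  induction r generalizing M with
  | zero =>
    exact ⟨_, le_max_right _ _, fun b γ f aij m i G h hG =>
      (h.hasLipDerivs_tailIntegral_zero hd hA hG i 0).mono (le_max_left _ _) le_rfl⟩
  | succ r ih =>
    have hr' : r ≤ k := by omega
    obtain ⟨M', hM'⟩ := HasBddPartials.exists_lieDeriv (N := N) r M B
    obtain ⟨C, -, hC⟩ := exists_hasLipDerivs_fluxDensity hA ha hr' (ih hr') (max M M')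
    obtain ⟨C', hC'⟩ := exists_hasLipDerivs_flux_div (N := N) (F := F) (B := B) (a := a) hA hd hr' C
    refine ⟨max (max M C') 0, le_max_right _ _, fun b γ f aij m i G h hG => ?_⟩
    have := h.isProbabilityMeasure
    have hL : HasBddPartials r M' (lieDeriv b G) := hM' b G
      (h.drift_contDiff.of_le (by exact_mod_cast (by omega : r ≤ k + 1)))
      (fun l hl => h.drift_bound l (by omega)) hG
    have hΦ := hC b γ f aij m i G h (hG.of_succ.mono (le_max_left _ _))
      (hL.mono (le_max_right _ _))
    have hopen := isOpen_fastRegion h.drift_continuous d A B (r + 1)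
    refine ⟨fun v _ => (abs_tailIntegral_le hG.nonneg hG.bound v).trans
      ((le_max_left _ _).trans (le_max_left _ _)), _, fun v hv =>
      h.hasDerivAt_tailIntegral hd hG.differentiable hG.bound hL.measurable hL.bound i hopen
        (fun v hv => le_abs_of_mem_fastRegion hA h.drift_bound_nonneg hv)
        (hΦ.contDiffOn hopen).continuousOn hv, ?_⟩
    exact (hC' b γ f aij m _ h hΦ).neg.mono ((le_max_right _ _).trans (le_max_left _ _)) le_rfl

theorem exists_hasLipDerivs_density (N k : ℕ) (F B : ℝ) (hA : 0 ≤ A) (ha : 0 < a) (hd : 0 < d) :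
    ∃ C, ∀ (b : ℝ → ℝ) (γ : ℝ → ℝ → ℝ) (f : Fin N → ℝ → ℝ)
      (aij : Fin N → Fin N → ℝ → ℝ) (m : Measure (Fin N → ℝ)) (i : Fin N),
      IsPDMP N k F B A a b γ f aij m →
      HasLipDerivs k C (fastRegion b d A B (k + 1))
        (fun v => fluxDensity b f aij m i (fun _ => 1) v * (b v)⁻¹) := by
  obtain ⟨C, -, hC⟩ := exists_hasLipDerivs_fluxDensity hA ha le_rfl
    (exists_hasLipDerivs_tailIntegral (N := N) (k := k) (F := F) (B := B) hA ha hd k le_rfl) 1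
  obtain ⟨C', hC'⟩ := exists_hasLipDerivs_flux_div (N := N) (F := F) (B := B) (a := a) hA hd
    (le_refl k) C
  refine ⟨C', fun b γ f aij m i h => hC' b γ f aij m _ h (hC b γ f aij m i _ h ?_ ?_)⟩
  · simpa using HasBddPartials.const (N := N) k 1
  · rw [lieDeriv_const]
    exact (HasBddPartials.const (N := N) k 0).mono (by simp)

end Bootstrap

/-- A finite measure on the line which gives the half-open intervals the integral of a bounded
function has that function as density. -/
theorem eq_withDensity_of_Ioc {μ : Measure ℝ} [IsFiniteMeasure μ] {q : ℝ → ℝ} (hq : Measurable q)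
    {c : ℝ} (hc : ∀ v, |q v| ≤ c) (h : ∀ s s', s < s' → μ.real (Ioc s s') = ∫ u in Ioc s s', q u) :
    μ = volume.withDensity fun v => ENNReal.ofReal (q v) := by
  let μp := (volume : Measure ℝ).withDensity fun v => ENNReal.ofReal (q v)
  let μn := (volume : Measure ℝ).withDensity fun v => ENNReal.ofReal (-q v)
  have hqi : ∀ s s', IntegrableOn q (Ioc s s') := fun s s' =>
    Measure.integrableOn_of_bounded (by simp) hq.aestronglyMeasurable
      (Eventually.of_forall fun v => hc v)
  have hp : ∀ s s', μp (Ioc s s') ≠ ⊤ := fun s s' => by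
    rw [withDensity_apply _ measurableSet_Ioc]
    exact (hqi s s').lintegral_lt_top.ne
  have hn : ∀ s s', μn (Ioc s s') ≠ ⊤ := fun s s' => by
    rw [withDensity_apply _ measurableSet_Ioc]
    exact (hqi s s').neg.lintegral_lt_top.ne
  have hadd : μ + μn = μp := by
    refine Measure.ext_of_Ioc' _ _ (fun s s' _ => ?_) fun s s' hs => ?_
    · rw [Measure.add_apply]
      exact ENNReal.add_ne_top.2 ⟨measure_ne_top _ _, hn s s'⟩
    · rw [← ENNReal.toReal_eq_toReal_iff' (by
          rw [Measure.add_apply]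
          exact ENNReal.add_ne_top.2 ⟨measure_ne_top _ _, hn s s'⟩) (hp s s'),
        Measure.add_apply, ENNReal.toReal_add (measure_ne_top _ _) (hn s s')]
      have h1 := h s s' hs
      rw [integral_eq_lintegral_pos_part_sub_lintegral_neg_part (hqi s s'),
        ← withDensity_apply _ measurableSet_Ioc, ← withDensity_apply _ measurableSet_Ioc] at h1
      rw [measureReal_def] at h1
      linarith
  have hs : MeasurableSet {v | q v < 0} := measurableSet_lt hq measurable_const
  have h1 : μn {v | q v < 0} = 0 := by
    have h2 : μp {v | q v < 0} = 0 := by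
      rw [withDensity_apply _ hs]
      refine (setLIntegral_congr_fun hs fun v hv => ENNReal.ofReal_of_nonpos (le_of_lt hv)).trans ?_
      simp
    rw [← hadd, Measure.add_apply, add_eq_zero] at h2
    exact h2.2
  have h2 : μn {v | q v < 0}ᶜ = 0 := by
    rw [withDensity_apply _ hs.compl]
    refine (setLIntegral_congr_fun hs.compl fun v hv => ENNReal.ofReal_of_nonpos ?_).trans
      (by simp)
    simpa using hv
  have h3 : μn = 0 := by
    rw [← Measure.measure_univ_eq_zero, ← union_compl_self {v | q v < 0}]
    exact measure_union_null h1 h2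
  rwa [h3, add_zero] at hadd

section Conclusion

variable {N k : ℕ} {F B A a d : ℝ}

theorem IsPDMP.map_restrict_eq {b : ℝ → ℝ} {γ : ℝ → ℝ → ℝ} {f : Fin N → ℝ → ℝ}
    {aij : Fin N → Fin N → ℝ → ℝ} {m : Measure (Fin N → ℝ)}
    (h : IsPDMP N k F B A a b γ f aij m) (hd : 0 < d) (i : Fin N) {S : Set ℝ}
    (hS : MeasurableSet S) (hSd : ∀ v ∈ S, d ≤ |b v|) :
    (m.map fun x => x i).restrict S = (volume.restrict S).withDensity
      fun v => ENNReal.ofReal (fluxDensity b f aij m i (fun _ => 1) v * (b v)⁻¹) := by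
  have := h.isProbabilityMeasure
  have hmi := measurable_pi_apply (X := fun _ : Fin N => ℝ) i
  have := Measure.isProbabilityMeasure_map (μ := m) hmi.aemeasurable
  have hc := cutoffInv_continuous h.drift_continuous hd
  have hbc : Continuous fun u => b u * cutoffInv b d u := h.drift_continuous.mul hc
  have hbcb : ∀ u, |b u * cutoffInv b d u| ≤ B * d⁻¹ := fun u => by
    rw [abs_mul]
    exact mul_le_mul (h.abs_drift_le u) (abs_cutoffInv_le hd u) (abs_nonneg _) h.drift_bound_nonneg
  have hL := lieDeriv_const (N := N) b 1
  have hLm : Measurable (lieDeriv b fun _ : Fin N → ℝ => 1) := by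
    rw [hL]
    exact measurable_const
  have hLb : ∀ x, |lieDeriv b (fun _ : Fin N → ℝ => 1) x| ≤ 0 := by simp [hL]
  have hi : Integrable (fun u => b u * cutoffInv b d u) (m.map fun x => x i) :=
    integrable_of_abs_le hbc.measurable hbcb
  let μ := (m.map fun x => x i).withDensity fun u => ENNReal.ofReal (b u * cutoffInv b d u)
  have : IsFiniteMeasure μ := isFiniteMeasure_withDensity_ofReal hi.2
  have hμ : μ = volume.withDensity fun v =>
      ENNReal.ofReal (cutoffInv b d v * fluxDensity b f aij m i (fun _ => 1) v) := by
    refine eq_withDensity_of_Ioc (hc.measurable.mul (h.fluxDensity_measurable measurable_const hLm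
      i)) (c := d⁻¹ * ((N * F * 1 + 0) + N * (F * 1))) (fun v => ?_) fun s s' _ => ?_
    · rw [abs_mul]
      exact mul_le_mul (abs_cutoffInv_le hd v) (h.abs_fluxDensity_le (by simp) hLb i v)
        (abs_nonneg _) (inv_pos.2 hd).le
    · rw [measureReal_def, withDensity_apply _ measurableSet_Ioc,
        ← integral_eq_lintegral_of_nonneg_ae (Eventually.of_forall fun u => mul_cutoffInv_nonneg u)
          hbc.aestronglyMeasurable,
        setIntegral_map measurableSet_Ioc hbc.aestronglyMeasurable hmi.aemeasurable,
        ← h.setIntegral_mul_drift_mul (G := fun _ => 1) (M := 1) (differentiable_const _) (by simp)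
          hLm hLb i hc (abs_cutoffInv_le hd) s s']
      simp
  have hr := congrArg (fun μ => Measure.restrict μ S) hμ
  simp only [μ, restrict_withDensity hS] at hr
  have h1 : ((m.map fun x => x i).restrict S).withDensity
      (fun u => ENNReal.ofReal (b u * cutoffInv b d u)) = (m.map fun x => x i).restrict S := by
    rw [withDensity_congr_ae (g := 1), withDensity_one]
    filter_upwards [ae_restrict_mem hS] with v hv
    simp [mul_cutoffInv hd (hSd v hv)]
  rw [h1] at hr
  rw [hr]
  refine withDensity_congr_ae ?_
  filter_upwards [ae_restrict_mem hS] with v hv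
  rw [cutoffInv_eq hd (hSd v hv), mul_comm]

theorem abs_sub_le_holder {δ C x y t α : ℝ} (hδ : 0 < δ) (hα0 : 0 < α) (hα1 : α < 1) (ht : 0 < t)
    (hC : 0 ≤ C) (hx : |x| ≤ C) (hy : |y| ≤ C) (h : t ≤ δ → |x - y| ≤ C * t) :
    |x - y| ≤ C * (1 + δ ^ (1 - α) + 2 * δ ^ (-α)) * t ^ α := by
  have h1 : 0 < δ ^ (1 - α) := Real.rpow_pos_of_pos hδ _
  have h2 : 0 < δ ^ (-α) := Real.rpow_pos_of_pos hδ _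
  have h3 : 0 < t ^ α := Real.rpow_pos_of_pos ht _
  rcases le_total t δ with hle | hle
  · have h4 : t = t ^ (1 - α) * t ^ α := by
      rw [← Real.rpow_add ht, sub_add_cancel, Real.rpow_one]
    have h5 : t ^ (1 - α) ≤ δ ^ (1 - α) := Real.rpow_le_rpow ht.le hle (by linarith)
    calc |x - y| ≤ C * t := h hle
      _ = C * t ^ (1 - α) * t ^ α := by rw [mul_assoc, ← h4]
      _ ≤ _ := by
        gcongr
        linarith
  · have h4 : 1 = δ ^ (-α) * δ ^ α := by rw [← Real.rpow_add hδ, neg_add_cancel, Real.rpow_zero]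
    have h5 : δ ^ α ≤ t ^ α := Real.rpow_le_rpow hδ.le hle hα0.le
    have h6 : 1 ≤ δ ^ (-α) * t ^ α := h4.le.trans (mul_le_mul_of_nonneg_left h5 h2.le)
    calc |x - y| ≤ |x| + |y| := abs_sub _ _
      _ ≤ C * 2 * 1 := by linarith
      _ ≤ C * 2 * (δ ^ (-α) * t ^ α) := by gcongr
      _ = C * (2 * δ ^ (-α)) * t ^ α := by ring
      _ ≤ _ := by
        gcongr
        linarith

theorem exists_marginal_density (N k : ℕ) (F B : ℝ) {α : ℝ} (hA : 0 < A) (ha : 0 < a) (hd : 0 < d)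
    (hα0 : 0 < α) (hα1 : α < 1) :
    ∃ C, ∀ (b : ℝ → ℝ) (γ : ℝ → ℝ → ℝ) (f : Fin N → ℝ → ℝ)
      (aij : Fin N → Fin N → ℝ → ℝ) (m : Measure (Fin N → ℝ)) (i : Fin N) (S : Set ℝ),
      IsPDMP N k F B A a b γ f aij m → S = fastRegion b d A B (k + 2) →
      ∃ p : ℝ → ℝ,
        (m.map fun x => x i).restrict S =
          (volume.restrict S).withDensity (fun v => ENNReal.ofReal (p v)) ∧
        ContinuousOn p S ∧ (∀ v ∈ S, |p v| ≤ C) ∧ ContDiffOn ℝ (k : ℕ) p S ∧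
        (∀ l ≤ k, ∀ v ∈ S, |iteratedDerivWithin l p S v| ≤ C) ∧
        (∀ v ∈ S, ∀ v' ∈ S, v ≠ v' →
          |iteratedDerivWithin k p S v - iteratedDerivWithin k p S v'| ≤ C * |v - v'| ^ α) := by
  obtain ⟨C, hC⟩ := exists_hasLipDerivs_density N k F B hA.le ha hd
  refine ⟨|C| * (1 + A ^ (1 - α) + 2 * A ^ (-α)), fun b γ f aij m i S h hS => ?_⟩
  have hp := (hC b γ f aij m i h).mono (le_abs_self C) le_rfl
  have hopen := isOpen_fastRegion h.drift_continuous d A B (k + 1)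
  have hSo : IsOpen S := hS ▸ isOpen_fastRegion h.drift_continuous d A B (k + 2)
  have hSU : S ⊆ fastRegion b d A B (k + 1) :=
    hS ▸ fastRegion_anti hA.le h.drift_bound_nonneg (k + 1).le_succ
  have hC' : |C| ≤ |C| * (1 + A ^ (1 - α) + 2 * A ^ (-α)) := by
    have h1 : 0 < A ^ (1 - α) := Real.rpow_pos_of_pos hA _
    have h2 : 0 < A ^ (-α) := Real.rpow_pos_of_pos hA _
    exact le_mul_of_one_le_right (abs_nonneg _) (by linarith)
  have hp' := hp.contDiffOn hopen
  refine ⟨_, h.map_restrict_eq hd i hSo.measurableSet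
    (fun v hv => le_abs_of_mem_fastRegion hA.le h.drift_bound_nonneg (hSU hv)),
    hp'.continuousOn.mono hSU, fun v hv => (hp.bound v (hSU hv)).trans hC', hp'.mono hSU,
    fun l hl v hv => ?_, fun v hv v' hv' hvv' => ?_⟩
  · rw [iteratedDerivWithin_of_isOpen hSo hv]
    exact (hp.iteratedDeriv_le hopen hl (hSU hv)).trans hC'
  · rw [iteratedDerivWithin_of_isOpen hSo hv, iteratedDerivWithin_of_isOpen hSo hv']
    refine abs_sub_le_holder hA hα0 hα1 (abs_pos.2 (sub_ne_zero.2 hvv')) (abs_nonneg C)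
      (hp.iteratedDeriv_le hopen le_rfl (hSU hv)) (hp.iteratedDeriv_le hopen le_rfl (hSU hv'))
      fun hle => hp.iteratedDeriv_sub_le hopen fun w hw => ?_
    have hw' : |w - v| ≤ A := by
      refine (abs_sub_left_of_mem_uIcc hw).trans ?_
      rwa [abs_sub_comm]
    have h1 := h.mapsTo_fastRegion (d := d) (ψ := fun s => s + (w - v)) (fun s => by simpa using hw')
      (k + 1) (show v ∈ fastRegion b d A B (k + 1 + 1) from hS ▸ hv)
    simpa using h1

theorem IsPDMP.of_forward_flow {b : ℝ → ℝ} {γ : ℝ → ℝ → ℝ} {f : Fin N → ℝ → ℝ}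
    {aij : Fin N → Fin N → ℝ → ℝ} {m : Measure (Fin N → ℝ)} (hm : IsProbabilityMeasure m)
    (hb : ContDiff ℝ (k + 1 : ℕ) b) (hbB : ∀ l ≤ k + 1, ∀ v : ℝ, |iteratedDeriv l b v| ≤ B)
    (hγ0 : ∀ v, γ 0 v = v)
    (hγ : ∀ v t, 0 ≤ t → HasDerivAt (fun s => γ s v) (b (γ t v)) t)
    (hf : ∀ i v, 0 < f i v) (hfk : ∀ i, ContDiff ℝ (k : ℕ) (f i))
    (hfF : ∀ i, ∀ l ≤ k, ∀ v : ℝ, |iteratedDeriv l (f i) v| ≤ F)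
    (haij : ∀ i j, i ≠ j → ContDiff ℝ (⊤ : ℕ∞) (aij i j))
    (haA : ∀ i j, i ≠ j → ∀ (l : ℕ) (v : ℝ), |iteratedDeriv l (aij i j) v| ≤ A)
    (haa : ∀ i j, i ≠ j → ∀ v : ℝ, a ≤ |deriv (fun w => w + aij i j w) v|)
    (hinf : ∀ x : Fin N → ℝ, (∫⁻ s in Ioi (0:ℝ), ENNReal.ofReal (∑ i, f i (γ s (x i)))) = ⊤)
    (hrep : ∀ g : (Fin N → ℝ) → ℝ, Measurable g → (∃ c, ∀ x, |g x| ≤ c) →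
      ∫ x, g x ∂m = ∑ i, ∫ x, (f i (x i) * ∫ t in Ioi (0:ℝ),
        surv N γ f (jmap N aij i x) t * g (flowN N γ t (jmap N aij i x))) ∂m) :
    IsPDMP N k F B A a b (fun t => γ (max t 0)) f aij m := by
  have hflow : ∀ t, 0 ≤ t → ∀ x, flowN N (fun t => γ (max t 0)) t x = flowN N γ t x :=
    fun t ht x => by
      show (fun j => γ (max t 0) (x j)) = _
      rw [max_eq_left ht]
      rfl
  have hsurv : ∀ t, 0 ≤ t → ∀ x, surv N (fun t => γ (max t 0)) f x t = surv N γ f x t :=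
    fun t ht x => by
      unfold surv
      congr 2
      refine intervalIntegral.integral_congr fun s hs => ?_
      rw [uIcc_of_le ht] at hs
      simp only [max_eq_left hs.1]
  have hγc : ∀ v t, 0 ≤ t → ContinuousAt (fun s => γ s v) t := fun v t ht => (hγ v t ht).continuousAt
  have hB0 : 0 ≤ B := (abs_nonneg _).trans (hbB 0 (Nat.zero_le _) 0)
  have hLip : LipschitzWith B.toNNReal b := LipschitzWith.of_dist_le_mul fun u v => by
    have h1 : HasLipDerivs 0 B univ b := HasLipDerivs.of_iteratedDeriv_le univ (hb.of_le (by
      exact_mod_cast Nat.le_add_left _ _)) fun l hl => hbB l (by omega)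
    rw [Real.dist_eq, Real.dist_eq, Real.coe_toNNReal _ hB0]
    exact h1.2 u v (subset_univ _)
  refine ⟨hb, hbB, fun v => by simp [hγ0], fun v => ?_, fun t => ?_, fun v t ht => ?_, hf, hfk, hfF,
    haij, haA, haa, fun x => ?_, hm, fun g hg hgb => ?_⟩
  · exact continuous_iff_continuousAt.2 fun t => (hγc v _ (le_max_right t 0)).comp
      (f := fun t => max t 0) (continuous_id.max continuous_const).continuousAt
  · have ht := le_max_right t 0
    generalize max t 0 = t at ht
    have h1 : LipschitzWith (Real.exp (B * t)).toNNReal (γ t) :=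
      LipschitzWith.of_dist_le_mul fun u v => by
        have h2 := dist_le_of_trajectories_ODE (v := fun _ => b) (fun _ => hLip)
          (fun s hs => (hγc u s hs.1).continuousWithinAt)
          (fun s hs => (hγ u s hs.1).hasDerivWithinAt)
          (fun s hs => (hγc v s hs.1).continuousWithinAt)
          (fun s hs => (hγ v s hs.1).hasDerivWithinAt) le_rfl t ⟨ht, le_rfl⟩
        rw [hγ0, hγ0, sub_zero, Real.coe_toNNReal _ hB0] at h2
        rw [Real.coe_toNNReal _ (Real.exp_pos _).le, mul_comm]
        exact h2
    exact h1.continuous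
  · simp only [max_eq_left ht.le]
    refine (hγ v t ht.le).congr_of_eventuallyEq ?_
    filter_upwards [lt_mem_nhds ht] with s hs
    rw [max_eq_left (le_of_lt hs)]
  · rw [← hinf x]
    refine setLIntegral_congr_fun measurableSet_Ioi fun s hs => ?_
    simp only [totalRate, hflow s (le_of_lt hs)]
    rfl
  · rw [hrep g hg hgb]
    refine Finset.sum_congr rfl fun i _ => integral_congr_ae (Eventually.of_forall fun x => ?_)
    simp only
    congr 1
    refine setIntegral_congr_fun measurableSet_Ioi fun t ht => ?_
    simp only [hflow t (le_of_lt ht), hsurv t (le_of_lt ht)]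

end Conclusion

end Auxiliary

/-- Theorem `theo:invmeasure`: for every `d > (k+2)·A·B`, the law `π` of the
`i`-th coordinate under the invariant measure `m` has, on `S_{d,k+2}`, a bounded continuous
Lebesgue density `p_π` of class `C^k`, all of whose derivatives up to order `k`, as well as
the `α`-Hölder constant of the `k`-th derivative, are bounded by a constant `C` depending
only on `N, k, d, A, a, F, B, α` — and in particular not on `b̃`, the `f_i`, the `a_i^j`,
or `m`. -/
theorem marginal_invariant_density_regularity
    (N k : ℕ) (hN : 1 ≤ N) (F B A a d α : ℝ)
    (hF : 0 < F) (hB : 0 < B) (hA : 0 < A) (ha : 0 < a)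
    (hd : ((k : ℝ) + 2) * A * B < d) (hα0 : 0 < α) (hα1 : α < 1) :
    ∃ C : ℝ, ∀ (i : Fin N)
      (btilde : ℝ → ℝ), ContDiff ℝ (k + 1 : ℕ) btilde →
      (∀ l ≤ k + 1, ∀ v : ℝ, |iteratedDeriv l btilde v| ≤ B) →
      ∀ γt : ℝ → ℝ → ℝ, (∀ v : ℝ, γt 0 v = v) →
      (∀ (v t : ℝ), 0 ≤ t → HasDerivAt (fun s => γt s v) (btilde (γt t v)) t) →
      ∀ f : Fin N → ℝ → ℝ, (∀ i' v, 0 < f i' v) →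
      (∀ i', ∃ L : NNReal, LipschitzWith L (f i')) →
      (∀ i', ContDiff ℝ (k : ℕ) (f i')) →
      (∀ i', ∀ l ≤ k, ∀ v : ℝ, |iteratedDeriv l (f i') v| ≤ F) →
      ∀ aij : Fin N → Fin N → ℝ → ℝ,
      (∀ i' j, i' ≠ j → ContDiff ℝ (⊤ : ℕ∞) (aij i' j)) →
      (∀ i' j, i' ≠ j → ∀ (l : ℕ) (v : ℝ), |iteratedDeriv l (aij i' j) v| ≤ A) →
      (∀ i' j, i' ≠ j → ∀ v : ℝ, a ≤ |deriv (fun w => w + aij i' j w) v|) →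
      (∀ x : Fin N → ℝ,
        (∫⁻ s in Ioi (0:ℝ), ENNReal.ofReal (∑ i', f i' (γt s (x i')))) = ⊤) →
      ∀ m : Measure (Fin N → ℝ), IsProbabilityMeasure m →
      (∀ g : (Fin N → ℝ) → ℝ, Measurable g → (∃ c, ∀ x, |g x| ≤ c) →
        ∫ x, g x ∂m
          = ∑ i', ∫ x, (f i' (x i') *
              ∫ t in Ioi (0:ℝ),
                surv N γt f (jmap N aij i' x) t *
                  g (flowN N γt t (jmap N aij i' x))) ∂m) →
      ∃ p : ℝ → ℝ,
        (m.map (fun x => x i)).restrict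
            {v : ℝ | ((k : ℝ) + 2) * A < |v| ∧ d < |btilde v|}
          = (volume.restrict {v : ℝ | ((k : ℝ) + 2) * A < |v| ∧ d < |btilde v|}).withDensity
              (fun v => ENNReal.ofReal (p v)) ∧
        ContinuousOn p {v : ℝ | ((k : ℝ) + 2) * A < |v| ∧ d < |btilde v|} ∧
        (∀ v ∈ {v : ℝ | ((k : ℝ) + 2) * A < |v| ∧ d < |btilde v|}, |p v| ≤ C) ∧
        ContDiffOn ℝ (k : ℕ) p {v : ℝ | ((k : ℝ) + 2) * A < |v| ∧ d < |btilde v|} ∧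
        (∀ l ≤ k, ∀ v ∈ {v : ℝ | ((k : ℝ) + 2) * A < |v| ∧ d < |btilde v|},
          |iteratedDerivWithin l p {v : ℝ | ((k : ℝ) + 2) * A < |v| ∧ d < |btilde v|} v|
            ≤ C) ∧
        (∀ v ∈ {v : ℝ | ((k : ℝ) + 2) * A < |v| ∧ d < |btilde v|},
          ∀ v' ∈ {v : ℝ | ((k : ℝ) + 2) * A < |v| ∧ d < |btilde v|}, v ≠ v' →
            |iteratedDerivWithin k p {v : ℝ | ((k : ℝ) + 2) * A < |v| ∧ d < |btilde v|} v -
              iteratedDerivWithin k p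
                {v : ℝ | ((k : ℝ) + 2) * A < |v| ∧ d < |btilde v|} v'|
              ≤ C * |v - v'| ^ α) := by
  obtain ⟨C, hC⟩ := exists_marginal_density N k F B (d := d - ((k : ℝ) + 2) * A * B) hA ha
    (sub_pos.2 hd) hα0 hα1
  refine ⟨C, fun i b hb hbB γ hγ0 hγ f hf _ hfk hfF aij haij haA haa hinf m hm hrep => ?_⟩
  refine hC b _ f aij m i _ (IsPDMP.of_forward_flow hm hb hbB hγ0 hγ hf hfk hfF haij haA haa hinf
    hrep) ?_
  ext v
  simp only [fastRegion, mem_ofPred_eq]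
  push_cast
  rw [show d - ((k : ℝ) + 2) * A * B + ((k : ℝ) + 2) * (A * B) = d by ring]
end
end
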